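/- arXiv:1806.11087 — 2 statements merged into one kernel-verified Lean document; each statement's English description precedes it below -/
import Mathlib

section
/- Let E and F be countable directed graphs satisfying Conditions (L) and (T) and having no degenerate vertices. Then every abstract group isomorphism Φ : G_E → G_F is spatially implemented: there exists a homeomorphism φ : ∂E → ∂F such that Φ(γ) = φ ∘ γ ∘ φ⁻¹ for every γ ∈ G_E. -/
/-! ## Directed graphs, paths, and the boundary path space -/

/-- A directed graph: edge set `E`, vertex set `V`, source and range maps. -/
structure DGraph (V : Type*) (E : Type*) where
  s : E → V
  r : E → V

variable {V E : Type*}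

/-- A finite path in a directed graph: a base (source) vertex together with a finite
sequence of composable edges; vertices are the trivial paths. -/
structure FinPath (G : DGraph V E) where
  src : V
  edges : List E
  src_eq : ∀ e ∈ edges.head?, G.s e = src
  chain : edges.Chain' fun e f => G.r e = G.s f

namespace FinPath

variable {G : DGraph V E}

/-- The range (terminal vertex) of a finite path. -/
def rng (μ : FinPath G) : V := μ.edges.getLast?.elim μ.src G.r

/-- `μ ≤ ν`: `ν` extends `μ`, i.e. `ν = μλ` for some (possibly trivial) path `λ`. -/
def Le (μ ν : FinPath G) : Prop := μ.src = ν.src ∧ μ.edges <+: ν.edges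

/-- Two finite paths are disjoint if neither is an initial segment of the other. -/
def Disjoint (μ ν : FinPath G) : Prop := ¬ Le μ ν ∧ ¬ Le ν μ

/-- A cycle: a nontrivial path returning to its base vertex. -/
def IsCycle (μ : FinPath G) : Prop := μ.edges ≠ [] ∧ μ.rng = μ.src

/-- A return path: a cycle not passing through its base vertex in between. -/
def IsReturnPath (μ : FinPath G) : Prop :=
  IsCycle μ ∧ ∀ (i : ℕ) (h : i + 1 < μ.edges.length),
    G.r (μ.edges.get ⟨i, Nat.lt_of_succ_lt h⟩) ≠ μ.rng

/-- A path has an exit. -/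
def HasExit (μ : FinPath G) : Prop :=
  ∃ (i : Fin μ.edges.length) (e : E),
    G.s e = G.s (μ.edges.get i) ∧ e ≠ μ.edges.get i

end FinPath

/-- The trivial path at a vertex. -/
def trivialPath (G : DGraph V E) (v : V) : FinPath G :=
  ⟨v, [], by intro e he; simp at he, List.IsChain.nil⟩

/-- An infinite path in a directed graph. -/
structure InfPath (G : DGraph V E) where
  edges : ℕ → E
  chain : ∀ i, G.r (edges i) = G.s (edges (i + 1))

/-- The source vertex of an infinite path. -/
def InfPath.src {G : DGraph V E} (x : InfPath G) : V := G.s (x.edges 0)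

/-- A wandering infinite path: it visits each vertex only finitely often. -/
def Wandering {G : DGraph V E} (x : InfPath G) : Prop :=
  ∀ v : V, {i : ℕ | G.s (x.edges i) = v}.Finite

/-- A semi-tail: a wandering infinite path each of whose edges is the unique edge emitted
by its source. -/
def IsSemiTail {G : DGraph V E} (x : InfPath G) : Prop :=
  Wandering x ∧ ∀ i, ∀ e : E, G.s e = G.s (x.edges i) → e = x.edges i

/-- A sink: a vertex emitting no edges. -/
def IsSink (G : DGraph V E) (v : V) : Prop := ∀ e : E, G.s e ≠ v

/-- An infinite emitter. -/
def InfEmitter (G : DGraph V E) (v : V) : Prop := {e : E | G.s e = v}.Infinite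

/-- A singular vertex: a sink or an infinite emitter. -/
def Singular (G : DGraph V E) (v : V) : Prop := IsSink G v ∨ InfEmitter G v

/-- `v ≥ w`: there is a finite path from `v` to `w`. -/
def Reaches (G : DGraph V E) (v w : V) : Prop :=
  ∃ μ : FinPath G, μ.src = v ∧ μ.rng = w

/-- Condition (L): every cycle has an exit. -/
def CondL (G : DGraph V E) : Prop :=
  ∀ μ : FinPath G, μ.IsCycle → μ.HasExit

/-- Condition (T): from every vertex there are at least two distinct paths to some common
vertex. -/
def CondT (G : DGraph V E) : Prop :=
  ∀ v : V, ∃ μ ν : FinPath G, μ ≠ ν ∧ μ.src = v ∧ ν.src = v ∧ μ.rng = ν.rng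

/-- Condition (K): every vertex supports either no return path or at least two. -/
def CondK (G : DGraph V E) : Prop :=
  ∀ v : V, (¬ ∃ μ : FinPath G, μ.IsReturnPath ∧ μ.src = v) ∨
    (∃ μ ν : FinPath G, μ ≠ ν ∧ μ.IsReturnPath ∧ ν.IsReturnPath ∧ μ.src = v ∧ ν.src = v)

/-- Condition (W): every wandering infinite path admits a second route from its source to
the range of one of its edges. -/
def CondW (G : DGraph V E) : Prop :=
  ∀ x : InfPath G, Wandering x →
    ∃ (n : ℕ) (μ ν : FinPath G), μ ≠ ν ∧ μ.src = x.src ∧ ν.src = x.src ∧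
      μ.rng = G.r (x.edges n) ∧ ν.rng = G.r (x.edges n)

/-- Condition (∞): every infinite emitter emits infinitely many edges whose ranges can
reach back. -/
def CondInf (G : DGraph V E) : Prop :=
  ∀ v : V, InfEmitter G v → {e : E | G.s e = v ∧ Reaches G (G.r e) v}.Infinite

/-- Cofinality: every vertex can reach some vertex on every infinite path. -/
def Cofinal (G : DGraph V E) : Prop :=
  ∀ (v : V) (x : InfPath G), ∃ n : ℕ, Reaches G v (G.s (x.edges n))

/-- The boundary path space: all infinite paths together with all finite paths ending at a
singular vertex. -/
def BPath (G : DGraph V E) : Type _ :=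
  {μ : FinPath G // Singular G μ.rng} ⊕ InfPath G

namespace BPath

variable {G : DGraph V E}

/-- The source vertex of a boundary path. -/
def src : BPath G → V
  | Sum.inl p => p.1.src
  | Sum.inr x => x.src

/-- The `n`-th edge of a boundary path (0-indexed), if it exists. -/
def edgeAt : BPath G → ℕ → Option E
  | Sum.inl p, n => p.1.edges[n]?
  | Sum.inr x, n => some (x.edges n)

end BPath

/-- A finite path `μ` is an initial segment of a boundary path `p`. -/
def IsPrefixOf {G : DGraph V E} (μ : FinPath G) (p : BPath G) : Prop :=
  μ.src = p.src ∧ ∀ i, i < μ.edges.length → p.edgeAt i = μ.edges[i]?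

/-- The cylinder set `Z(μ)` of a finite path. -/
def ZSet {G : DGraph V E} (μ : FinPath G) : Set (BPath G) :=
  {p | IsPrefixOf μ p}

/-- The basic set `Z(μ∖F) = Z(μ) ∖ ⋃_{e ∈ F} Z(μe)`. -/
def ZMinus {G : DGraph V E} (μ : FinPath G) (F : Set E) : Set (BPath G) :=
  {p | IsPrefixOf μ p ∧ ∀ e ∈ F, p.edgeAt μ.edges.length ≠ some e}

/-- The topology on the boundary path space generated by the basic sets `Z(μ∖F)`. -/
instance bpathTopology {G : DGraph V E} : TopologicalSpace (BPath G) :=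
  TopologicalSpace.generateFrom
    {S | ∃ (μ : FinPath G) (F : Set E), F.Finite ∧ (∀ e ∈ F, G.s e = μ.rng) ∧ S = ZMinus μ F}

/-- Tail equivalence of boundary paths. -/
def TailEquiv {G : DGraph V E} : BPath G → BPath G → Prop
  | Sum.inl p, Sum.inl q => p.1.rng = q.1.rng
  | Sum.inr x, Sum.inr y => ∃ k l : ℕ, ∀ n : ℕ, x.edges (k + n) = y.edges (l + n)
  | Sum.inl _, Sum.inr _ => False
  | Sum.inr _, Sum.inl _ => False

/-- The set of edges received by a vertex. -/
def recvSet (G : DGraph V E) (v : V) : Set E := {e | G.r e = v}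

/-- The set of edges emitted by a vertex. -/
def emitSet (G : DGraph V E) (v : V) : Set E := {e | G.s e = v}

/-- A degenerate vertex (six types). -/
def Degenerate (G : DGraph V E) (v : V) : Prop :=
  (∃ e : E, recvSet G v = {e} ∧ G.s e = v) ∨
  (∃ e f : E, e ≠ f ∧ recvSet G v = {e, f} ∧ G.s e = v ∧ recvSet G (G.s f) = ∅) ∨
  (∃ w : V, w ≠ v ∧ (∃ e : E, recvSet G v = {e} ∧ G.s e = w) ∧
    (∃ f : E, recvSet G w = {f} ∧ G.s f = v)) ∨
  (InfEmitter G v ∧ recvSet G v = ∅) ∨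
  (Singular G v ∧ ∃ f : E, recvSet G v = {f} ∧ recvSet G (G.s f) = ∅) ∨
  (emitSet G v = ∅ ∧ recvSet G v = ∅)

/-- `q = μz` where `p = λz`: the boundary path `q` is obtained from `p` by replacing the
initial segment `λ` with `μ`. -/
def IsShiftedBy {G : DGraph V E} (lam μ : FinPath G) (p q : BPath G) : Prop :=
  IsPrefixOf μ q ∧
    ∀ n : ℕ, p.edgeAt (lam.edges.length + n) = q.edgeAt (μ.edges.length + n)

/-- Membership in the topological full group of the graph groupoid: a homeomorphism `α` of
`∂E` given by finitely many prefix-exchanges `(μᵢ, Fᵢ, λᵢ)` and equal to the identity off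
their common (compact open) support. -/
def InFullGroup (G : DGraph V E) (α : BPath G ≃ₜ BPath G) : Prop :=
  ∃ (k : ℕ) (μ lam : Fin k → FinPath G) (F : Fin k → Set E),
    (∀ i, (μ i).rng = (lam i).rng) ∧
    (∀ i, (F i).Finite) ∧
    (∀ i, F i ⊂ {e : E | G.s e = (μ i).rng}) ∧
    (∀ i j, i ≠ j → ZMinus (lam i) (F i) ∩ ZMinus (lam j) (F j) = ∅) ∧
    (∀ i j, i ≠ j → ZMinus (μ i) (F i) ∩ ZMinus (μ j) (F j) = ∅) ∧
    (⋃ i, ZMinus (lam i) (F i)) = (⋃ i, ZMinus (μ i) (F i)) ∧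
    (∀ i, ∀ p ∈ ZMinus (lam i) (F i), IsShiftedBy (lam i) (μ i) p (α p)) ∧
    (∀ p ∉ ⋃ i, ZMinus (lam i) (F i), α p = p)

instance homeoGroup (X : Type*) [TopologicalSpace X] : Group (X ≃ₜ X) where
  mul f g := g.trans f
  one := Homeomorph.refl X
  inv := Homeomorph.symm
  mul_assoc _ _ _ := Homeomorph.ext fun _ => rfl
  one_mul _ := Homeomorph.ext fun _ => rfl
  mul_one _ := Homeomorph.ext fun _ => rfl
  inv_mul_cancel f := Homeomorph.ext f.symm_apply_apply

/-! ## Abstract reconstruction theorem -/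

section Reconstruction

open scoped commutatorElement

set_option linter.unusedSectionVars false

variable {A X : Type*} [Group A] [TopologicalSpace X] [MulAction A X]

/-- The set of points moved by `g`. -/
def mvSet (X : Type*) [MulAction A X] (g : A) : Set X := {x | g • x ≠ x}

/-- The support of `g`. -/
def spSet (X : Type*) [TopologicalSpace X] [MulAction A X] (g : A) : Set X :=
  closure (mvSet X g)

structure GoodAction (A X : Type*) [Group A] [TopologicalSpace X] [MulAction A X] : Prop where
  t2 : T2Space X
  cont : ∀ g : A, Continuous fun x : X => g • x
  faithful : ∀ g : A, (∀ x : X, g • x = x) → g = 1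
  spOpen : ∀ g : A, IsOpen (spSet X g)
  spCompact : ∀ g : A, IsCompact (spSet X g)
  many : ∀ U : Set X, IsOpen U → U.Nonempty → ∃ g : A, g ≠ 1 ∧ g * g = 1 ∧ mvSet X g ⊆ U
  base : ∀ (x : X) (U : Set X), IsOpen U → x ∈ U →
    ∃ a b : A, (x ∈ spSet X a ∧ x ∈ spSet X b) ∧ spSet X a ∩ spSet X b ⊆ U

/-- Algebraic disjointness. -/
def AlgDisj (f g : A) : Prop :=
  ∀ h : A, ¬ Commute f h → ∃ f₁ f₂ : A, Commute f₁ g ∧ Commute f₂ g ∧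
    ⁅f₁, ⁅f₂, h⁆⁆ ≠ 1 ∧ Commute ⁅f₁, ⁅f₂, h⁆⁆ g

def AlgBelow (b a : A) : Prop := ∀ g : A, AlgDisj a g → Commute b (g ^ 12)

lemma AlgDisj.map {B : Type*} [Group B] (Φ : A ≃* B) {f g : A} (h : AlgDisj f g) :
    AlgDisj (Φ f) (Φ g) := by
  intro k hk
  obtain ⟨k, rfl⟩ := Φ.surjective k
  have hk' : ¬ Commute f k := fun hc => hk (hc.map Φ)
  obtain ⟨f₁, f₂, h1, h2, h3, h4⟩ := h k hk'
  refine ⟨Φ f₁, Φ f₂, h1.map Φ, h2.map Φ, ?_, ?_⟩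
  · rw [← map_commutatorElement, ← map_commutatorElement]
    exact fun hh => h3 ((map_eq_one_iff Φ Φ.injective).1 hh)
  · rw [← map_commutatorElement, ← map_commutatorElement]
    exact h4.map Φ

lemma AlgBelow.map {B : Type*} [Group B] (Φ : A ≃* B) {f g : A} (h : AlgBelow f g) :
    AlgBelow (Φ f) (Φ g) := by
  intro k hk
  have h1 := hk.map Φ.symm
  rw [Φ.symm_apply_apply] at h1
  have h2 := (h _ h1).map Φ
  simpa using h2

lemma algBelow_map_iff {B : Type*} [Group B] (Φ : A ≃* B) {f g : A} :
    AlgBelow (Φ f) (Φ g) ↔ AlgBelow f g := by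
  refine ⟨fun h => ?_, fun h => h.map Φ⟩
  simpa using h.map Φ.symm

lemma smul_not_mv {g : A} {x : X} : x ∉ mvSet X g ↔ g • x = x := by
  simp [mvSet]

lemma smul_mem_mv {g : A} {x : X} (h : x ∈ mvSet X g) : g • x ∈ mvSet X g := by
  intro h'
  exact h (MulAction.injective g h')

lemma smul_mem_of_mv {g : A} {x : X} {U : Set X} (hU : mvSet X g ⊆ U) (h : x ∈ U) :
    g • x ∈ U := by
  by_cases hx : x ∈ mvSet X g
  · exact hU (smul_mem_mv hx)
  · rwa [smul_not_mv.1 hx]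

lemma inv_fix {g : A} {x : X} (h : g • x = x) : g⁻¹ • x = x := by
  rw [inv_smul_eq_iff, h]

lemma mv_pow {g : A} {n : ℕ} : mvSet X (g ^ n) ⊆ mvSet X g := by
  intro x hx hg
  apply hx
  induction n with
  | zero => simp
  | succ n ih =>
    have : g ^ n • x = x := by
      by_contra h
      exact hx (by rw [pow_succ, mul_smul, hg]; exact absurd (ih h) h)
    rw [pow_succ, mul_smul, hg, this]

namespace GoodAction

lemma ext (hG : GoodAction A X) {a b : A} (h : ∀ x : X, a • x = b • x) : a = b := by
  have := hG.faithful (b⁻¹ * a) (fun x => by rw [mul_smul, h, inv_smul_smul])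
  rw [inv_mul_eq_one] at this
  exact this.symm

lemma mv_open (hG : GoodAction A X) (g : A) : IsOpen (mvSet X g) := by
  have := hG.t2
  exact isOpen_ne_fun (hG.cont g) continuous_id

lemma exists_mv (hG : GoodAction A X) {g : A} (h : g ≠ 1) : ∃ x : X, x ∈ mvSet X g := by
  by_contra hc
  push Not at hc
  exact h (hG.faithful g fun x => smul_not_mv.1 (hc x))

lemma sep (hG : GoodAction A X) {g : A} {x : X} (hx : x ∈ mvSet X g) {W : Set X} (hW : IsOpen W) (hxW : x ∈ W) :
    ∃ U : Set X, IsOpen U ∧ x ∈ U ∧ U ⊆ W ∧ ∀ y ∈ U, g • y ∉ U := by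
  have := hG.t2
  obtain ⟨U, V, hU, hV, h1, h2, h3⟩ := t2_separation hx
  refine ⟨W ∩ V ∩ (fun y => g • y) ⁻¹' U, (hW.inter hV).inter (hU.preimage (hG.cont g)),
    ⟨⟨hxW, h2⟩, h1⟩, fun y hy => hy.1.1, ?_⟩
  intro y hy hy'
  exact Set.disjoint_left.1 h3 hy.2 hy'.1.2

lemma comm_of_disj (hG : GoodAction A X) {a b : A} (h : ∀ x, x ∈ mvSet X a → x ∉ mvSet X b) : Commute a b := by
  apply hG.ext
  intro x
  rw [mul_smul, mul_smul]
  by_cases hx : x ∈ mvSet X a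
  · rw [smul_not_mv.1 (h x hx), smul_not_mv.1 (h _ (smul_mem_mv hx))]
  · rw [smul_not_mv.1 hx]
    by_cases hx' : b • x ∈ mvSet X a
    · have := smul_not_mv.1 (h _ hx')
      have h2 : b • x = x := MulAction.injective b this
      rw [h2] at hx'
      exact absurd hx' hx
    · exact smul_not_mv.1 hx'

lemma algDisj_of_disj (hG : GoodAction A X) {f g : A} (h : ∀ x, x ∈ mvSet X f → x ∉ mvSet X g) : AlgDisj f g := by
  intro k hk
  have h0 : ∃ x, x ∈ mvSet X f ∧ x ∈ mvSet X k := by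
    by_contra hc
    push Not at hc
    exact hk (hG.comm_of_disj hc)
  obtain ⟨x, hxf, hxk⟩ := h0
  obtain ⟨U, hU, hxU, hUf, hUk⟩ := hG.sep hxk (hG.mv_open f) hxf
  obtain ⟨f₂, hf2, -, hf2U⟩ := hG.many U hU ⟨x, hxU⟩
  obtain ⟨y, hy⟩ := hG.exists_mv hf2
  obtain ⟨V, hV, hyV, hVU, hV2⟩ := hG.sep hy hU (hf2U hy)
  obtain ⟨f₁, hf1, -, hf1V⟩ := hG.many V hV ⟨y, hyV⟩
  obtain ⟨w, hw⟩ := hG.exists_mv hf1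
  have hc : ∀ z ∈ U, ⁅f₂, k⁆ • z = f₂ • z := by
    intro z hz
    have h1 : k⁻¹ • z ∉ U := fun hn => hUk _ hn (by rwa [smul_inv_smul])
    have h2 : f₂ • (k⁻¹ • z) = k⁻¹ • z := smul_not_mv.1 fun hn => h1 (hf2U hn)
    rw [commutatorElement_def, mul_smul, mul_smul, mul_smul, inv_fix h2, smul_inv_smul]
  have hcU : ∀ z ∈ U, ⁅f₂, k⁆ • z ∈ U := fun z hz => by
    rw [hc z hz]; exact smul_mem_of_mv hf2U hz
  have hcomm : ∀ e : A, mvSet X e ⊆ U → Commute e g := fun e he =>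
    hG.comm_of_disj fun x hx => h x (hUf (he hx))
  refine ⟨f₁, f₂, hcomm _ (hf1V.trans hVU), hcomm _ hf2U, ?_, ?_⟩
  · intro hk1
    have hwV := hf1V hw
    have hinv : ⁅f₂, k⁆⁻¹ • w = f₂⁻¹ • w := by
      rw [inv_smul_eq_iff, hc, smul_inv_smul]
      by_cases hh : f₂ • w = w
      · rw [inv_fix hh]; exact hVU hwV
      · by_contra hn
        have : f₂ • (f₂⁻¹ • w) = f₂⁻¹ • w := smul_not_mv.1 fun hm => hn (hf2U hm)
        rw [smul_inv_smul] at this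
        rw [← this] at hn
        exact hn (hVU hwV)
    have hnV : f₂⁻¹ • w ∉ V := fun hn => hV2 _ hn (by rwa [smul_inv_smul])
    have hfix : f₁ • (f₂⁻¹ • w) = f₂⁻¹ • w := smul_not_mv.1 fun hn => hnV (hf1V hn)
    have : ⁅f₁, ⁅f₂, k⁆⁆ • w = f₁ • w := by
      rw [commutatorElement_def f₁, mul_smul, mul_smul, mul_smul, hinv, inv_fix hfix, ← hinv,
        smul_inv_smul]
    rw [hk1, one_smul] at this
    exact hw this.symm
  · apply hcomm
    intro z hz
    by_contra hzU
    apply hz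
    have h1 : ⁅f₂, k⁆⁻¹ • z ∉ U := fun hn => hzU (by have := hcU _ hn; rwa [smul_inv_smul] at this)
    have h2 : f₁ • (⁅f₂, k⁆⁻¹ • z) = ⁅f₂, k⁆⁻¹ • z :=
      smul_not_mv.1 fun hn => h1 (hVU (hf1V hn))
    have h3 : f₁ • z = z := smul_not_mv.1 fun hn => hzU (hVU (hf1V hn))
    rw [commutatorElement_def f₁, mul_smul, mul_smul, mul_smul, inv_fix h2, smul_inv_smul, h3]

lemma mv_commutator {a b : A} {x : X} (hx : x ∈ mvSet X ⁅a, b⁆) :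
    x ∈ mvSet X b ∨ a⁻¹ • x ∈ mvSet X b := by
  by_contra hc
  push Not at hc
  obtain ⟨h1, h2⟩ := hc
  apply hx
  rw [smul_not_mv] at h1 h2
  rw [commutatorElement_def, mul_smul, mul_smul, mul_smul, inv_fix h1, h2, smul_inv_smul]

lemma disj_of_algDisj (hG : GoodAction A X) {f g : A} (h : AlgDisj f g) :
    ∀ x, x ∈ mvSet X f → x ∉ mvSet X (g ^ 12) := by
  intro x hxf hxg
  have hpow : ∀ i m : ℕ, i * m = 12 → x ∈ mvSet X (g ^ i) := by
    intro i m him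
    apply mv_pow (n := m)
    rwa [← pow_mul, him]
  obtain ⟨U0, hU0, hx0, -, h0⟩ := hG.sep hxf isOpen_univ (Set.mem_univ _)
  obtain ⟨U1, hU1, hx1, h01, h1⟩ := hG.sep (hpow 1 12 rfl) hU0 hx0
  obtain ⟨U2, hU2, hx2, h12, h2⟩ := hG.sep (hpow 2 6 rfl) hU1 hx1
  obtain ⟨U3, hU3, hx3, h23, h3⟩ := hG.sep (hpow 3 4 rfl) hU2 hx2
  obtain ⟨U, hU, hxU, h34, h4⟩ := hG.sep (hpow 4 3 rfl) hU3 hx3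
  have hUf : ∀ y ∈ U, f • y ∉ U := fun y hy hn =>
    h0 y (h01 (h12 (h23 (h34 hy)))) (h01 (h12 (h23 (h34 hn))))
  have hUg : ∀ i : ℕ, 1 ≤ i → i ≤ 4 → ∀ y ∈ U, g ^ i • y ∉ U := by
    intro i hi1 hi4 y hy hn
    interval_cases i
    · exact h1 y (h12 (h23 (h34 hy))) (h12 (h23 (h34 hn)))
    · exact h2 y (h23 (h34 hy)) (h23 (h34 hn))
    · exact h3 y (h34 hy) (h34 hn)
    · exact h4 y hy hn
  obtain ⟨k, hk1, -, hkU⟩ := hG.many U hU ⟨x, hxU⟩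
  have hfk : ¬ Commute f k := by
    intro hc
    obtain ⟨y, hy⟩ := hG.exists_mv hk1
    apply hy
    have e1 : f • k • y = k • f • y := by rw [← mul_smul, ← mul_smul, hc.eq]
    have e2 : k • f • y = f • y := smul_not_mv.1 fun hn => hUf y (hkU hy) (hkU hn)
    rw [e2] at e1
    exact MulAction.injective f e1
  obtain ⟨f₁, f₂, c1, c2, hne, c3⟩ := h k hfk
  obtain ⟨y, hy⟩ := hG.exists_mv hne
  have horb : ∀ i : ℕ, g ^ i • y ∈ mvSet X ⁅f₁, ⁅f₂, k⁆⁆ := by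
    intro i hi
    apply hy
    rw [← mul_smul, (c3.pow_right i).eq, mul_smul] at hi
    exact MulAction.injective _ hi
  let w : Fin 4 → A := ![1, f₁, f₂, f₁ * f₂]
  have hwc : ∀ j, Commute (w j) g := by
    intro j
    fin_cases j
    · exact Commute.one_left g
    · exact c1
    · exact c2
    · exact c1.mul_left c2
  have hcov : ∀ z, z ∈ mvSet X ⁅f₁, ⁅f₂, k⁆⁆ → ∃ j, (w j)⁻¹ • z ∈ U := by
    intro z hz
    rcases mv_commutator hz with hz | hz <;> rcases mv_commutator hz with hz | hz
    · exact ⟨0, by simpa [w] using hkU hz⟩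
    · exact ⟨2, by simpa [w] using hkU hz⟩
    · exact ⟨1, by simpa [w] using hkU hz⟩
    · exact ⟨3, by simpa [w, mul_smul] using hkU hz⟩
  choose! J hJ using hcov
  obtain ⟨a, b, hab, hJab⟩ := Fintype.exists_ne_map_eq_of_card_lt
    (fun i : Fin 5 => J (g ^ (i : ℕ) • y)) (by simp)
  wlog hlt : a < b generalizing a b
  · exact this b a hab.symm hJab.symm (lt_of_le_of_ne (not_lt.1 hlt) hab.symm)
  have ha := hJ _ (horb a)
  have hb := hJ _ (horb b)
  rw [← hJab] at hb
  have hlt' : (a : ℕ) < b := hlt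
  have hb5 := b.2
  refine hUg (b - a) (by omega) (by omega) _ ha ?_
  convert hb using 1
  have hcm : Commute (g ^ ((b : ℕ) - a)) (w (J (g ^ (a : ℕ) • y)))⁻¹ :=
    ((hwc _).symm.inv_right).pow_left _
  rw [← mul_smul, hcm.eq, mul_smul, ← mul_smul (g ^ ((b : ℕ) - a)), ← pow_add]
  congr 3
  omega

lemma exists_pow_aux (hG : GoodAction A X) {n : ℕ}
    (hn : ∀ U : Set X, IsOpen U → U.Nonempty → ∃ g : A, mvSet X g ⊆ U ∧ g ^ n ≠ 1) :
    ∀ U : Set X, IsOpen U → U.Nonempty → ∃ g : A, mvSet X g ⊆ U ∧ g ^ (2 * n) ≠ 1 := by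
  intro U hU hne
  obtain ⟨p, hp1, hpp, hpU⟩ := hG.many U hU hne
  obtain ⟨x, hx⟩ := hG.exists_mv hp1
  obtain ⟨V, hV, hxV, hVU, hVp⟩ := hG.sep hx hU (hpU hx)
  obtain ⟨q, hqV, hqn⟩ := hn V hV ⟨x, hxV⟩
  refine ⟨p * q, ?_, ?_⟩
  · intro z hz
    by_contra hzU
    apply hz
    rw [mul_smul, smul_not_mv.1 fun hh => hzU (hVU (hqV hh)), smul_not_mv.1 fun hh => hzU (hpU hh)]
  · intro h1
    obtain ⟨z, hz⟩ := hG.exists_mv hqn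
    have hzV : z ∈ V := hqV (mv_pow hz)
    have h2 : ∀ y ∈ V, (p * q) ^ 2 • y = q • y := by
      intro y hy
      have e1 : q • y ∈ V := smul_mem_of_mv hqV hy
      have e2 : q • p • q • y = p • q • y := smul_not_mv.1 fun hh => hVp _ e1 (hqV hh)
      rw [pow_two, mul_smul, mul_smul, mul_smul, e2, ← mul_smul, hpp, one_smul]
    have h3 : ∀ m : ℕ, q ^ m • z ∈ V ∧ (p * q) ^ (2 * m) • z = q ^ m • z := by
      intro m
      induction m with
      | zero => simpa using hzV
      | succ m ih =>
        constructor
        · rw [pow_succ', mul_smul]; exact smul_mem_of_mv hqV ih.1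
        · rw [mul_add, mul_one, add_comm, pow_add, mul_smul, ih.2, h2 _ ih.1, pow_succ', mul_smul]
    apply hz
    rw [← (h3 n).2, h1, one_smul]

lemma exists_pow (hG : GoodAction A X) (U : Set X) (hU : IsOpen U) (hne : U.Nonempty) :
    ∃ g : A, mvSet X g ⊆ U ∧ g ^ 12 ≠ 1 := by
  refine hG.exists_pow_aux (n := 6) (hG.exists_pow_aux (n := 3) ?_) U hU hne
  intro U hU hne
  obtain ⟨g, h1, h2, h3⟩ := hG.many U hU hne
  exact ⟨g, h3, by rw [pow_succ, pow_two, h2, one_mul]; exact h1⟩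

lemma below_iff (hG : GoodAction A X) {a b : A} : AlgBelow b a ↔ mvSet X b ⊆ spSet X a := by
  constructor
  · intro h x hx
    by_contra hxa
    obtain ⟨U, hU, hxU, hUa, hUb⟩ := hG.sep hx (isClosed_closure (s := mvSet X a)).isOpen_compl hxa
    obtain ⟨g, hgU, hg⟩ := hG.exists_pow U hU ⟨x, hxU⟩
    have hc := h g (hG.algDisj_of_disj fun y hy hy' => hUa (hgU hy') (subset_closure hy))
    obtain ⟨y, hy⟩ := hG.exists_mv hg
    apply hy
    have hyU := hgU (mv_pow hy)
    have e1 : b • g ^ 12 • y = g ^ 12 • b • y := by rw [← mul_smul, ← mul_smul, hc.eq]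
    rw [smul_not_mv.1 fun hn => hUb y hyU (hgU (mv_pow hn))] at e1
    exact MulAction.injective b e1
  · intro h g hg
    apply hG.comm_of_disj
    intro x hx hx'
    obtain ⟨y, hy1, hy2⟩ := mem_closure_iff.1 (h hx) _ (hG.mv_open _) hx'
    exact hG.disj_of_algDisj hg y hy2 hy1

lemma inter_subset_iff (hG : GoodAction A X) {a b c : A} : spSet X a ∩ spSet X b ⊆ spSet X c ↔
    ∀ d : A, AlgBelow d a → AlgBelow d b → AlgBelow d c := by
  simp only [hG.below_iff]
  constructor
  · intro h d h1 h2 x hx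
    exact h ⟨h1 hx, h2 hx⟩
  · intro h x hx
    by_contra hc
    obtain ⟨d, hd1, -, hd⟩ := hG.many ((spSet X a ∩ spSet X b) ∩ (spSet X c)ᶜ)
      (((hG.spOpen a).inter (hG.spOpen b)).inter isClosed_closure.isOpen_compl) ⟨x, hx, hc⟩
    obtain ⟨y, hy⟩ := hG.exists_mv hd1
    exact (hd hy).2 (h d (fun z hz => (hd hz).1.1) (fun z hz => (hd hz).1.2) hy)

lemma inter_nonempty_iff (hG : GoodAction A X) {a b : A} : (spSet X a ∩ spSet X b).Nonempty ↔
    ∃ d : A, d ≠ 1 ∧ AlgBelow d a ∧ AlgBelow d b := by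
  simp only [hG.below_iff]
  constructor
  · intro h
    obtain ⟨d, hd1, -, hd⟩ := hG.many (spSet X a ∩ spSet X b)
      ((hG.spOpen a).inter (hG.spOpen b)) h
    exact ⟨d, hd1, fun z hz => (hd hz).1, fun z hz => (hd hz).2⟩
  · rintro ⟨d, hd, h1, h2⟩
    obtain ⟨y, hy⟩ := hG.exists_mv hd
    exact ⟨y, h1 hy, h2 hy⟩

lemma smul_mem_sp (hG : GoodAction A X) (g a : A) (x : X) : g • x ∈ spSet X a ↔ x ∈ spSet X (g⁻¹ * a * g) := by
  have key : ∀ (g a : A) (x : X), x ∈ spSet X (g⁻¹ * a * g) → g • x ∈ spSet X a := by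
    intro g a x hx
    have : Set.MapsTo (fun y : X => g • y) (mvSet X (g⁻¹ * a * g)) (mvSet X a) := by
      intro y hy hh
      apply hy
      rw [mul_smul, mul_smul, hh, inv_smul_smul]
    exact this.closure (hG.cont g) hx
  refine ⟨fun h => ?_, key g a x⟩
  have := key g⁻¹ (g⁻¹ * a * g) (g • x) (by simpa [mul_assoc] using h)
  simpa using this

end GoodAction

lemma exists_corr {I X Y : Type*} [TopologicalSpace X] [TopologicalSpace Y] [T2Space X]
    [T2Space Y] (U : I → Set X) (W : I → Set Y)
    (hU : ∀ i, IsOpen (U i)) (hUc : ∀ i, IsCompact (U i))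
    (hW : ∀ i, IsOpen (W i)) (hWc : ∀ i, IsCompact (W i))
    (bU : ∀ x O, IsOpen O → x ∈ O → ∃ i, x ∈ U i ∧ U i ⊆ O)
    (bW : ∀ x O, IsOpen O → x ∈ O → ∃ i, x ∈ W i ∧ W i ⊆ O)
    (hne : ∀ i, (U i).Nonempty ↔ (W i).Nonempty)
    (hle : ∀ i j, U i ⊆ U j ↔ W i ⊆ W j) (x : X) :
    ∃ y : Y, ∀ i, x ∈ U i ↔ y ∈ W i := by
  obtain ⟨i0, hi0, -⟩ := bU x Set.univ isOpen_univ (Set.mem_univ _)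
  have : Nonempty {i // x ∈ U i} := ⟨⟨i0, hi0⟩⟩
  have hinter : (⋂ i : {i // x ∈ U i}, W i.1).Nonempty := by
    apply IsCompact.nonempty_iInter_of_directed_nonempty_isCompact_isClosed
    · intro i j
      obtain ⟨k, hk, hk'⟩ := bU x (U i.1 ∩ U j.1) ((hU _).inter (hU _)) ⟨i.2, j.2⟩
      exact ⟨⟨k, hk⟩, (hle _ _).1 (hk'.trans Set.inter_subset_left),
        (hle _ _).1 (hk'.trans Set.inter_subset_right)⟩
    · intro i
      exact (hne _).1 ⟨x, i.2⟩
    · exact fun i => hWc _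
    · exact fun i => (hWc _).isClosed
  obtain ⟨y, hy⟩ := hinter
  rw [Set.mem_iInter] at hy
  refine ⟨y, fun i => ⟨fun h => hy ⟨i, h⟩, fun h => ?_⟩⟩
  by_contra hx
  obtain ⟨j, hj, hj'⟩ := bU x (U i)ᶜ (hUc i).isClosed.isOpen_compl hx
  obtain ⟨k, hk, hk'⟩ := bW y (W i ∩ W j) ((hW _).inter (hW _)) ⟨h, hy ⟨j, hj⟩⟩
  obtain ⟨z, hz⟩ := (hne k).2 ⟨y, hk⟩
  exact hj' ((hle k j).2 (hk'.trans Set.inter_subset_right) hz)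
    ((hle k i).2 (hk'.trans Set.inter_subset_left) hz)

lemma uniq_corr {I Y : Type*} [TopologicalSpace Y] [T2Space Y] (W : I → Set Y)
    (bW : ∀ x O, IsOpen O → x ∈ O → ∃ i, x ∈ W i ∧ W i ⊆ O) {y z : Y}
    (h : ∀ i, y ∈ W i ↔ z ∈ W i) : y = z := by
  by_contra hyz
  obtain ⟨i, hi, hi'⟩ := bW y {z}ᶜ isOpen_compl_singleton hyz
  exact hi' ((h i).1 hi) rfl

lemma exists_homeo {I X Y : Type*} [TopologicalSpace X] [TopologicalSpace Y] [T2Space X]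
    [T2Space Y] (U : I → Set X) (W : I → Set Y)
    (hU : ∀ i, IsOpen (U i)) (hUc : ∀ i, IsCompact (U i))
    (hW : ∀ i, IsOpen (W i)) (hWc : ∀ i, IsCompact (W i))
    (bU : ∀ x O, IsOpen O → x ∈ O → ∃ i, x ∈ U i ∧ U i ⊆ O)
    (bW : ∀ x O, IsOpen O → x ∈ O → ∃ i, x ∈ W i ∧ W i ⊆ O)
    (hne : ∀ i, (U i).Nonempty ↔ (W i).Nonempty)
    (hle : ∀ i j, U i ⊆ U j ↔ W i ⊆ W j) :
    ∃ φ : X ≃ₜ Y, ∀ x i, x ∈ U i ↔ φ x ∈ W i := by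
  choose f hf using exists_corr U W hU hUc hW hWc bU bW hne hle
  choose g hg using exists_corr W U hW hWc hU hUc bW bU (fun i => (hne i).symm)
    (fun i j => (hle i j).symm)
  refine ⟨⟨⟨f, g, fun x => uniq_corr U bU fun i => ?_, fun y => uniq_corr W bW fun i => ?_⟩,
    ?_, ?_⟩, hf⟩
  · exact ((hf x i).trans (hg (f x) i)).symm
  · exact ((hg y i).trans (hf (g y) i)).symm
  · refine continuous_iff_continuousAt.2 fun x O hO => ?_
    obtain ⟨O', hO', hOo, hx⟩ := mem_nhds_iff.1 hO
    obtain ⟨i, hi, hi'⟩ := bW _ O' hOo hx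
    refine Filter.mem_map.2 (Filter.mem_of_superset ((hU i).mem_nhds ((hf x i).2 hi)) fun z hz => ?_)
    exact hO' (hi' ((hf z i).1 hz))
  · refine continuous_iff_continuousAt.2 fun x O hO => ?_
    obtain ⟨O', hO', hOo, hx⟩ := mem_nhds_iff.1 hO
    obtain ⟨i, hi, hi'⟩ := bU _ O' hOo hx
    refine Filter.mem_map.2 (Filter.mem_of_superset ((hW i).mem_nhds ((hg x i).2 hi)) fun z hz => ?_)
    exact hO' (hi' ((hg z i).1 hz))

theorem GoodAction.reconstruct {A B X Y : Type*} [Group A] [Group B] [TopologicalSpace X]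
    [TopologicalSpace Y] [MulAction A X] [MulAction B Y] (hA : GoodAction A X)
    (hB : GoodAction B Y) (Φ : A ≃* B) :
    ∃ φ : X ≃ₜ Y, ∀ (a : A) (x : X), φ (a • x) = Φ a • φ x := by
  have := hA.t2
  have := hB.t2
  have bW : ∀ (x : Y) O, IsOpen O → x ∈ O → ∃ i : A × A,
      x ∈ spSet Y (Φ i.1) ∩ spSet Y (Φ i.2) ∧ spSet Y (Φ i.1) ∩ spSet Y (Φ i.2) ⊆ O := by
    intro x O hO hx
    obtain ⟨a, b, h1, h2⟩ := hB.base x O hO hx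
    refine ⟨(Φ.symm a, Φ.symm b), ?_⟩
    simp only [MulEquiv.apply_symm_apply]
    exact ⟨h1, h2⟩
  have key : ∀ a b c : A, spSet X a ∩ spSet X b ⊆ spSet X c ↔
      spSet Y (Φ a) ∩ spSet Y (Φ b) ⊆ spSet Y (Φ c) := by
    intro a b c
    rw [hA.inter_subset_iff, hB.inter_subset_iff]
    constructor
    · intro h d
      obtain ⟨d, rfl⟩ := Φ.surjective d
      simp only [algBelow_map_iff]
      exact h d
    · intro h d
      have := h (Φ d)
      simpa only [algBelow_map_iff] using this
  obtain ⟨φ, hφ⟩ := exists_homeo (I := A × A) (fun i => spSet X i.1 ∩ spSet X i.2)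
    (fun i => spSet Y (Φ i.1) ∩ spSet Y (Φ i.2))
    (fun i => (hA.spOpen _).inter (hA.spOpen _))
    (fun i => (hA.spCompact _).inter_right isClosed_closure)
    (fun i => (hB.spOpen _).inter (hB.spOpen _))
    (fun i => (hB.spCompact _).inter_right isClosed_closure)
    (fun x O hO hx => by
      obtain ⟨a, b, h1, h2⟩ := hA.base x O hO hx
      exact ⟨(a, b), h1, h2⟩)
    bW
    (fun i => by
      rw [hA.inter_nonempty_iff, hB.inter_nonempty_iff]
      constructor
      · rintro ⟨d, h0, h1, h2⟩
        exact ⟨Φ d, by simpa using h0, h1.map Φ, h2.map Φ⟩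
      · rintro ⟨d, h0, h1, h2⟩
        obtain ⟨d, rfl⟩ := Φ.surjective d
        exact ⟨d, by simpa using h0, (algBelow_map_iff Φ).1 h1, (algBelow_map_iff Φ).1 h2⟩)
    (fun i j => by
      rw [Set.subset_inter_iff, Set.subset_inter_iff, key, key])
  refine ⟨φ, fun a x => uniq_corr _ bW fun i => ?_⟩
  rw [← hφ]
  have := hφ x (a⁻¹ * i.1 * a, a⁻¹ * i.2 * a)
  simp only [map_mul, map_inv] at this
  simp only [Set.mem_inter_iff, hA.smul_mem_sp a, hB.smul_mem_sp (Φ a)] at this ⊢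
  exact this

end Reconstruction
/-! ## Boundary paths as sequences -/

section BoundaryPaths

variable {G : DGraph V E}

/-- The vertex reached after `n` steps. -/
def seqVtx (G : DGraph V E) (v : V) (f : ℕ → Option E) : ℕ → V
  | 0 => v
  | n + 1 => (f n).elim (seqVtx G v f n) G.r

structure IsBSeq (G : DGraph V E) (v : V) (f : ℕ → Option E) : Prop where
  src : ∀ n e, f n = some e → G.s e = seqVtx G v f n
  nonesucc : ∀ n, f n = none → f (n + 1) = none
  sing : ∀ n, f n = none → Singular G (seqVtx G v f n)

lemma seqVtx_congr {v : V} {f g : ℕ → Option E} {n : ℕ} (h : ∀ i < n, f i = g i) :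
    seqVtx G v f n = seqVtx G v g n := by
  induction n with
  | zero => rfl
  | succ n ih =>
    simp only [seqVtx]
    rw [h n (by omega), ih fun i hi => h i (by omega)]

lemma seqVtx_some {v : V} {f : ℕ → Option E} {n : ℕ} {e : E} (h : f n = some e) :
    seqVtx G v f (n + 1) = G.r e := by
  simp [seqVtx, h]

lemma seqVtx_none {v : V} {f : ℕ → Option E} {n : ℕ} (h : f n = none) :
    seqVtx G v f (n + 1) = seqVtx G v f n := by
  simp [seqVtx, h]

lemma seqVtx_shift {v w : V} {f g : ℕ → Option E} {k l : ℕ}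
    (h0 : seqVtx G v f k = seqVtx G w g l) (h : ∀ n, f (k + n) = g (l + n)) (n : ℕ) :
    seqVtx G v f (k + n) = seqVtx G w g (l + n) := by
  induction n with
  | zero => simpa using h0
  | succ n ih =>
    rw [← add_assoc, ← add_assoc]
    simp only [seqVtx]
    rw [h n, ih]

lemma none_of_le {f : ℕ → Option E} (h : ∀ n, f n = none → f (n + 1) = none) {n m : ℕ}
    (hn : f n = none) (hm : n ≤ m) : f m = none := by
  induction m, hm using Nat.le_induction with
  | base => exact hn
  | succ m _ ih => exact h m ih

lemma FinPath.seqVtx_length (μ : FinPath G) :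
    seqVtx G μ.src (fun i => μ.edges[i]?) μ.edges.length = μ.rng := by
  unfold FinPath.rng
  rw [List.getLast?_eq_getElem?]
  rcases hm : μ.edges.length with _ | m
  · simp [seqVtx, List.length_eq_zero_iff.1 hm]
  · have : μ.edges[m]? = some (μ.edges[m]'(by omega)) := List.getElem?_eq_getElem _
    simp [seqVtx, this]

lemma FinPath.src_edge (μ : FinPath G) {n : ℕ} {e : E} (h : μ.edges[n]? = some e) :
    G.s e = seqVtx G μ.src (fun i => μ.edges[i]?) n := by
  rcases n with _ | n
  · exact μ.src_eq e (by rw [List.head?_eq_getElem?]; exact h)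
  · have hlt : n + 1 < μ.edges.length := by
      by_contra hc
      rw [List.getElem?_eq_none (by omega)] at h
      cases h
    have h2 : μ.edges[n]? = some (μ.edges[n]'(by omega)) := List.getElem?_eq_getElem _
    have h3 := List.isChain_iff_getElem.1 μ.chain n hlt
    rw [List.getElem?_eq_getElem hlt] at h
    cases h
    rw [seqVtx_some h2, h3]

lemma FinPath.ext' {μ ν : FinPath G} (h1 : μ.src = ν.src) (h2 : μ.edges = ν.edges) : μ = ν := by
  cases μ; cases ν; simp_all

lemma BPath.isBSeq (p : BPath G) : IsBSeq G p.src p.edgeAt := by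
  rcases p with ⟨μ, hμ⟩ | x
  · refine ⟨fun n e h => μ.src_edge h, fun n h => ?_, fun n h => ?_⟩
    · simp only [BPath.edgeAt, List.getElem?_eq_none_iff] at h ⊢
      omega
    · have hn : μ.edges.length ≤ n := by
        simpa only [BPath.edgeAt, List.getElem?_eq_none_iff] using h
      have key : ∀ m, μ.edges.length ≤ m →
          seqVtx G μ.src (fun i => μ.edges[i]?) m = μ.rng := by
        intro m hm
        induction m, hm using Nat.le_induction with
        | base => exact μ.seqVtx_length
        | succ m hm ih => rw [seqVtx_none, ih]; exact List.getElem?_eq_none hm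
      have := key n hn
      change Singular G (seqVtx G μ.src (fun i => μ.edges[i]?) n)
      rw [this]
      exact hμ
  · refine ⟨fun n e h => ?_, fun n h => ?_, fun n h => ?_⟩
    · simp only [BPath.edgeAt, Option.some.injEq] at h
      subst h
      rcases n with _ | n
      · rfl
      · rw [seqVtx_some (e := x.edges n) rfl, x.chain]
    · simp [BPath.edgeAt] at h
    · simp [BPath.edgeAt] at h

lemma BPath.ext' {p q : BPath G} (h1 : p.src = q.src) (h2 : ∀ n, p.edgeAt n = q.edgeAt n) :
    p = q := by
  rcases p with ⟨μ, hμ⟩ | x <;> rcases q with ⟨ν, hν⟩ | y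
  · congr 1
    apply Subtype.ext
    exact FinPath.ext' h1 (List.ext_getElem? h2)
  · have := h2 μ.edges.length
    simp [BPath.edgeAt] at this
  · have := h2 ν.edges.length
    simp [BPath.edgeAt] at this
  · congr 1
    cases x; cases y
    congr 1
    funext n
    simpa [BPath.edgeAt] using h2 n

/-- Prefixes as finite paths. -/
lemma exists_finPath (v : V) (f : ℕ → Option E)
    (hs : ∀ n e, f n = some e → G.s e = seqVtx G v f n) (n : ℕ) (hn : ∀ i < n, f i ≠ none) :
    ∃ μ : FinPath G, μ.src = v ∧ μ.edges.length = n ∧ ∀ i < n, f i = μ.edges[i]? := by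
  have hsome : ∀ i : Fin n, ∃ e, f i = some e := fun i => Option.ne_none_iff_exists'.1 (hn i i.2)
  choose c hc using hsome
  have hget : ∀ i (hi : i < n), f i = (List.ofFn c)[i]? := by
    intro i hi
    rw [hc ⟨i, hi⟩, List.getElem?_eq_getElem (by simpa using hi), List.getElem_ofFn]
  refine ⟨⟨v, List.ofFn c, ?_, ?_⟩, rfl, by simp, hget⟩
  · intro e he
    rw [List.head?_eq_getElem?] at he
    by_cases h0 : 0 < n
    · rw [← hget 0 h0] at he
      exact hs 0 e he
    · obtain rfl : n = 0 := by omega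
      simp at he
  · apply List.isChain_iff_getElem.2
    intro i hi
    have hi' : i + 1 < n := by simpa using hi
    have h1 := hc ⟨i, by omega⟩
    have h2 := hs _ _ (hc ⟨i + 1, hi'⟩)
    rw [seqVtx_some h1] at h2
    simpa using h2.symm

lemma IsBSeq.exists_bpath {v : V} {f : ℕ → Option E} (h : IsBSeq G v f) :
    ∃ p : BPath G, p.src = v ∧ ∀ n, p.edgeAt n = f n := by
  classical
  by_cases hf : ∃ n, f n = none
  · let n := Nat.find hf
    have hn : f n = none := Nat.find_spec hf
    have hlt : ∀ i < n, f i ≠ none := fun i hi => Nat.find_min hf hi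
    obtain ⟨μ, h1, h2, h3⟩ := exists_finPath v f h.src n hlt
    have hr : μ.rng = seqVtx G v f n := by
      rw [← μ.seqVtx_length, h1, h2]
      exact (seqVtx_congr h3).symm
    refine ⟨Sum.inl ⟨μ, by rw [hr]; exact h.sing n hn⟩, h1, fun m => ?_⟩
    change μ.edges[m]? = f m
    by_cases hm : m < n
    · exact (h3 m hm).symm
    · rw [none_of_le h.nonesucc hn (by omega), List.getElem?_eq_none (by omega)]
  · push Not at hf
    have hsome : ∀ i, ∃ e, f i = some e := fun i => Option.ne_none_iff_exists'.1 (hf i)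
    choose c hc using hsome
    refine ⟨Sum.inr ⟨c, fun i => ?_⟩, ?_, fun n => (hc n).symm⟩
    · rw [h.src _ _ (hc (i + 1)), seqVtx_some (hc i)]
    · exact h.src 0 _ (hc 0)

/-- The vertex of a boundary path after `n` steps. -/
abbrev BPath.vtx (p : BPath G) (n : ℕ) : V := seqVtx G p.src p.edgeAt n

lemma IsPrefixOf.vtx_eq {μ : FinPath G} {p : BPath G} (h : IsPrefixOf μ p) :
    p.vtx μ.edges.length = μ.rng := by
  rw [← μ.seqVtx_length, h.1]
  exact seqVtx_congr h.2

lemma IsPrefixOf.edge_ne {μ : FinPath G} {p : BPath G} (h : IsPrefixOf μ p) {i : ℕ}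
    (hi : i < μ.edges.length) : p.edgeAt i ≠ none := by
  rw [h.2 i hi, List.getElem?_eq_getElem hi]
  simp

lemma BPath.exists_initSeg (p : BPath G) (n : ℕ) (hn : ∀ i < n, p.edgeAt i ≠ none) :
    ∃ μ : FinPath G, μ.edges.length = n ∧ IsPrefixOf μ p := by
  obtain ⟨μ, h1, h2, h3⟩ := exists_finPath p.src p.edgeAt p.isBSeq.src n hn
  exact ⟨μ, h2, h1, by rw [h2]; exact h3⟩

lemma IsPrefixOf.unique {μ ν : FinPath G} {p : BPath G} (h1 : IsPrefixOf μ p)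
    (h2 : IsPrefixOf ν p) (h : μ.edges.length = ν.edges.length) : μ = ν := by
  apply FinPath.ext' (h1.1.trans h2.1.symm)
  apply List.ext_getElem? fun i => ?_
  by_cases hi : i < μ.edges.length
  · rw [← h1.2 i hi, ← h2.2 i (by omega)]
  · rw [List.getElem?_eq_none (by omega), List.getElem?_eq_none (by omega)]

lemma isPrefixOf_trivial (p : BPath G) : IsPrefixOf (trivialPath G p.src) p :=
  ⟨rfl, fun i hi => by simp [trivialPath] at hi⟩

/-! ### Concatenation -/

def FinPath.app (μ ν : FinPath G) (h : ν.src = μ.rng) : FinPath G where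
  src := μ.src
  edges := μ.edges ++ ν.edges
  src_eq := by
    intro e he
    rcases hm : μ.edges with _ | ⟨a, l⟩
    · rw [hm, List.nil_append] at he
      rw [ν.src_eq e he, h]
      simp [FinPath.rng, hm]
    · rw [hm] at he
      exact μ.src_eq e (by rw [hm]; simpa using he)
  chain := by
    apply List.isChain_append.2
    refine ⟨μ.chain, ν.chain, fun x hx y hy => ?_⟩
    rw [ν.src_eq y hy, h]
    simp only [Option.mem_def] at hx
    simp [FinPath.rng, hx]

lemma FinPath.app_rng (μ ν : FinPath G) (h : ν.src = μ.rng) : (μ.app ν h).rng = ν.rng := by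
  simp only [FinPath.rng, FinPath.app, List.getLast?_append]
  rcases hl : ν.edges.getLast? with _ | e
  · simp only [Option.none_or]
    rw [h]
    rfl
  · simp

def FinPath.single (G : DGraph V E) (e : E) : FinPath G where
  src := G.s e
  edges := [e]
  src_eq := by intro f hf; simp at hf; rw [hf]
  chain := List.isChain_singleton e

/-- Append one edge. -/
def FinPath.snoc (μ : FinPath G) (e : E) (h : G.s e = μ.rng) : FinPath G :=
  μ.app (FinPath.single G e) h

lemma FinPath.snoc_rng (μ : FinPath G) (e : E) (h : G.s e = μ.rng) :
    (μ.snoc e h).rng = G.r e := by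
  exact FinPath.app_rng μ (FinPath.single G e) h

lemma FinPath.snoc_length (μ : FinPath G) (e : E) (h : G.s e = μ.rng) :
    (μ.snoc e h).edges.length = μ.edges.length + 1 := by
  simp [FinPath.snoc, FinPath.app, FinPath.single]

lemma isPrefixOf_snoc {μ : FinPath G} {e : E} {h : G.s e = μ.rng} {p : BPath G} :
    IsPrefixOf (μ.snoc e h) p ↔ IsPrefixOf μ p ∧ p.edgeAt μ.edges.length = some e := by
  have hed : (μ.snoc e h).edges = μ.edges ++ [e] := rfl
  have hsr : (μ.snoc e h).src = μ.src := rfl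
  unfold IsPrefixOf
  rw [hed, hsr]
  constructor
  · rintro ⟨h1, h2⟩
    refine ⟨⟨h1, fun i hi => ?_⟩, ?_⟩
    · rw [h2 i (by simp; omega), List.getElem?_append_left hi]
    · rw [h2 _ (by simp)]; simp
  · rintro ⟨⟨h1, h2⟩, h3⟩
    refine ⟨h1, fun i hi => ?_⟩
    rcases Nat.lt_or_ge i μ.edges.length with hlt | hge
    · rw [h2 i hlt, List.getElem?_append_left hlt]
    · have : i = μ.edges.length := by simp at hi; omega
      subst this
      simp [h3]

/-- Split a finite path. -/
lemma FinPath.split (ν : FinPath G) (a b : List E) (h : ν.edges = a ++ b) :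
    ∃ α β : FinPath G, α.edges = a ∧ β.edges = b ∧ α.src = ν.src ∧ β.src = α.rng ∧
      β.rng = ν.rng := by
  have hc := List.isChain_append.1 (h ▸ ν.chain)
  let α : FinPath G := ⟨ν.src, a, by
    intro e he
    apply ν.src_eq
    rw [h]
    rcases a with _ | ⟨x, l⟩
    · simp at he
    · simpa using he, hc.1⟩
  let β : FinPath G := ⟨α.rng, b, by
    intro e he
    simp only [FinPath.rng, α]
    rcases hl : a.getLast? with _ | x
    · rw [List.getLast?_eq_none_iff] at hl
      simp only [Option.elim]
      apply ν.src_eq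
      rw [h, hl]
      exact he
    · exact (hc.2.2 x hl e he).symm, hc.2.1⟩
  refine ⟨α, β, rfl, rfl, rfl, rfl, ?_⟩
  have : α.app β rfl = ν := FinPath.ext' rfl h.symm
  rw [← this, FinPath.app_rng]

/-! ### Shifts -/

lemma IsShiftedBy.symm {lam μ : FinPath G} {p q : BPath G} (hp : IsPrefixOf lam p)
    (h : IsShiftedBy lam μ p q) : IsShiftedBy μ lam q p :=
  ⟨hp, fun n => (h.2 n).symm⟩

lemma IsShiftedBy.unique {lam μ : FinPath G} {p q q' : BPath G}
    (h : IsShiftedBy lam μ p q) (h' : IsShiftedBy lam μ p q') : q = q' := by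
  apply BPath.ext' (h.1.1.symm.trans h'.1.1)
  intro n
  rcases Nat.lt_or_ge n μ.edges.length with hlt | hge
  · rw [h.1.2 n hlt, h'.1.2 n hlt]
  · obtain ⟨m, rfl⟩ := Nat.exists_eq_add_of_le hge
    rw [← h.2, ← h'.2]

/-- Gluing of a finite path and the tail of a boundary path. -/
lemma exists_glue (μ : FinPath G) (p : BPath G) (k : ℕ) (h : μ.rng = p.vtx k) :
    ∃ q : BPath G, IsPrefixOf μ q ∧ ∀ n, p.edgeAt (k + n) = q.edgeAt (μ.edges.length + n) := by
  set l := μ.edges.length with hl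
  let f : ℕ → Option E := fun i => if i < l then μ.edges[i]? else p.edgeAt (k + (i - l))
  have f1 : ∀ i < l, f i = μ.edges[i]? := fun i hi => by simp [f, hi]
  have f2 : ∀ n, f (l + n) = p.edgeAt (k + n) := fun n => by simp [f]
  have hv0 : seqVtx G μ.src f l = μ.rng := by
    rw [← μ.seqVtx_length]; exact seqVtx_congr f1
  have hv : ∀ n, seqVtx G μ.src f (l + n) = p.vtx (k + n) :=
    seqVtx_shift (hv0.trans h) f2
  have hb : IsBSeq G μ.src f := by
    refine ⟨fun n e he => ?_, fun n hn => ?_, fun n hn => ?_⟩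
    · rcases Nat.lt_or_ge n l with hlt | hge
      · rw [f1 n hlt] at he
        rw [μ.src_edge he]
        exact (seqVtx_congr fun i hi => f1 i (by omega)).symm
      · obtain ⟨m, rfl⟩ := Nat.exists_eq_add_of_le hge
        rw [f2] at he
        rw [hv]
        exact p.isBSeq.src _ _ he
    · rcases Nat.lt_or_ge n l with hlt | hge
      · rw [f1 n hlt, List.getElem?_eq_getElem (by omega)] at hn
        cases hn
      · obtain ⟨m, rfl⟩ := Nat.exists_eq_add_of_le hge
        rw [f2] at hn
        rw [add_assoc, f2]
        exact p.isBSeq.nonesucc _ hn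
    · rcases Nat.lt_or_ge n l with hlt | hge
      · rw [f1 n hlt, List.getElem?_eq_getElem (by omega)] at hn
        cases hn
      · obtain ⟨m, rfl⟩ := Nat.exists_eq_add_of_le hge
        rw [f2] at hn
        rw [hv]
        exact p.isBSeq.sing _ hn
  obtain ⟨q, hq1, hq2⟩ := hb.exists_bpath
  refine ⟨q, ⟨hq1.symm, fun i hi => ?_⟩, fun n => ?_⟩
  · rw [hq2, f1 i hi]
  · rw [hq2, f2]

lemma exists_shift {lam μ : FinPath G} (h : lam.rng = μ.rng) {p : BPath G}
    (hp : IsPrefixOf lam p) : ∃ q, IsShiftedBy lam μ p q := by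
  obtain ⟨q, h1, h2⟩ := exists_glue μ p lam.edges.length (by rw [hp.vtx_eq, h])
  exact ⟨q, h1, h2⟩


/-! ### Topology -/

lemma mem_ZMinus {μ : FinPath G} {F : Set E} {p : BPath G} :
    p ∈ ZMinus μ F ↔ IsPrefixOf μ p ∧ ∀ e ∈ F, p.edgeAt μ.edges.length ≠ some e := Iff.rfl

lemma isOpen_ZMinus (μ : FinPath G) {F : Set E} (hF : F.Finite) : IsOpen (ZMinus μ F) := by
  have : ZMinus μ F = ZMinus μ (F ∩ {e | G.s e = μ.rng}) := by
    ext p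
    refine ⟨fun h => ⟨h.1, fun e he => h.2 e he.1⟩, fun h => ⟨h.1, fun e he hp => ?_⟩⟩
    refine h.2 e ⟨he, ?_⟩ hp
    rw [Set.mem_setOf_eq, p.isBSeq.src _ _ hp]
    exact h.1.vtx_eq
  rw [this]
  exact TopologicalSpace.isOpen_generateFrom_of_mem
    ⟨μ, _, hF.subset Set.inter_subset_left, fun e he => he.2, rfl⟩

lemma ZMinus_empty (μ : FinPath G) : ZMinus μ ∅ = ZSet μ := by
  ext p
  simp [ZMinus, ZSet]

lemma isOpen_ZSet (μ : FinPath G) : IsOpen (ZSet μ) := by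
  rw [← ZMinus_empty]
  exact isOpen_ZMinus μ Set.finite_empty

lemma isClosed_ZSet (μ : FinPath G) : IsClosed (ZSet μ) := by
  classical
  rw [← isOpen_compl_iff, isOpen_iff_forall_mem_open]
  intro p hp
  by_cases hs : μ.src = p.src
  · have hex : ∃ i, i < μ.edges.length ∧ p.edgeAt i ≠ μ.edges[i]? := by
      by_contra hc
      push Not at hc
      exact hp ⟨hs, hc⟩
    obtain ⟨h1, h2⟩ := Nat.find_spec hex
    have hmin : ∀ j < Nat.find hex, p.edgeAt j = μ.edges[j]? := by
      intro j hj
      by_contra hne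
      exact Nat.find_min hex hj ⟨by omega, hne⟩
    set i := Nat.find hex
    obtain ⟨lam, hl, hlp⟩ := p.exists_initSeg i (fun j hj => by
      rw [hmin j hj, List.getElem?_eq_getElem (by omega)]; simp)
    rw [List.getElem?_eq_getElem h1] at h2
    refine ⟨ZMinus lam {μ.edges[i]}, fun q hq hq' => ?_, isOpen_ZMinus _ (Set.finite_singleton _),
      hlp, fun e he => ?_⟩
    · apply hq.2 _ rfl
      rw [hl, hq'.2 i h1, List.getElem?_eq_getElem h1]
    · rw [hl, Set.mem_singleton_iff.1 he]
      exact h2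
  · refine ⟨ZSet (trivialPath G p.src), fun q hq hq' => ?_, isOpen_ZSet _, isPrefixOf_trivial p⟩
    exact hs (hq'.1.trans hq.1.symm)

lemma isOpen_ZSet_edge (μ : FinPath G) (e : E) :
    IsOpen {p : BPath G | IsPrefixOf μ p ∧ p.edgeAt μ.edges.length = some e} := by
  by_cases h : G.s e = μ.rng
  · have := isOpen_ZSet (μ.snoc e h)
    simpa only [ZSet, isPrefixOf_snoc] using this
  · convert isOpen_empty
    ext p
    simp only [Set.mem_setOf_eq, Set.mem_empty_iff_false, iff_false]
    rintro ⟨h1, h2⟩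
    apply h
    rw [p.isBSeq.src _ _ h2]
    exact h1.vtx_eq

lemma isClosed_ZMinus (μ : FinPath G) (F : Set E) : IsClosed (ZMinus μ F) := by
  have : ZMinus μ F = ZSet μ ∩
      ⋂ e ∈ F, {p : BPath G | IsPrefixOf μ p ∧ p.edgeAt μ.edges.length = some e}ᶜ := by
    ext p
    simp only [ZMinus, ZSet, Set.mem_setOf_eq, Set.mem_inter_iff, Set.mem_iInter,
      Set.mem_compl_iff, not_and]
    exact ⟨fun h => ⟨h.1, fun e he _ => h.2 e he⟩, fun h => ⟨h.1, fun e he => h.2 e he h.1⟩⟩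
  rw [this]
  exact (isClosed_ZSet μ).inter
    (isClosed_biInter fun e _ => (isOpen_ZSet_edge μ e).isClosed_compl)

instance bpathT2 : T2Space (BPath G) := by
  classical
  refine ⟨fun p q hpq => ?_⟩
  have key : ∀ p q : BPath G, (∃ μ : FinPath G, IsPrefixOf μ p ∧ ¬ IsPrefixOf μ q) →
      ∃ U W : Set (BPath G), IsOpen U ∧ IsOpen W ∧ p ∈ U ∧ q ∈ W ∧ _root_.Disjoint U W := by
    rintro p q ⟨μ, h1, h2⟩
    exact ⟨ZSet μ, (ZSet μ)ᶜ, isOpen_ZSet μ, (isClosed_ZSet μ).isOpen_compl, h1, h2,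
      disjoint_compl_right⟩
  by_cases hs : p.src = q.src
  · have hex : ∃ i, p.edgeAt i ≠ q.edgeAt i := by
      by_contra hc
      push Not at hc
      exact hpq (BPath.ext' hs hc)
    have h1 := Nat.find_spec hex
    have hmin : ∀ j < Nat.find hex, p.edgeAt j = q.edgeAt j := by
      intro j hj
      by_contra hne
      exact Nat.find_min hex hj hne
    set i := Nat.find hex
    have key2 : ∀ p q : BPath G, p.edgeAt i ≠ q.edgeAt i → (∀ j < i, p.edgeAt j = q.edgeAt j) →
        p.edgeAt i ≠ none → ∃ μ : FinPath G, IsPrefixOf μ p ∧ ¬ IsPrefixOf μ q := by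
      intro p q hne hm hnn
      obtain ⟨lam, hl, hlp⟩ := p.exists_initSeg (i + 1) (fun j hj hjn => hnn
        (none_of_le p.isBSeq.nonesucc hjn (by omega)))
      refine ⟨lam, hlp, fun hq => hne ?_⟩
      rw [hlp.2 i (by omega), hq.2 i (by omega)]
    by_cases hp : p.edgeAt i = none
    · obtain ⟨U, W, hU, hW, h3, h4, h5⟩ := key q p (key2 q p h1.symm
        (fun j hj => (hmin j hj).symm) (fun hq => h1 (hp.trans hq.symm)))
      exact ⟨W, U, hW, hU, h4, h3, h5.symm⟩
    · exact key p q (key2 p q h1 hmin hp)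
  · exact key p q ⟨trivialPath G p.src, isPrefixOf_trivial p, fun h => hs h.1⟩

/-- Neighbourhood bases. -/
lemma exists_nhd {p : BPath G} {O : Set (BPath G)} (hO : IsOpen O) (hp : p ∈ O) :
    ∃ (lam : FinPath G) (F : Set E), F.Finite ∧ p ∈ ZMinus lam F ∧ ZMinus lam F ⊆ O := by
  have key : ∀ lam₁ lam₂ : FinPath G, ∀ F₁ F₂ : Set E, F₁.Finite → F₂.Finite →
      p ∈ ZMinus lam₁ F₁ → p ∈ ZMinus lam₂ F₂ → lam₁.edges.length ≤ lam₂.edges.length →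
      ∃ (lam : FinPath G) (F : Set E), F.Finite ∧ p ∈ ZMinus lam F ∧
        ZMinus lam F ⊆ ZMinus lam₁ F₁ ∩ ZMinus lam₂ F₂ := by
    intro lam₁ lam₂ F₁ F₂ hF₁ hF₂ h1 h2 hle
    rcases hle.eq_or_lt with heq | hlt
    · obtain rfl := h1.1.unique h2.1 heq
      refine ⟨lam₁, F₁ ∪ F₂, hF₁.union hF₂, ⟨h1.1, ?_⟩, fun q hq => ⟨⟨hq.1, ?_⟩, hq.1, ?_⟩⟩
      · rintro e (he | he)
        · exact h1.2 e he
        · exact h2.2 e he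
      · exact fun e he => hq.2 e (Or.inl he)
      · exact fun e he => hq.2 e (Or.inr he)
    · refine ⟨lam₂, F₂, hF₂, h2, fun q hq => ⟨⟨⟨?_, fun i hi => ?_⟩, fun e he => ?_⟩, hq⟩⟩
      · rw [h1.1.1, ← h2.1.1, hq.1.1]
      · rw [← h1.1.2 i hi, hq.1.2 i (by omega), ← h2.1.2 i (by omega)]
      · have := h1.2 e he
        rwa [h2.1.2 _ hlt, ← hq.1.2 _ hlt] at this
  induction hO with
  | basic s hs =>
    obtain ⟨μ, F, hF, -, rfl⟩ := hs
    exact ⟨μ, F, hF, hp, subset_rfl⟩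
  | univ =>
    exact ⟨trivialPath G p.src, ∅, Set.finite_empty, ⟨isPrefixOf_trivial p, by simp⟩,
      Set.subset_univ _⟩
  | inter s t _ _ ihs iht =>
    obtain ⟨l1, F1, hF1, h1, h1'⟩ := ihs hp.1
    obtain ⟨l2, F2, hF2, h2, h2'⟩ := iht hp.2
    rcases le_total l1.edges.length l2.edges.length with hle | hle
    · obtain ⟨l, F, hF, h, h'⟩ := key l1 l2 F1 F2 hF1 hF2 h1 h2 hle
      exact ⟨l, F, hF, h, fun q hq => ⟨h1' (h' hq).1, h2' (h' hq).2⟩⟩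
    · obtain ⟨l, F, hF, h, h'⟩ := key l2 l1 F2 F1 hF2 hF1 h2 h1 hle
      exact ⟨l, F, hF, h, fun q hq => ⟨h1' (h' hq).2, h2' (h' hq).1⟩⟩
  | sUnion S _ ih =>
    obtain ⟨s, hs, hps⟩ := hp
    obtain ⟨l, F, hF, h, h'⟩ := ih s hs hps
    exact ⟨l, F, hF, h, h'.trans (Set.subset_sUnion_of_mem hs)⟩

lemma exists_nhd' {p : BPath G} {O : Set (BPath G)} (hO : IsOpen O) (hp : p ∈ O) :
    ∃ (N : ℕ) (F : Set E), F.Finite ∧ ∀ lam : FinPath G, IsPrefixOf lam p →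
      (N ≤ lam.edges.length → ZSet lam ⊆ O) ∧
      (p.edgeAt lam.edges.length = none → ZMinus lam F ⊆ O) := by
  obtain ⟨l, F, hF, h, h'⟩ := exists_nhd hO hp
  have key : ∀ lam : FinPath G, IsPrefixOf lam p → l.edges.length < lam.edges.length →
      ZSet lam ⊆ O := by
    intro lam hlam hlt q hq
    apply h'
    refine ⟨⟨?_, fun i hi => ?_⟩, fun e he => ?_⟩
    · rw [h.1.1, ← hlam.1, hq.1]
    · rw [← h.1.2 i hi, hq.2 i (by omega), ← hlam.2 i (by omega)]
    · have := h.2 e he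
      rwa [hlam.2 _ hlt, ← hq.2 _ hlt] at this
  refine ⟨l.edges.length + 1, F, hF, fun lam hlam => ⟨fun hN => key lam hlam hN, fun hn => ?_⟩⟩
  rcases Nat.lt_trichotomy l.edges.length lam.edges.length with hlt | heq | hgt
  · exact fun q hq => key lam hlam hlt hq.1
  · obtain rfl := h.1.unique hlam heq
    exact h'
  · exact absurd hn (h.1.edge_ne hgt)

lemma isCompact_ZSet (μ : FinPath G) : IsCompact (ZSet μ) := by
  classical
  rw [isCompact_iff_ultrafilter_le_nhds]
  intro U hU
  have hμ : ZSet μ ∈ U := by simpa using hU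
  let L : ℕ → E → Prop := fun i e => {p : BPath G | p.edgeAt i = some e} ∈ U
  have hLu : ∀ i e e', L i e → L i e' → e = e' := by
    intro i e e' h h'
    obtain ⟨p, hp, hp'⟩ := U.nonempty_of_mem (Filter.inter_mem h h')
    simp only [Set.mem_setOf_eq] at hp hp'
    rw [hp] at hp'
    exact Option.some.inj hp'
  let f : ℕ → Option E := fun n =>
    if h : ∀ i ≤ n, ∃ e, L i e then some (h n le_rfl).choose else none
  have fsome : ∀ n e, f n = some e → (∀ i ≤ n, ∃ e, L i e) ∧ L n e := by
    intro n e h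
    by_cases hc : ∀ i ≤ n, ∃ e, L i e
    · refine ⟨hc, ?_⟩
      simp only [f, dif_pos hc, Option.some.injEq] at h
      rw [← h]
      exact (hc n le_rfl).choose_spec
    · simp only [f, dif_neg hc] at h
      cases h
  have fof : ∀ n e, (∀ i < n, ∃ e, L i e) → L n e → f n = some e := by
    intro n e h he
    have hc : ∀ i ≤ n, ∃ e, L i e := by
      intro i hi
      rcases hi.eq_or_lt with rfl | hlt
      · exact ⟨e, he⟩
      · exact h i hlt
    simp only [f, dif_pos hc, Option.some.injEq]
    exact hLu n _ _ (hc n le_rfl).choose_spec he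
  have fne : ∀ n, (∀ i < n, f i ≠ none) → ∀ i < n, ∃ e, L i e := by
    intro n h i hi
    obtain ⟨e, he⟩ := Option.ne_none_iff_exists'.1 (h i hi)
    exact ⟨e, (fsome i e he).2⟩
  have key : ∀ n, (∀ i < n, f i ≠ none) →
      {p : BPath G | p.src = μ.src ∧ ∀ i < n, p.edgeAt i = f i} ∈ U := by
    intro n
    induction n with
    | zero =>
      intro _
      filter_upwards [hμ] with p hp
      exact ⟨hp.1.symm, fun i hi => absurd hi (by omega)⟩
    | succ n ih =>
      intro h
      obtain ⟨e, he⟩ := Option.ne_none_iff_exists'.1 (h n (by omega))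
      filter_upwards [ih fun i hi => h i (by omega), (fsome n e he).2] with p hp hp'
      refine ⟨hp.1, fun i hi => ?_⟩
      rcases (Nat.lt_succ_iff.1 hi).eq_or_lt with rfl | hlt
      · rw [he]; exact hp'
      · exact hp.2 i hlt
  have fnone : ∀ n, f n = none → f (n + 1) = none := by
    intro n h
    by_contra hc
    obtain ⟨e, he⟩ := Option.ne_none_iff_exists'.1 hc
    have h1 := (fsome _ _ he).1
    obtain ⟨e', he'⟩ := h1 n (by omega)
    rw [fof n e' (fun i hi => h1 i (by omega)) he'] at h
    cases h
  have hb : IsBSeq G μ.src f := by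
    refine ⟨fun n e he => ?_, fnone, fun n hn => ?_⟩
    · have h1 : ∀ i < n, f i ≠ none := fun i hi hh => by
        rw [none_of_le fnone hh hi.le] at he
        cases he
      obtain ⟨p, hp, hp'⟩ := U.nonempty_of_mem (Filter.inter_mem (key n h1) (fsome n e he).2)
      rw [p.isBSeq.src _ _ hp', hp.1]
      exact seqVtx_congr hp.2
    · have hex : ∃ m, f m = none := ⟨n, hn⟩
      have hm := Nat.find_spec hex
      have hlt : ∀ i < Nat.find hex, f i ≠ none := fun i hi => Nat.find_min hex hi
      have hle : Nat.find hex ≤ n := Nat.find_min' hex hn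
      set m := Nat.find hex
      have hvt : seqVtx G μ.src f n = seqVtx G μ.src f m := by
        clear hn
        induction n, hle using Nat.le_induction with
        | base => rfl
        | succ k hk ih => rw [seqVtx_none (none_of_le fnone hm hk), ih]
      rw [hvt]
      by_contra hsing
      unfold Singular at hsing
      push Not at hsing
      have hfin : {e : E | G.s e = seqVtx G μ.src f m}.Finite := Set.not_infinite.1 hsing.2
      have hcov : (⋃ e ∈ {e : E | G.s e = seqVtx G μ.src f m},
          {p : BPath G | p.edgeAt m = some e}) ∈ U := by
        filter_upwards [key m hlt] with p hp
        have hv : p.vtx m = seqVtx G μ.src f m := by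
          unfold BPath.vtx
          rw [hp.1]; exact seqVtx_congr hp.2
        rcases hpe : p.edgeAt m with _ | e
        · exfalso
          have := p.isBSeq.sing m hpe
          rw [show seqVtx G p.src p.edgeAt m = _ from hv] at this
          rcases this with h1 | h1
          · exact hsing.1 h1
          · exact hsing.2 h1
        · simp only [Set.mem_iUnion]
          exact ⟨e, (p.isBSeq.src _ _ hpe).trans hv, hpe⟩
      obtain ⟨e, -, he⟩ := (Ultrafilter.finite_biUnion_mem_iff hfin).1 hcov
      rw [fof m e (fne m hlt) he] at hm
      cases hm
  obtain ⟨x, hx1, hx2⟩ := hb.exists_bpath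
  have hLμ : ∀ i (hi : i < μ.edges.length), L i μ.edges[i] := by
    intro i hi
    change {p : BPath G | p.edgeAt i = some μ.edges[i]} ∈ U
    filter_upwards [hμ] with p hp
    rw [hp.2 i hi, List.getElem?_eq_getElem hi]
  refine ⟨x, ⟨hx1.symm, fun i hi => ?_⟩, ?_⟩
  · rw [hx2, List.getElem?_eq_getElem hi]
    exact fof i _ (fun j hj => ⟨_, hLμ j (by omega)⟩) (hLμ i hi)
  · rw [TopologicalSpace.nhds_generateFrom]
    refine le_iInf₂ fun s hs => ?_
    obtain ⟨hxs, lam, F, hF, -, rfl⟩ := hs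
    rw [Filter.le_principal_iff]
    have hne : ∀ i < lam.edges.length, f i ≠ none := fun i hi => by
      rw [← hx2]; exact hxs.1.edge_ne hi
    have hF' : (⋂ e ∈ F, {p : BPath G | p.edgeAt lam.edges.length = some e}ᶜ) ∈ U := by
      refine (Filter.biInter_mem hF).2 fun e he => ?_
      refine Ultrafilter.compl_mem_iff_notMem.2 fun hc => hxs.2 e he ?_
      rw [hx2]
      exact fof _ e (fne _ hne) hc
    filter_upwards [key _ hne, hF'] with p hp hp'
    refine ⟨⟨?_, fun i hi => ?_⟩, fun e he hpe => ?_⟩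
    · rw [hxs.1.1, hx1, hp.1]
    · rw [hp.2 i hi, ← hx2, hxs.1.2 i hi]
    · simp only [Set.mem_iInter, Set.mem_compl_iff] at hp'
      exact hp' e he hpe

lemma isCompact_ZMinus (μ : FinPath G) (F : Set E) : IsCompact (ZMinus μ F) :=
  (isCompact_ZSet μ).of_isClosed_subset (isClosed_ZMinus μ F) fun _ hp => hp.1


/-! ### Deepening and swaps -/

lemma CondT.no_sink (hT : CondT G) (v : V) : ∃ e, G.s e = v := by
  by_contra hc
  push Not at hc
  obtain ⟨μ, ν, hne, h1, h2, -⟩ := hT v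
  have key : ∀ ρ : FinPath G, ρ.src = v → ρ.edges = [] := by
    intro ρ hρ
    rcases hm : ρ.edges with _ | ⟨a, l⟩
    · rfl
    · exact absurd ((ρ.src_eq a (by simp [hm])).trans hρ) (hc a)
  exact hne (FinPath.ext' (h1.trans h2.symm) ((key μ h1).trans (key ν h2).symm))

lemma extend_pair {lam μ : FinPath G} (hr : lam.rng = μ.rng) {p q : BPath G}
    (hp : IsPrefixOf lam p) (hq : IsShiftedBy lam μ p q) (n : ℕ)
    (hn : ∀ i < n, p.edgeAt (lam.edges.length + i) ≠ none) :
    ∃ lam' μ' : FinPath G, lam'.rng = μ'.rng ∧ lam'.edges.length = lam.edges.length + n ∧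
      μ'.edges.length = μ.edges.length + n ∧ IsPrefixOf lam' p ∧ IsShiftedBy lam' μ' p q ∧
      ∀ p' q', IsPrefixOf lam' p' → IsPrefixOf lam p' ∧
        (IsShiftedBy lam μ p' q' → IsShiftedBy lam' μ' p' q') := by
  induction n with
  | zero => exact ⟨lam, μ, hr, rfl, rfl, hp, hq, fun p' q' h => ⟨h, id⟩⟩
  | succ n ih =>
    obtain ⟨l, m, h1, h2, h3, h4, h5, h6⟩ := ih fun i hi => hn i (by omega)
    obtain ⟨e, he⟩ := Option.ne_none_iff_exists'.1 (hn n (by omega))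
    rw [← h2] at he
    have hse : G.s e = l.rng := (p.isBSeq.src _ _ he).trans h4.vtx_eq
    have key : ∀ p' q', IsPrefixOf (l.snoc e hse) p' → IsShiftedBy l m p' q' →
        IsShiftedBy (l.snoc e hse) (m.snoc e (hse.trans h1)) p' q' := by
      intro p' q' hp' hq'
      have h7 := isPrefixOf_snoc.1 hp'
      refine ⟨isPrefixOf_snoc.2 ⟨hq'.1, ?_⟩, fun k => ?_⟩
      · have := hq'.2 0
        rw [add_zero, add_zero] at this
        rw [← this, h7.2]
      · rw [FinPath.snoc_length, FinPath.snoc_length, add_assoc, add_assoc]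
        exact hq'.2 (1 + k)
    have h8 : IsPrefixOf (l.snoc e hse) p := isPrefixOf_snoc.2 ⟨h4, he⟩
    refine ⟨l.snoc e hse, m.snoc e (hse.trans h1), ?_, ?_, ?_, h8, key _ _ h8 h5, ?_⟩
    · rw [FinPath.snoc_rng, FinPath.snoc_rng]
    · rw [FinPath.snoc_length]; omega
    · rw [FinPath.snoc_length]; omega
    · intro p' q' hp'
      have h9 := h6 p' q' (isPrefixOf_snoc.1 hp').1
      exact ⟨h9.1, fun hs => key _ _ hp' (h9.2 hs)⟩

lemma deepen (hns : ∀ v, ∃ e, G.s e = v) {lam μ : FinPath G} (hr : lam.rng = μ.rng)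
    {p q : BPath G} (hp : IsPrefixOf lam p) (hq : IsShiftedBy lam μ p q)
    {U W : Set (BPath G)} (hU : IsOpen U) (hW : IsOpen W) (hpU : p ∈ U) (hqW : q ∈ W) :
    ∃ (lam' μ' : FinPath G) (F : Set E), F.Finite ∧ lam'.rng = μ'.rng ∧
      F ⊂ {e | G.s e = μ'.rng} ∧ p ∈ ZMinus lam' F ∧ ZMinus lam' F ⊆ U ∧
      q ∈ ZMinus μ' F ∧ ZMinus μ' F ⊆ W ∧ IsShiftedBy lam' μ' p q ∧
      ∀ p' q', IsPrefixOf lam' p' → IsPrefixOf lam p' ∧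
        (IsShiftedBy lam μ p' q' → IsShiftedBy lam' μ' p' q') := by
  classical
  obtain ⟨N1, F1, hF1, H1⟩ := exists_nhd' hU hpU
  obtain ⟨N2, F2, hF2, H2⟩ := exists_nhd' hW hqW
  by_cases hinf : ∀ n, p.edgeAt n ≠ none
  · obtain ⟨l, m, h1, h2, h3, h4, h5, h6⟩ := extend_pair hr hp hq (N1 + N2) fun i _ => hinf _
    refine ⟨l, m, ∅, Set.finite_empty, h1, ?_, ?_, ?_, ?_, ?_, h5, h6⟩
    · rw [Set.empty_ssubset]
      exact hns _
    · rw [ZMinus_empty]; exact h4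
    · rw [ZMinus_empty]; exact (H1 l h4).1 (by omega)
    · rw [ZMinus_empty]; exact h5.1
    · rw [ZMinus_empty]; exact (H2 m h5.1).1 (by omega)
  · push Not at hinf
    have hex : ∃ n, p.edgeAt (lam.edges.length + n) = none := by
      obtain ⟨n, hn⟩ := hinf
      exact ⟨n, none_of_le p.isBSeq.nonesucc hn (by omega)⟩
    obtain ⟨l, m, h1, h2, h3, h4, h5, h6⟩ := extend_pair hr hp hq (Nat.find hex)
      fun i hi => Nat.find_min hex hi
    have hpn : p.edgeAt l.edges.length = none := by rw [h2]; exact Nat.find_spec hex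
    have hqn : q.edgeAt m.edges.length = none := by
      have := h5.2 0
      rw [add_zero, add_zero] at this
      rw [← this, hpn]
    have hinfE : InfEmitter G m.rng := by
      have := q.isBSeq.sing _ hqn
      rw [show seqVtx G q.src q.edgeAt m.edges.length = m.rng from h5.1.vtx_eq] at this
      rcases this with h | h
      · obtain ⟨e, he⟩ := hns m.rng
        exact absurd he (h e)
      · exact h
    have hcut : ∀ (ρ : FinPath G) (F : Set E), F ⊆ F1 ∪ F2 → ρ.rng = m.rng →
        ZMinus ρ ((F1 ∪ F2) ∩ {e | G.s e = m.rng}) ⊆ ZMinus ρ F := by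
      intro ρ F hF hρ x hx
      refine ⟨hx.1, fun e he hxe => hx.2 e ⟨hF he, ?_⟩ hxe⟩
      have := (x.isBSeq.src _ _ hxe).trans hx.1.vtx_eq
      exact this.trans hρ
    refine ⟨l, m, (F1 ∪ F2) ∩ {e | G.s e = m.rng}, (hF1.union hF2).subset Set.inter_subset_left,
      h1, ?_, ⟨h4, ?_⟩, ?_, ⟨h5.1, ?_⟩, ?_, h5, h6⟩
    · refine ⟨Set.inter_subset_right, fun hsub => hinfE ?_⟩
      exact ((hF1.union hF2).subset Set.inter_subset_left).subset hsub
    · intro e _; rw [hpn]; simp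
    · exact (hcut l F1 Set.subset_union_left h1).trans ((H1 l h4).2 hpn)
    · intro e _; rw [hqn]; simp
    · exact (hcut m F2 Set.subset_union_right rfl).trans ((H2 m h5.1).2 hqn)

lemma ZMinus.shift {lam μ : FinPath G} {F : Set E} {p q : BPath G}
    (hp : p ∈ ZMinus lam F) (h : IsShiftedBy lam μ p q) : q ∈ ZMinus μ F := by
  refine ⟨h.1, fun e he hq => hp.2 e he ?_⟩
  have := h.2 0
  rw [add_zero, add_zero] at this
  rw [this, hq]

lemma continuousAt_shift (hns : ∀ v, ∃ e, G.s e = v) {lam μ : FinPath G} (hr : lam.rng = μ.rng)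
    {F : Set E} (hF : F.Finite) {f : BPath G → BPath G}
    (hf : ∀ p ∈ ZMinus lam F, IsShiftedBy lam μ p (f p)) {p : BPath G} (hp : p ∈ ZMinus lam F) :
    ContinuousAt f p := by
  rw [ContinuousAt, Filter.tendsto_def]
  intro s hs
  obtain ⟨O, hOs, hO, hpO⟩ := mem_nhds_iff.1 hs
  obtain ⟨l, m, F', hF', h1, -, h2, -, h3, h4, h5, h6⟩ :=
    deepen hns hr hp.1 (hf p hp) isOpen_univ hO (Set.mem_univ _) hpO
  have : ZMinus l F' ∩ ZMinus lam F ∈ nhds p :=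
    ((isOpen_ZMinus l hF').inter (isOpen_ZMinus lam hF)).mem_nhds ⟨h2, hp⟩
  refine Filter.mem_of_superset this fun x hx => hOs (h4 ?_)
  exact ZMinus.shift hx.1 ((h6 x (f x) hx.1.1).2 (hf x hx.2))

lemma exists_cylSwap (hns : ∀ v, ∃ e, G.s e = v) {lam μ : FinPath G} (hr : lam.rng = μ.rng)
    {F : Set E} (hF : F.Finite) (hFs : F ⊂ {e | G.s e = μ.rng})
    (hd : ZMinus lam F ∩ ZMinus μ F = ∅) :
    ∃ α : BPath G ≃ₜ BPath G, InFullGroup G α ∧ (∀ p, α (α p) = p) ∧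
      (∀ p ∈ ZMinus lam F ∪ ZMinus μ F, α p ≠ p) ∧
      (∀ p ∉ ZMinus lam F ∪ ZMinus μ F, α p = p) := by
  classical
  have hd1 : ∀ p, p ∈ ZMinus lam F → p ∉ ZMinus μ F := fun p h1 h2 => by
    have : p ∈ ZMinus lam F ∩ ZMinus μ F := ⟨h1, h2⟩
    rw [hd] at this
    exact this
  let f : BPath G → BPath G := fun p =>
    if h : p ∈ ZMinus lam F then (exists_shift hr h.1).choose
    else if h : p ∈ ZMinus μ F then (exists_shift hr.symm h.1).choose else p
  have f1 : ∀ p ∈ ZMinus lam F, IsShiftedBy lam μ p (f p) := by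
    intro p hp
    have : f p = (exists_shift hr hp.1).choose := by simp only [f, dif_pos hp]
    rw [this]
    exact (exists_shift hr hp.1).choose_spec
  have f2 : ∀ p ∈ ZMinus μ F, IsShiftedBy μ lam p (f p) := by
    intro p hp
    have : f p = (exists_shift hr.symm hp.1).choose := by
      simp only [f, dif_neg (fun h => hd1 p h hp), dif_pos hp]
    rw [this]
    exact (exists_shift hr.symm hp.1).choose_spec
  have f3 : ∀ p ∉ ZMinus lam F ∪ ZMinus μ F, f p = p := by
    intro p hp
    have hp1 : p ∉ ZMinus lam F := fun h => hp (Or.inl h)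
    have hp2 : p ∉ ZMinus μ F := fun h => hp (Or.inr h)
    simp only [f, dif_neg hp1, dif_neg hp2]
  have g1 : ∀ p ∈ ZMinus lam F, f p ∈ ZMinus μ F := fun p hp => ZMinus.shift hp (f1 p hp)
  have g2 : ∀ p ∈ ZMinus μ F, f p ∈ ZMinus lam F := fun p hp => ZMinus.shift hp (f2 p hp)
  have ff : ∀ p, f (f p) = p := by
    intro p
    by_cases h1 : p ∈ ZMinus lam F
    · exact (f2 _ (g1 p h1)).unique ((f1 p h1).symm h1.1)
    · by_cases h2 : p ∈ ZMinus μ F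
      · exact (f1 _ (g2 p h2)).unique ((f2 p h2).symm h2.1)
      · have : p ∉ ZMinus lam F ∪ ZMinus μ F := fun h => h.elim h1 h2
        rw [f3 p this, f3 p this]
  have hc : Continuous f := by
    rw [continuous_iff_continuousAt]
    intro p
    by_cases h1 : p ∈ ZMinus lam F
    · exact continuousAt_shift hns hr hF f1 h1
    · by_cases h2 : p ∈ ZMinus μ F
      · exact continuousAt_shift hns hr.symm hF f2 h2
      · have ho : IsOpen (ZMinus lam F ∪ ZMinus μ F)ᶜ :=
          ((isClosed_ZMinus lam F).union (isClosed_ZMinus μ F)).isOpen_compl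
        have hp : p ∈ (ZMinus lam F ∪ ZMinus μ F)ᶜ := fun h => h.elim h1 h2
        have : f =ᶠ[nhds p] id := by
          filter_upwards [ho.mem_nhds hp] with x hx using f3 x hx
        exact continuousAt_id.congr this.symm
  let α : BPath G ≃ₜ BPath G := ⟨⟨f, f, ff, ff⟩, hc, hc⟩
  have hα : ∀ p, α p = f p := fun p => rfl
  have hun : (⋃ i : Fin 2, ZMinus ((![lam, μ] : Fin 2 → FinPath G) i)
      ((![F, F] : Fin 2 → Set E) i)) = ZMinus lam F ∪ ZMinus μ F := by
    ext p; simp [Fin.exists_fin_two]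
  have hun' : (⋃ i : Fin 2, ZMinus ((![μ, lam] : Fin 2 → FinPath G) i)
      ((![F, F] : Fin 2 → Set E) i)) = ZMinus lam F ∪ ZMinus μ F := by
    ext p; simp [Fin.exists_fin_two, or_comm]
  have hd' : ZMinus μ F ∩ ZMinus lam F = ∅ := by rw [Set.inter_comm]; exact hd
  refine ⟨α, ⟨2, ![μ, lam], ![lam, μ], ![F, F], ?_, ?_, ?_, ?_, ?_, ?_, ?_, ?_⟩, ff, ?_, f3⟩
  · intro i; fin_cases i
    · exact hr.symm
    · exact hr
  · intro i; fin_cases i <;> exact hF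
  · intro i; fin_cases i
    · exact hFs
    · show F ⊂ {e | G.s e = lam.rng}
      rw [hr]; exact hFs
  · intro i j hij
    fin_cases i <;> fin_cases j <;> first | exact absurd rfl hij | exact hd | exact hd'
  · intro i j hij
    fin_cases i <;> fin_cases j <;> first | exact absurd rfl hij | exact hd | exact hd'
  · rw [hun, hun']
  · intro i; fin_cases i
    · exact f1
    · exact f2
  · rw [hun]; exact f3
  · rintro p (hp | hp) h
    · have := g1 p hp
      rw [← hα, h] at this
      exact hd1 p hp this
    · have := g2 p hp
      rw [← hα, h] at this
      exact hd1 p this hp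

/-! ### Many elements and supports -/

lemma ZSet_nonempty (hns : ∀ v, ∃ e, G.s e = v) (ν : FinPath G) : (ZSet ν).Nonempty := by
  choose c hc using hns
  let w : ℕ → V := fun n => (fun v => G.r (c v))^[n] ν.rng
  let x : InfPath G := ⟨fun n => c (w n), fun i => by
    rw [hc]
    simp only [w]
    rw [Function.iterate_succ_apply']⟩
  obtain ⟨q, hq, -⟩ := exists_glue ν (Sum.inr x) 0 (hc ν.rng).symm
  exact ⟨q, hq⟩

lemma exists_disjoint_pair (hL : CondL G) (hT : CondT G) (v : V) :
    ∃ ρ₁ ρ₂ : FinPath G, ρ₁.src = v ∧ ρ₂.src = v ∧ ρ₁.rng = ρ₂.rng ∧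
      ∃ i, i < ρ₁.edges.length ∧ i < ρ₂.edges.length ∧ ρ₁.edges[i]? ≠ ρ₂.edges[i]? := by
  have key : ∀ μ ν : FinPath G, μ ≠ ν → μ.src = v → ν.src = v → μ.rng = ν.rng →
      μ.edges.length ≤ ν.edges.length → ∃ ρ₁ ρ₂ : FinPath G, ρ₁.src = v ∧ ρ₂.src = v ∧
      ρ₁.rng = ρ₂.rng ∧
      ∃ i, i < ρ₁.edges.length ∧ i < ρ₂.edges.length ∧ ρ₁.edges[i]? ≠ ρ₂.edges[i]? := by
    intro μ ν hne hμ hν hr hle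
    by_cases hex : ∃ i, i < μ.edges.length ∧ μ.edges[i]? ≠ ν.edges[i]?
    · obtain ⟨i, hi, h⟩ := hex
      exact ⟨μ, ν, hμ, hν, hr, i, hi, by omega, h⟩
    push Not at hex
    have hpre : ν.edges = μ.edges ++ ν.edges.drop μ.edges.length := by
      have : μ.edges = ν.edges.take μ.edges.length := by
        apply List.ext_getElem?
        intro i
        by_cases hi : i < μ.edges.length
        · rw [hex i hi, List.getElem?_take_of_lt hi]
        · rw [List.getElem?_eq_none (by omega), List.getElem?_eq_none]
          simp only [List.length_take]
          omega
      conv_lhs => rw [← List.take_append_drop μ.edges.length ν.edges]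
      rw [← this]
    obtain ⟨α, τ, h1, h2, h3, h4, h5⟩ := ν.split _ _ hpre
    have hα : α = μ := FinPath.ext' (h3.trans (hν.trans hμ.symm)) h1
    subst hα
    have hτ : τ.IsCycle := by
      refine ⟨fun h0 => hne ?_, by rw [h5, h4, hr]⟩
      apply FinPath.ext' h3
      rw [hpre, ← h2, h0, List.append_nil]
    obtain ⟨⟨i, hi⟩, e, he, hne'⟩ := hL τ hτ
    simp only [List.get_eq_getElem] at he hne'
    obtain ⟨a, b, k1, k2, k3, k4, k5⟩ := τ.split _ _ (List.take_append_drop i τ.edges).symm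
    have hea : G.s e = a.rng := by
      rw [he, ← k4]
      apply b.src_eq
      rw [k2]
      simp [List.head?_drop, hi]
    have hal : a.edges.length = i := by rw [k1, List.length_take]; omega
    have hla : (α.app a (k3.trans h4)).edges.length = α.edges.length + i := by
      simp [FinPath.app, hal]
    have hlen : ν.edges.length = α.edges.length + τ.edges.length := by
      conv_lhs => rw [hpre]
      rw [List.length_append, h2]
    refine ⟨(α.app a (k3.trans h4)).snoc e (by rw [FinPath.app_rng, hea]),
      (ν.app a (k3.trans (h4.trans hr))).snoc e (by rw [FinPath.app_rng, hea]), hμ, hν, ?_,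
      α.edges.length + i, ?_, ?_, ?_⟩
    · rw [FinPath.snoc_rng, FinPath.snoc_rng]
    · rw [FinPath.snoc_length, hla]; omega
    · rw [FinPath.snoc_length]
      simp only [FinPath.app, List.length_append]
      omega
    · have e1 : ((α.app a (k3.trans h4)).snoc e (by rw [FinPath.app_rng, hea])).edges =
          (α.app a (k3.trans h4)).edges ++ [e] := rfl
      have e2 : ((ν.app a (k3.trans (h4.trans hr))).snoc e
          (by rw [FinPath.app_rng, hea])).edges = (ν.edges ++ a.edges) ++ [e] := rfl
      rw [e1, e2, ← hla, List.getElem?_append_right le_rfl, hla, List.append_assoc,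
        List.getElem?_append_left (by omega), hpre, ← h2,
        List.getElem?_append_right (by omega)]
      simp only [Nat.sub_self, Nat.add_sub_cancel_left]
      rw [List.getElem?_eq_getElem hi]
      simpa using hne'
  obtain ⟨μ, ν, hne, hμ, hν, hr⟩ := hT v
  rcases le_total μ.edges.length ν.edges.length with h | h
  · exact key μ ν hne hμ hν hr h
  · exact key ν μ hne.symm hν hμ hr.symm h

lemma exists_ZSet_subset (hns : ∀ v, ∃ e, G.s e = v) {O : Set (BPath G)} (hO : IsOpen O)
    (hne : O.Nonempty) : ∃ ν : FinPath G, ZSet ν ⊆ O := by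
  classical
  obtain ⟨p, hp⟩ := hne
  obtain ⟨N, F, hF, H⟩ := exists_nhd' hO hp
  by_cases hinf : ∀ n, p.edgeAt n ≠ none
  · obtain ⟨μ, hl, hμ⟩ := p.exists_initSeg N fun i _ => hinf i
    exact ⟨μ, (H μ hμ).1 hl.ge⟩
  · push Not at hinf
    obtain ⟨μ, hl, hμ⟩ := p.exists_initSeg (Nat.find hinf) fun i hi => Nat.find_min hinf hi
    have hn : p.edgeAt μ.edges.length = none := by rw [hl]; exact Nat.find_spec hinf
    have hs := p.isBSeq.sing _ hn
    rw [show seqVtx G p.src p.edgeAt μ.edges.length = μ.rng from hμ.vtx_eq] at hs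
    have hi : InfEmitter G μ.rng := by
      rcases hs with h | h
      · obtain ⟨e, he⟩ := hns μ.rng
        exact absurd he (h e)
      · exact h
    obtain ⟨e, he, heF⟩ := Set.Infinite.exists_notMem_finite hi hF
    refine ⟨μ.snoc e he, fun x hx => (H μ hμ).2 hn ?_⟩
    have hx' := isPrefixOf_snoc.1 hx
    refine ⟨hx'.1, fun f hf hxf => heF ?_⟩
    rw [hx'.2] at hxf
    rw [Option.some.inj hxf]
    exact hf

lemma exists_many (hL : CondL G) (hT : CondT G) {O : Set (BPath G)} (hO : IsOpen O)
    (hne : O.Nonempty) : ∃ α : BPath G ≃ₜ BPath G, InFullGroup G α ∧ (∀ p, α (α p) = p) ∧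
      (∃ p, α p ≠ p) ∧ ∀ p, α p ≠ p → p ∈ O := by
  have hns := hT.no_sink
  obtain ⟨ν, hν⟩ := exists_ZSet_subset hns hO hne
  obtain ⟨ρ₁, ρ₂, h1, h2, hr, i, hi1, hi2, hi⟩ := exists_disjoint_pair hL hT ν.rng
  have hr' : (ν.app ρ₁ h1).rng = (ν.app ρ₂ h2).rng := by
    rw [FinPath.app_rng, FinPath.app_rng, hr]
  have hg : ∀ (ρ : FinPath G) (h : ρ.src = ν.rng), i < ρ.edges.length → ∀ p : BPath G,
      IsPrefixOf (ν.app ρ h) p →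
      p.edgeAt (ν.edges.length + i) = ρ.edges[i]? := by
    intro ρ h hi p hp
    rw [hp.2 _ (by simp only [FinPath.app, List.length_append]; omega)]
    simp only [FinPath.app]
    rw [List.getElem?_append_right (by omega), Nat.add_sub_cancel_left]
  have hsub : ∀ (ρ : FinPath G) (h : ρ.src = ν.rng), ZSet (ν.app ρ h) ⊆ O := by
    intro ρ h p hp
    refine hν ⟨hp.1, fun j hj => ?_⟩
    rw [hp.2 j (by simp only [FinPath.app, List.length_append]; omega)]
    simp only [FinPath.app]
    rw [List.getElem?_append_left hj]
  have hd : ZMinus (ν.app ρ₁ h1) ∅ ∩ ZMinus (ν.app ρ₂ h2) ∅ = ∅ := by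
    rw [Set.eq_empty_iff_forall_notMem]
    rintro p ⟨hp1, hp2⟩
    exact hi ((hg ρ₁ h1 hi1 p hp1.1).symm.trans (hg ρ₂ h2 hi2 p hp2.1))
  obtain ⟨α, hα, hαα, hm, hf⟩ := exists_cylSwap hns hr' Set.finite_empty
    (Set.empty_ssubset.2 (hns _)) hd
  refine ⟨α, hα, hαα, ?_, fun p hp => ?_⟩
  · obtain ⟨p, hp⟩ := ZSet_nonempty hns (ν.app ρ₁ h1)
    exact ⟨p, hm p (Or.inl (by rw [ZMinus_empty]; exact hp))⟩
  · by_contra hc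
    apply hp
    apply hf
    rw [ZMinus_empty, ZMinus_empty]
    exact fun h => hc (h.elim (fun h => hsub ρ₁ h1 h) (fun h => hsub ρ₂ h2 h))

lemma not_isolated (hL : CondL G) (hT : CondT G) (p : BPath G) : ¬ IsOpen ({p} : Set (BPath G)) := by
  intro h
  obtain ⟨α, -, h2, ⟨x, hx⟩, h3⟩ := exists_many hL hT h ⟨p, rfl⟩
  have e1 : x = p := h3 x hx
  have e2 : α x = p := h3 (α x) (by rw [h2]; exact hx.symm)
  exact hx (e2.trans e1.symm)

lemma IsShiftedBy.self_unique {lam μ : FinPath G} {q q' : BPath G}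
    (h : IsShiftedBy lam μ q q) (h' : IsShiftedBy lam μ q' q')
    (hlt : lam.edges.length < μ.edges.length) : q = q' := by
  apply BPath.ext' (h.1.1.symm.trans h'.1.1)
  intro n
  induction n using Nat.strong_induction_on with
  | _ n ih =>
    rcases Nat.lt_or_ge n μ.edges.length with hn | hn
    · rw [h.1.2 n hn, h'.1.2 n hn]
    · obtain ⟨m, rfl⟩ := Nat.exists_eq_add_of_le hn
      rw [← h.2 m, ← h'.2 m]
      exact ih _ (by omega)

lemma InFullGroup.closure_moved (hL : CondL G) (hT : CondT G) {α : BPath G ≃ₜ BPath G}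
    (hα : InFullGroup G α) :
    IsOpen (closure {p | α p ≠ p}) ∧ IsCompact (closure {p | α p ≠ p}) := by
  obtain ⟨k, μ, lam, F, h1, h2, h3, h4, h5, h6, h7, h8⟩ := hα
  have hcl : IsClosed (⋃ i : {i : Fin k // lam i ≠ μ i}, ZMinus (lam i) (F i)) :=
    isClosed_iUnion_of_finite fun i => isClosed_ZMinus _ _
  have : closure {p | α p ≠ p} =
      ⋃ i : {i : Fin k // lam i ≠ μ i}, ZMinus (lam i) (F i) := by
    apply subset_antisymm
    · refine closure_minimal (fun p hp => ?_) hcl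
      by_contra hc
      apply hp
      by_cases hu : p ∈ ⋃ i, ZMinus (lam i) (F i)
      · obtain ⟨i, hi⟩ := Set.mem_iUnion.1 hu
        by_cases he : lam i = μ i
        · have hs := h7 i p hi
          rw [← he] at hs
          exact hs.unique ⟨hi.1, fun n => rfl⟩
        · exact absurd (Set.mem_iUnion.2 ⟨⟨i, he⟩, hi⟩) hc
      · exact h8 p hu
    · intro p hp
      obtain ⟨⟨i, hi⟩, hpi⟩ := Set.mem_iUnion.1 hp
      by_contra hc
      have hW : IsOpen (ZMinus (lam i) (F i) ∩ (closure {p | α p ≠ p})ᶜ) :=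
        (isOpen_ZMinus _ (h2 i)).inter isClosed_closure.isOpen_compl
      have hs : ∀ q ∈ ZMinus (lam i) (F i) ∩ (closure {p | α p ≠ p})ᶜ,
          IsPrefixOf (lam i) q ∧ IsShiftedBy (lam i) (μ i) q q := by
        intro q hq
        refine ⟨hq.1.1, ?_⟩
        have hfix : α q = q := by
          by_contra hn
          exact hq.2 (subset_closure hn)
        have := h7 i q hq.1
        rwa [hfix] at this
      have hsing : ZMinus (lam i) (F i) ∩ (closure {p | α p ≠ p})ᶜ = {p} := by
        apply subset_antisymm
        · intro q hq
          have a := hs q hq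
          have b := hs p ⟨hpi, hc⟩
          rcases lt_trichotomy (lam i).edges.length (μ i).edges.length with h | h | h
          · exact a.2.self_unique b.2 h
          · exact absurd (a.1.unique a.2.1 h) hi
          · exact (a.2.symm a.1).self_unique (b.2.symm b.1) h
        · rintro q rfl
          exact ⟨hpi, hc⟩
      rw [hsing] at hW
      exact not_isolated hL hT p hW
  rw [this]
  exact ⟨isOpen_iUnion fun i => isOpen_ZMinus _ (h2 i),
    isCompact_iUnion fun i => isCompact_ZMinus _ _⟩

/-! ### Orbits have at least three points -/

/-- Tail equivalence with explicit lags. -/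
def BRel (p q : BPath G) : Prop :=
  ∃ k l : ℕ, (∀ i < k, p.edgeAt i ≠ none) ∧ (∀ i < l, q.edgeAt i ≠ none) ∧ p.vtx k = q.vtx l ∧
    ∀ n, p.edgeAt (k + n) = q.edgeAt (l + n)

lemma BRel.refl (p : BPath G) : BRel p p :=
  ⟨0, 0, by simp, by simp, rfl, fun _ => rfl⟩

lemma BRel.symm {p q : BPath G} (h : BRel p q) : BRel q p := by
  obtain ⟨k, l, h1, h2, h3, h4⟩ := h
  exact ⟨l, k, h2, h1, h3.symm, fun n => (h4 n).symm⟩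

lemma BRel.trans {p q r : BPath G} (h : BRel p q) (h' : BRel q r) : BRel p r := by
  have key : ∀ (p q r : BPath G) (k l l' m : ℕ), l ≤ l' →
      (∀ i < k, p.edgeAt i ≠ none) → p.vtx k = q.vtx l →
      (∀ n, p.edgeAt (k + n) = q.edgeAt (l + n)) →
      (∀ i < l', q.edgeAt i ≠ none) → (∀ i < m, r.edgeAt i ≠ none) → q.vtx l' = r.vtx m →
      (∀ n, q.edgeAt (l' + n) = r.edgeAt (m + n)) → BRel p r := by
    intro p q r k l l' m hle h1 h2 h3 h4 h5 h6 h7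
    obtain ⟨d, rfl⟩ := Nat.exists_eq_add_of_le hle
    refine ⟨k + d, m, fun i hi => ?_, h5, (seqVtx_shift h2 h3 d).trans h6, fun n => ?_⟩
    · rcases Nat.lt_or_ge i k with hk | hk
      · exact h1 i hk
      · obtain ⟨j, rfl⟩ := Nat.exists_eq_add_of_le hk
        rw [h3]
        exact h4 _ (by omega)
    · rw [add_assoc, h3, ← add_assoc, h7]
  obtain ⟨k, l, h1, h2, h3, h4⟩ := h
  obtain ⟨l', m, g1, g2, g3, g4⟩ := h'
  rcases le_total l l' with hle | hle
  · exact key p q r k l l' m hle h1 h3 h4 g1 g2 g3 g4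
  · exact (key r q p m l' l k hle g2 g3.symm (fun n => (g4 n).symm) h2 h1 h3.symm
      (fun n => (h4 n).symm)).symm

lemma BRel.exists_shift {p q : BPath G} (h : BRel p q) :
    ∃ lam μ : FinPath G, lam.rng = μ.rng ∧ IsPrefixOf lam p ∧ IsShiftedBy lam μ p q := by
  obtain ⟨k, l, h1, h2, h3, h4⟩ := h
  obtain ⟨lam, e1, hp⟩ := p.exists_initSeg k h1
  obtain ⟨μ, e2, hq⟩ := q.exists_initSeg l h2
  subst e1 e2
  exact ⟨lam, μ, by rw [← hp.vtx_eq, ← hq.vtx_eq, h3], hp, hq, h4⟩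

lemma exists_cons (y : BPath G) (e : E) (he : G.r e = y.src) :
    ∃ q : BPath G, q.src = G.s e ∧ q.edgeAt 0 = some e ∧ (∀ n, q.edgeAt (n + 1) = y.edgeAt n) ∧
      BRel y q := by
  obtain ⟨q, h1, h2⟩ := exists_glue (FinPath.single G e) y 0 he
  have h0 : q.edgeAt 0 = some e := h1.2 0 (by simp [FinPath.single])
  have h3 : ∀ n, q.edgeAt (n + 1) = y.edgeAt n := fun n => by
    have := h2 n
    rw [zero_add] at this
    rw [this, add_comm]
    rfl
  refine ⟨q, h1.1.symm, h0, h3, 0, 1, by simp, ?_, ?_, fun n => by rw [zero_add, add_comm, h3]⟩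
  · intro i hi
    obtain rfl : i = 0 := by omega
    rw [h0]; simp
  · rw [BPath.vtx, BPath.vtx, seqVtx_some h0, he]; rfl

lemma exists_drop (p : BPath G) (k : ℕ) (hk : ∀ i < k, p.edgeAt i ≠ none) :
    ∃ q : BPath G, q.src = p.vtx k ∧ (∀ n, q.edgeAt n = p.edgeAt (k + n)) ∧ BRel p q := by
  obtain ⟨q, h1, h2⟩ := exists_glue (trivialPath G (p.vtx k)) p k rfl
  have h3 : ∀ n, q.edgeAt n = p.edgeAt (k + n) := fun n => by
    rw [h2 n]
    simp [trivialPath]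
  refine ⟨q, h1.1.symm, h3, k, 0, hk, by simp, h1.1, fun n => by rw [zero_add, h3]⟩

/-- The orbit of `y` has two further points. -/
def Three (y : BPath G) : Prop :=
  ∃ a b : BPath G, BRel y a ∧ BRel y b ∧ y ≠ a ∧ y ≠ b ∧ a ≠ b

lemma Three.of_rel {p y : BPath G} (h : BRel p y) (hy : Three y) : Three p := by
  obtain ⟨a, b, h1, h2, h3, h4, h5⟩ := hy
  by_cases e1 : p = y
  · subst e1
    exact ⟨a, b, h1, h2, h3, h4, h5⟩
  by_cases e2 : p = a
  · subst e2
    exact ⟨y, b, h, h.trans h2, e1, h5, h4⟩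
  · exact ⟨y, a, h, h.trans h1, e1, e2, h3⟩

lemma ne_of_edgeAt {p q : BPath G} (n : ℕ) (h : p.edgeAt n ≠ q.edgeAt n) : p ≠ q := by
  rintro rfl
  exact h rfl

lemma three_of {y : BPath G} (h01 : y.edgeAt 1 = y.edgeAt 0) {f : E} (hf : G.r f = y.src)
    (hf0 : y.edgeAt 0 ≠ some f)
    (H : (∃ g, G.r g = G.s f) ∨ ∃ h, h ≠ f ∧ G.r h = y.src ∧ y.edgeAt 0 ≠ some h) : Three y := by
  obtain ⟨q, q1, q2, q3, q4⟩ := exists_cons y f hf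
  rcases H with ⟨g, hg⟩ | ⟨h, h1, h2, h3⟩
  · obtain ⟨r, r1, r2, r3, r4⟩ := exists_cons q g (hg.trans q1.symm)
    refine ⟨q, r, q4, q4.trans r4, ne_of_edgeAt 0 ?_, ne_of_edgeAt 1 ?_, ne_of_edgeAt 1 ?_⟩
    · rw [q2]; exact hf0
    · rw [r3 0, q2, h01]; exact hf0
    · rw [r3 0, q3 0, q2]; exact hf0
  · obtain ⟨r, r1, r2, r3, r4⟩ := exists_cons y h h2
    refine ⟨q, r, q4, r4, ne_of_edgeAt 0 ?_, ne_of_edgeAt 0 ?_, ne_of_edgeAt 0 ?_⟩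
    · rw [q2]; exact hf0
    · rw [r2]; exact h3
    · rw [q2, r2]
      intro hh
      exact h1 (Option.some.inj hh).symm

lemma three_finite (hns : ∀ v, ∃ e, G.s e = v) (hdeg : ∀ v, ¬ Degenerate G v) {y : BPath G}
    (h0 : y.edgeAt 0 = none) : Three y := by
  have hs : Singular G y.src := y.isBSeq.sing 0 h0
  have hi : InfEmitter G y.src := by
    rcases hs with h | h
    · obtain ⟨e, he⟩ := hns y.src
      exact absurd he (h e)
    · exact h
  have hr : (recvSet G y.src).Nonempty := by
    rw [Set.nonempty_iff_ne_empty]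
    exact fun h => hdeg y.src (Or.inr (Or.inr (Or.inr (Or.inl ⟨hi, h⟩))))
  obtain ⟨f, hf⟩ := hr
  have hf' : G.r f = y.src := hf
  refine three_of (by rw [y.isBSeq.nonesucc 0 h0, h0]) hf' (by rw [h0]; simp) ?_
  by_contra hc
  push Not at hc
  apply hdeg y.src
  refine Or.inr (Or.inr (Or.inr (Or.inr (Or.inl ⟨hs, f, ?_, ?_⟩))))
  · ext h
    simp only [recvSet, Set.mem_ofPred_eq, Set.mem_singleton_iff]
    constructor
    · intro hh
      by_contra hne
      have := hc.2 h hne hh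
      rw [h0] at this
      simp at this
    · rintro rfl; exact hf'
  · rw [Set.eq_empty_iff_forall_notMem]
    exact fun g hg => hc.1 g hg

lemma three_const (hdeg : ∀ v, ¬ Degenerate G v) {y : BPath G} {e : E}
    (h0 : ∀ n, y.edgeAt n = some e) : Three y := by
  have hs : G.s e = y.src := y.isBSeq.src 0 e (h0 0)
  have hr : G.r e = y.src := by
    have := y.isBSeq.src 1 e (h0 1)
    rw [seqVtx_some (h0 0)] at this
    rw [← this, hs]
  have h1 : ∃ f, f ≠ e ∧ G.r f = y.src := by
    by_contra hc
    push Not at hc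
    apply hdeg y.src
    refine Or.inl ⟨e, ?_, hs⟩
    ext f
    simp only [recvSet, Set.mem_ofPred_eq, Set.mem_singleton_iff]
    constructor
    · intro hf
      by_contra hne
      exact hc f hne hf
    · rintro rfl; exact hr
  obtain ⟨f, hfe, hf⟩ := h1
  refine three_of (by rw [h0, h0]) hf (by rw [h0]; simpa using hfe.symm) ?_
  by_contra hc
  push Not at hc
  apply hdeg y.src
  refine Or.inr (Or.inl ⟨e, f, hfe.symm, ?_, hs, ?_⟩)
  · ext h
    simp only [recvSet, Set.mem_ofPred_eq, Set.mem_insert_iff, Set.mem_singleton_iff]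
    constructor
    · intro hh
      by_contra hne
      push Not at hne
      have := hc.2 h hne.2 hh
      rw [h0] at this
      exact hne.1 (Option.some.inj this).symm
    · rintro (rfl | rfl)
      · exact hr
      · exact hf
  · rw [Set.eq_empty_iff_forall_notMem]
    exact fun g hg => hc.1 g hg

lemma three_period (hdeg : ∀ v, ¬ Degenerate G v) {p : BPath G} {e f : E} (hef : e ≠ f)
    (h0 : p.edgeAt 0 = some e) (h1 : p.edgeAt 1 = some f) (h2 : p.edgeAt 2 = some e) :
    Three p := by
  obtain ⟨d, d1, d2, d3⟩ := exists_drop p 1 fun i hi => by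
    obtain rfl : i = 0 := by omega
    rw [h0]; simp
  have hd0 : d.edgeAt 0 = some f := by rw [d2 0, ← h1]
  have hd1 : d.edgeAt 1 = some e := by rw [d2 1, ← h2]
  have se : G.s e = p.src := p.isBSeq.src 0 e h0
  have re : G.r e = d.src := by rw [d1, BPath.vtx, seqVtx_some h0]
  have sf : G.s f = d.src := d.isBSeq.src 0 f hd0
  have rf : G.r f = p.src := by
    have := d.isBSeq.src 1 e hd1
    rw [seqVtx_some hd0] at this
    rw [← this, se]
  have hpd : p ≠ d := ne_of_edgeAt 0 (by rw [h0, hd0]; simpa using hef)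
  by_cases c1 : ∃ g, g ≠ f ∧ G.r g = p.src
  · obtain ⟨g, hg, hgr⟩ := c1
    obtain ⟨q, q1, q2, q3, q4⟩ := exists_cons p g hgr
    refine ⟨d, q, d3, q4, hpd, ne_of_edgeAt 1 ?_, ne_of_edgeAt 0 ?_⟩
    · rw [q3 0, h0, h1]; simpa using hef.symm
    · rw [q2, hd0]; simpa using hg.symm
  by_cases c2 : ∃ g, g ≠ e ∧ G.r g = d.src
  · obtain ⟨g, hg, hgr⟩ := c2
    obtain ⟨q, q1, q2, q3, q4⟩ := exists_cons d g hgr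
    refine ⟨d, q, d3, d3.trans q4, hpd, ne_of_edgeAt 0 ?_, ne_of_edgeAt 1 ?_⟩
    · rw [q2, h0]; simpa using hg.symm
    · rw [q3 0, hd0, hd1]; simpa using hef
  exfalso
  push Not at c1 c2
  apply hdeg p.src
  refine Or.inr (Or.inr (Or.inl ⟨d.src, ?_, ⟨f, ?_, sf⟩, ⟨e, ?_, se⟩⟩))
  · intro h
    exact c1 e hef (re.trans h)
  · ext g
    simp only [recvSet, Set.mem_ofPred_eq, Set.mem_singleton_iff]
    refine ⟨fun hg => ?_, fun hg => hg ▸ rf⟩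
    by_contra hne
    exact c1 g hne hg
  · ext g
    simp only [recvSet, Set.mem_ofPred_eq, Set.mem_singleton_iff]
    refine ⟨fun hg => ?_, fun hg => hg ▸ re⟩
    by_contra hne
    exact c2 g hne hg

lemma const_of_succ {p : BPath G} {e : E} (h0 : p.edgeAt 0 = some e)
    (h : ∀ n, p.edgeAt (n + 1) = p.edgeAt n) (n : ℕ) : p.edgeAt n = some e := by
  induction n with
  | zero => exact h0
  | succ n ih => rw [h, ih]

lemma three_all (hns : ∀ v, ∃ e, G.s e = v) (hdeg : ∀ v, ¬ Degenerate G v) (p : BPath G) :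
    Three p := by
  classical
  by_cases hinf : ∀ n, p.edgeAt n ≠ none
  · obtain ⟨d, d1, d2, d3⟩ := exists_drop p 1 fun i _ => hinf i
    obtain ⟨c, c1, c2, c3⟩ := exists_drop p 2 fun i _ => hinf i
    obtain ⟨e, he⟩ := Option.ne_none_iff_exists'.1 (hinf 0)
    obtain ⟨f, hf⟩ := Option.ne_none_iff_exists'.1 (hinf 1)
    by_cases e1 : p = d
    · refine three_const hdeg (const_of_succ he fun n => ?_)
      rw [add_comm, ← d2, ← e1]
    by_cases e2 : d = c
    · refine Three.of_rel d3 (three_const (e := f) hdeg (const_of_succ (by rw [d2 0, ← hf]) ?_))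
      intro n
      rw [d2, ← add_assoc, add_right_comm, ← c2, ← e2]
    by_cases e3 : p = c
    · have h2 : p.edgeAt 2 = some e := by
        rw [← he]
        conv_rhs => rw [e3]
        rw [c2]
      by_cases hef : e = f
      · exfalso
        apply e1
        subst hef
        have hcon : ∀ n, p.edgeAt n = some e ∧ p.edgeAt (n + 1) = some e := by
          intro n
          induction n with
          | zero => exact ⟨he, hf⟩
          | succ n ih =>
            refine ⟨ih.2, ?_⟩
            have := c2 n
            rw [← e3, ih.1] at this
            rw [this]
            congr 1
            omega
        apply BPath.ext'
        · rw [d1, BPath.vtx, seqVtx_some he]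
          have := p.isBSeq.src 2 e h2
          rw [seqVtx_some hf] at this
          rw [← this]
          exact (p.isBSeq.src 0 e he).symm
        · intro n
          rw [d2, (hcon n).1, add_comm, (hcon n).2]
      · exact three_period hdeg hef he hf h2
    · exact ⟨d, c, d3, c3, e1, e3, e2⟩
  · push Not at hinf
    obtain ⟨d, d1, d2, d3⟩ := exists_drop p (Nat.find hinf) fun i hi => Nat.find_min hinf hi
    exact Three.of_rel d3 (three_finite hns hdeg (by rw [d2]; exact Nat.find_spec hinf))

/-- Transposition of two related points inside prescribed neighbourhoods. -/
lemma exists_transp (hns : ∀ v, ∃ e, G.s e = v) {p q : BPath G} (h : BRel p q)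
    {U W : Set (BPath G)} (hU : IsOpen U) (hW : IsOpen W) (hp : p ∈ U) (hq : q ∈ W)
    (hd : U ∩ W = ∅) : ∃ α : BPath G ≃ₜ BPath G, InFullGroup G α ∧ α p ≠ p ∧
      closure {x | α x ≠ x} ⊆ U ∪ W := by
  obtain ⟨lam, μ, hr, h1, h2⟩ := h.exists_shift
  obtain ⟨l, m, F, hF, k1, k2, k3, k4, k5, k6, -, -⟩ := deepen hns hr h1 h2 hU hW hp hq
  have hd' : ZMinus l F ∩ ZMinus m F = ∅ := by
    rw [← Set.subset_empty_iff, ← hd]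
    exact Set.inter_subset_inter k4 k6
  obtain ⟨α, a1, a2, a3, a4⟩ := exists_cylSwap hns k1 hF k2 hd'
  refine ⟨α, a1, a3 p (Or.inl k3), ?_⟩
  refine (closure_minimal (fun x hx => ?_) ((isClosed_ZMinus l F).union
    (isClosed_ZMinus m F))).trans (Set.union_subset_union k4 k6)
  by_contra hc
  exact hx (a4 x hc)

lemma exists_base (hT : CondT G) (hdeg : ∀ v, ¬ Degenerate G v) (p : BPath G)
    {O : Set (BPath G)} (hO : IsOpen O) (hp : p ∈ O) :
    ∃ α β : BPath G ≃ₜ BPath G, InFullGroup G α ∧ InFullGroup G β ∧ α p ≠ p ∧ β p ≠ p ∧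
      closure {x | α x ≠ x} ∩ closure {x | β x ≠ x} ⊆ O := by
  have hns := hT.no_sink
  obtain ⟨a, b, h1, h2, h3, h4, h5⟩ := three_all hns hdeg p
  obtain ⟨U1, W1, u1, w1, pu1, aw1, d1⟩ := t2_separation h3
  obtain ⟨U2, W2, u2, w2, pu2, bw2, d2⟩ := t2_separation h4
  obtain ⟨A, B, oA, oB, aA, bB, d3⟩ := t2_separation h5
  have dj1 : ∀ x, x ∈ U1 → x ∉ W1 := fun x hx hx' => Set.disjoint_left.1 d1 hx hx'
  have dj2 : ∀ x, x ∈ U2 → x ∉ W2 := fun x hx hx' => Set.disjoint_left.1 d2 hx hx'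
  have dj3 : ∀ x, x ∈ A → x ∉ B := fun x hx hx' => Set.disjoint_left.1 d3 hx hx'
  have hU : IsOpen (O ∩ (U1 ∩ U2)) := hO.inter (u1.inter u2)
  obtain ⟨α, a1, a2, a3⟩ := exists_transp hns h1 hU (w1.inter oA) ⟨hp, pu1, pu2⟩ ⟨aw1, aA⟩ (by
    rw [Set.eq_empty_iff_forall_notMem]
    rintro x ⟨hx, hx'⟩
    exact dj1 x hx.2.1 hx'.1)
  obtain ⟨β, b1, b2, b3⟩ := exists_transp hns h2 hU (w2.inter oB) ⟨hp, pu1, pu2⟩ ⟨bw2, bB⟩ (by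
    rw [Set.eq_empty_iff_forall_notMem]
    rintro x ⟨hx, hx'⟩
    exact dj2 x hx.2.2 hx'.1)
  refine ⟨α, β, a1, b1, a2, b2, ?_⟩
  rintro x ⟨hx1, hx2⟩
  rcases a3 hx1 with h | h
  · exact h.1
  · rcases b3 hx2 with h' | h'
    · exact h'.1
    · exact absurd h'.2 (dj3 x h.2)

/-! ### The full group acts well -/

/-- Tautological action of a subgroup of homeomorphisms. -/
abbrev tautAction {X : Type*} [TopologicalSpace X] (Γ : Subgroup (X ≃ₜ X)) : MulAction Γ X where
  smul γ x := γ.1 x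
  one_smul _ := rfl
  mul_smul _ _ _ := rfl

theorem fullGroup_good (hL : CondL G) (hT : CondT G) (hdeg : ∀ v, ¬ Degenerate G v)
    (Γ : Subgroup (BPath G ≃ₜ BPath G)) (hΓ : ∀ α : BPath G ≃ₜ BPath G, α ∈ Γ ↔ InFullGroup G α) :
    @GoodAction Γ (BPath G) _ _ (tautAction Γ) := by
  letI := tautAction Γ
  have hmv : ∀ γ : Γ, mvSet (BPath G) γ = {x | γ.1 x ≠ x} := fun γ => rfl
  refine ⟨inferInstance, fun γ => γ.1.continuous, fun γ h => ?_, fun γ => ?_, fun γ => ?_,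
    fun U hU hne => ?_, fun x U hU hx => ?_⟩
  · exact Subtype.ext (Homeomorph.ext h)
  · rw [spSet, hmv]
    exact (((hΓ _).1 γ.2).closure_moved hL hT).1
  · rw [spSet, hmv]
    exact (((hΓ _).1 γ.2).closure_moved hL hT).2
  · obtain ⟨α, h1, h2, ⟨p, hp⟩, h3⟩ := exists_many hL hT hU hne
    refine ⟨⟨α, (hΓ α).2 h1⟩, ?_, ?_, fun x hx => h3 x hx⟩
    · intro h
      have h' : α = (1 : BPath G ≃ₜ BPath G) := congrArg Subtype.val h
      apply hp
      rw [h']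
      rfl
    · exact Subtype.ext (Homeomorph.ext h2)
  · obtain ⟨α, β, h1, h2, h3, h4, h5⟩ := exists_base hT hdeg x hU hx
    exact ⟨⟨α, (hΓ α).2 h1⟩, ⟨β, (hΓ β).2 h2⟩, ⟨subset_closure h3, subset_closure h4⟩, h5⟩

end BoundaryPaths

/-- Let `E` and `F` be countable graphs satisfying Conditions (L) and (T)
with no degenerate vertices. Then every abstract group isomorphism between the topological
full groups `G_E` and `G_F` is spatially implemented by a homeomorphism `∂E → ∂F`.
(Here `Γ` and `Λ` are the topological full groups, realized as subgroups of the
homeomorphism groups whose carriers consist exactly of the full-group elements.) -/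
theorem statement3 {V₁ E₁ V₂ E₂ : Type*}
    [Countable V₁] [Countable E₁] [Countable V₂] [Countable E₂]
    (G : DGraph V₁ E₁) (H : DGraph V₂ E₂)
    (hL₁ : CondL G) (hT₁ : CondT G) (hL₂ : CondL H) (hT₂ : CondT H)
    (hdeg₁ : ∀ v : V₁, ¬ Degenerate G v) (hdeg₂ : ∀ v : V₂, ¬ Degenerate H v)
    (Γ : Subgroup (BPath G ≃ₜ BPath G)) (Λ : Subgroup (BPath H ≃ₜ BPath H))
    (hΓ : ∀ α : BPath G ≃ₜ BPath G, α ∈ Γ ↔ InFullGroup G α)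
    (hΛ : ∀ α : BPath H ≃ₜ BPath H, α ∈ Λ ↔ InFullGroup H α)
    (Φ : Γ ≃* Λ) :
    ∃ φ : BPath G ≃ₜ BPath H, ∀ γ : Γ,
      ⇑((Φ γ : Λ) : BPath H ≃ₜ BPath H) =
        ⇑φ ∘ ⇑((γ : Γ) : BPath G ≃ₜ BPath G) ∘ ⇑φ.symm := by
  letI := tautAction Γ
  letI := tautAction Λ
  obtain ⟨φ, hφ⟩ := GoodAction.reconstruct (fullGroup_good hL₁ hT₁ hdeg₁ Γ hΓ)
    (fullGroup_good hL₂ hT₂ hdeg₂ Λ hΛ) Φ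
  refine ⟨φ, fun γ => funext fun y => ?_⟩
  have h := hφ γ (φ.symm y)
  rw [φ.apply_symm_apply] at h
  exact h.symm
end

section
/- Let E be a directed graph with no sinks and let Γ be any subgroup of G_E containing the commutator subgroup of G_E. Then the pair (Γ, ∂E) satisfies conditions (F1), (F2) and (F3) if and only if E satisfies Conditions (K), (W) and (∞). -/
variable {V E : Type*}

/-- The support of a homeomorphism: the closure of the set of moved points. -/
def Supp {X : Type*} [TopologicalSpace X] (γ : X ≃ₜ X) : Set X :=
  closure {x | γ x ≠ x}

/-- Condition (F1). -/
def CondF1 {X : Type*} [TopologicalSpace X] (Γ : Subgroup (X ≃ₜ X)) : Prop :=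
  ∀ (x : X) (A : Set X), IsClopen A → x ∈ A →
    ∃ α : X ≃ₜ X, α ∈ Γ ∧ α ≠ 1 ∧ α * α = 1 ∧ x ∈ Supp α ∧ Supp α ⊆ A

/-- Condition (F2). -/
def CondF2 {X : Type*} [TopologicalSpace X] (Γ : Subgroup (X ≃ₜ X)) : Prop :=
  ∀ α : X ≃ₜ X, α ∈ Γ → α ≠ 1 → α * α = 1 →
    ∀ A : Set X, IsClopen A → A.Nonempty → A ⊆ Supp α →
      ∃ β : X ≃ₜ X, β ∈ Γ ∧ β ≠ 1 ∧ Supp β ⊆ A ∪ (⇑α '' A) ∧ ∀ x ∈ Supp β, β x = α x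

/-- Condition (F3). -/
def CondF3 {X : Type*} [TopologicalSpace X] (Γ : Subgroup (X ≃ₜ X)) : Prop :=
  ∀ A : Set X, IsClopen A → A.Nonempty →
    ∃ α : X ≃ₜ X, α ∈ Γ ∧ Supp α ⊆ A ∧ α * α ≠ 1

open scoped commutatorElement

namespace S4
open Topology

variable {G : DGraph V E}

/-! ### Finite paths -/

theorem fp_ext {μ ν : FinPath G} (h1 : μ.src = ν.src) (h2 : μ.edges = ν.edges) : μ = ν := by
  cases μ; cases ν; simp only at h1 h2; subst h1; subst h2; rfl

theorem rng_nil {μ : FinPath G} (h : μ.edges = []) : μ.rng = μ.src := by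
  simp [FinPath.rng, h]

theorem rng_last {μ : FinPath G} {n : ℕ} {e : E} (h : μ.edges.length = n + 1)
    (he : μ.edges[n]? = some e) : μ.rng = G.r e := by
  rw [FinPath.rng, List.getLast?_eq_getElem?, h, Nat.add_sub_cancel, he]; rfl

theorem fp_zero {μ : FinPath G} {e : E} (h : μ.edges[0]? = some e) : G.s e = μ.src :=
  μ.src_eq e (by simpa [List.head?_eq_getElem?] using h)

theorem fp_succ {μ : FinPath G} {n : ℕ} {e e' : E} (h : μ.edges[n]? = some e)
    (h' : μ.edges[n + 1]? = some e') : G.r e = G.s e' := by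
  have hc := μ.chain
  rw [List.getElem?_eq_some_iff] at h h'
  obtain ⟨a, rfl⟩ := h
  obtain ⟨b, rfl⟩ := h'
  exact List.isChain_iff_getElem.mp hc n (by omega)

/-- Concatenation of finite paths. -/
def cat (μ ν : FinPath G) (h : μ.rng = ν.src) : FinPath G where
  src := μ.src
  edges := μ.edges ++ ν.edges
  src_eq := by
    intro e he
    rcases hm : μ.edges with _ | ⟨a, l⟩
    · rw [hm] at he
      rw [ν.src_eq e (by simpa using he), ← h, rng_nil hm]
    · exact μ.src_eq e (by rw [hm] at he ⊢; simpa using he)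
  chain := by
    refine List.isChain_append.mpr ⟨μ.chain, ν.chain, ?_⟩
    intro x hx y hy
    rw [ν.src_eq y hy, ← h]
    have hx' : μ.edges.getLast? = some x := hx
    simp [FinPath.rng, hx']

theorem cat_rng (μ ν : FinPath G) (h : μ.rng = ν.src) : (cat μ ν h).rng = ν.rng := by
  rcases hm : ν.edges.getLast? with _ | e
  · have h0 : ν.edges = [] := by simpa using hm
    rw [rng_nil h0, ← h]
    simp [FinPath.rng, cat, h0]
  · simp [FinPath.rng, cat, hm]

theorem fp_split (ν : FinPath G) (k : ℕ) (hk : k ≤ ν.edges.length) :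
    ∃ a b : FinPath G, a.src = ν.src ∧ a.edges = ν.edges.take k ∧ b.edges = ν.edges.drop k ∧
      a.rng = b.src ∧ b.rng = ν.rng := by
  let a : FinPath G := ⟨ν.src, ν.edges.take k, by
    intro e he
    apply ν.src_eq e
    rcases k with _ | k
    · simp at he
    · rcases hm : ν.edges with _ | ⟨c, l⟩
      · rw [hm] at he; simp at he
      · rw [hm] at he; simpa using he, ν.chain.take k⟩
  let b : FinPath G := ⟨a.rng, ν.edges.drop k, by
    intro e he
    have he' : ν.edges[k]? = some e := by simpa [List.head?_eq_getElem?] using he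
    rcases k with _ | k
    · rw [rng_nil (by simp [a])]
      exact fp_zero (μ := ν) he'
    · have hl : k < ν.edges.length := hk
      have hg : a.edges[k]? = some ν.edges[k] := by
        simp [a, hl]
      rw [rng_last (by simp [a]; omega) hg]
      exact (fp_succ (by simp [hl]) he').symm, ν.chain.drop k⟩
  have hab : a.rng = b.src := rfl
  refine ⟨a, b, rfl, rfl, rfl, hab, ?_⟩
  rw [← cat_rng a b hab]
  congr 1
  exact fp_ext rfl (by simp [cat, a, b])

/-- Finite segment of an infinite path. -/
def seg (x : InfPath G) (N m : ℕ) : FinPath G where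
  src := G.s (x.edges N)
  edges := (List.range (m - N)).map fun i => x.edges (N + i)
  src_eq := by
    intro e he
    rw [List.head?_eq_getElem?] at he
    have he : _ = some e := he
    obtain ⟨h0, he⟩ := List.getElem?_eq_some_iff.mp he
    rw [← he]; simp
  chain := by
    refine List.isChain_iff_getElem.mpr ?_
    intro i hi
    simpa [add_assoc] using x.chain (N + i)

theorem seg_len (x : InfPath G) (N m : ℕ) : (seg x N m).edges.length = m - N := by simp [seg]

theorem seg_get (x : InfPath G) {N m i : ℕ} (h : N + i < m) :
    (seg x N m).edges[i]? = some (x.edges (N + i)) := by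
  simp [seg, show i < m - N by omega]

theorem seg_rng (x : InfPath G) {N m : ℕ} (h : N ≤ m) : (seg x N m).rng = G.s (x.edges m) := by
  obtain ⟨k, rfl⟩ := Nat.exists_eq_add_of_le h
  rcases k with _ | k
  · rw [rng_nil (by simp [seg])]; rfl
  · rw [rng_last (n := k) (by rw [seg_len]; omega) (seg_get x (by omega)), x.chain]; rfl

/-! ### Boundary paths -/

theorem bp_zero {p : BPath G} {e : E} (h : p.edgeAt 0 = some e) : G.s e = p.src := by
  rcases p with p | x
  · exact fp_zero h
  · simp only [BPath.edgeAt, Option.some.injEq] at h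
    rw [← h]; rfl

theorem bp_succ {p : BPath G} {n : ℕ} {e' : E} (h' : p.edgeAt (n + 1) = some e') :
    ∃ e, p.edgeAt n = some e ∧ G.r e = G.s e' := by
  rcases p with p | x
  · have h' : p.1.edges[n + 1]? = some e' := h'
    have hl := (List.getElem?_eq_some_iff.mp h').1
    exact ⟨p.1.edges[n], by simp [BPath.edgeAt], fp_succ (by simp) h'⟩
  · simp only [BPath.edgeAt, Option.some.injEq] at h' ⊢
    exact ⟨_, rfl, by rw [x.chain, h']⟩

theorem bp_some_of_le {p : BPath G} {m n : ℕ} (h : m ≤ n) (hn : p.edgeAt n ≠ none) :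
    p.edgeAt m ≠ none := by
  induction n, h using Nat.le_induction with
  | base => exact hn
  | succ n _ ih =>
    apply ih
    obtain ⟨e, he⟩ := Option.ne_none_iff_exists'.mp hn
    obtain ⟨e', he', _⟩ := bp_succ he
    simp [he']

theorem bp_ext {p q : BPath G} (h1 : p.src = q.src) (h2 : ∀ n, p.edgeAt n = q.edgeAt n) :
    p = q := by
  rcases p with p | x <;> rcases q with q | y
  · congr 1
    apply Subtype.ext
    exact fp_ext h1 (List.ext_getElem? h2)
  · have := h2 p.1.edges.length
    simp [BPath.edgeAt] at this
  · have := h2 q.1.edges.length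
    simp [BPath.edgeAt] at this
  · congr 1
    cases x; cases y
    congr 1
    funext n
    simpa [BPath.edgeAt] using h2 n

/-- The next edge after a prefix starts at the end of the prefix. -/
theorem pre_next {μ : FinPath G} {p : BPath G} (h : IsPrefixOf μ p) {e : E}
    (he : p.edgeAt μ.edges.length = some e) : G.s e = μ.rng := by
  rcases hl : μ.edges.length with _ | n
  · rw [hl] at he
    rw [rng_nil (List.length_eq_zero_iff.mp hl), h.1]
    exact bp_zero he
  · rw [hl] at he
    obtain ⟨e', he', hr⟩ := bp_succ he
    have := h.2 n (by omega)
    rw [rng_last hl (this ▸ he'), hr]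

theorem pre_eq {μ ν : FinPath G} {p : BPath G} (h : IsPrefixOf μ p) (h' : IsPrefixOf ν p)
    (hl : μ.edges.length = ν.edges.length) : μ = ν := by
  refine fp_ext (h.1.trans h'.1.symm) (List.ext_getElem? fun i => ?_)
  by_cases hi : i < μ.edges.length
  · rw [← h.2 i hi, ← h'.2 i (hl ▸ hi)]
  · rw [List.getElem?_eq_none (by omega), List.getElem?_eq_none (by omega)]

theorem exists_shift {P Q : FinPath G} (hr : P.rng = Q.rng) {p : BPath G} (hp : IsPrefixOf P p) :
    ∃ q, IsShiftedBy P Q p q := by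
  rcases p with ⟨μ, hμ⟩ | x
  · have hle : P.edges.length ≤ μ.edges.length := by
      by_contra hc
      have := hp.2 μ.edges.length (by omega)
      simp only [BPath.edgeAt] at this
      rw [List.getElem?_eq_none le_rfl, List.getElem?_eq_getElem (by omega)] at this
      cases this
    obtain ⟨a, b, h1, h2, h3, h4, h5⟩ := fp_split μ _ hle
    have ha : a = P := by
      refine fp_ext (h1.trans hp.1.symm) (List.ext_getElem? fun i => ?_)
      rw [h2, List.getElem?_take]
      split_ifs with hi
      · exact hp.2 i hi
      · rw [List.getElem?_eq_none (by omega)]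
    subst ha
    have hc : Q.rng = b.src := hr.symm.trans h4
    refine ⟨Sum.inl ⟨cat Q b hc, by rw [cat_rng, h5]; exact hμ⟩, ⟨rfl, ?_⟩, ?_⟩
    · intro i hi
      simp [BPath.edgeAt, cat, List.getElem?_append_left hi]
    · intro n
      simp only [BPath.edgeAt, cat]
      rw [List.getElem?_append_right (by omega), h3, List.getElem?_drop]
      congr 1; omega
  · have hnext := pre_next hp (e := x.edges P.edges.length) rfl
    let y : InfPath G := ⟨fun n => (Q.edges[n]?).getD (x.edges (n - Q.edges.length + P.edges.length)), by
      intro n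
      rcases lt_trichotomy (n + 1) Q.edges.length with h | h | h
      · have h0 : n < Q.edges.length := by omega
        simp only [List.getElem?_eq_getElem h0, List.getElem?_eq_getElem h, Option.getD_some]
        exact fp_succ (List.getElem?_eq_getElem h0) (List.getElem?_eq_getElem h)
      · have h0 : n < Q.edges.length := by omega
        rw [List.getElem?_eq_getElem h0, List.getElem?_eq_none (by omega)]
        simp only [Option.getD_some, Option.getD_none]
        rw [show n + 1 - Q.edges.length + P.edges.length = P.edges.length by omega, hnext, hr]
        exact (rng_last h.symm (List.getElem?_eq_getElem h0)).symm
      · rw [List.getElem?_eq_none (by omega), List.getElem?_eq_none (by omega)]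
        simp only [Option.getD_none]
        rw [x.chain]
        congr 2; omega⟩
    refine ⟨Sum.inr y, ⟨?_, ?_⟩, ?_⟩
    · change Q.src = G.s (y.edges 0)
      by_cases h : 0 < Q.edges.length
      · simp only [y, List.getElem?_eq_getElem h, Option.getD_some]
        exact (fp_zero (List.getElem?_eq_getElem h)).symm
      · simp only [y, List.getElem?_eq_none (not_lt.mp h), Option.getD_none]
        rw [show 0 - Q.edges.length + P.edges.length = P.edges.length by omega, hnext, hr]
        exact (rng_nil (List.length_eq_zero_iff.mp (by omega))).symm
    · intro i hi
      simp [BPath.edgeAt, y, hi]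
    · intro n
      simp only [BPath.edgeAt, y]
      rw [List.getElem?_eq_none (by omega)]
      simp only [Option.getD_none]
      congr 2; omega

theorem shift_unique {P Q : FinPath G} {p q q' : BPath G} (h : IsShiftedBy P Q p q)
    (h' : IsShiftedBy P Q p q') : q = q' := by
  refine bp_ext (h.1.1.symm.trans h'.1.1) fun n => ?_
  by_cases hn : n < Q.edges.length
  · rw [h.1.2 n hn, h'.1.2 n hn]
  · have a := h.2 (n - Q.edges.length)
    have b := h'.2 (n - Q.edges.length)
    rw [show Q.edges.length + (n - Q.edges.length) = n by omega] at a b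
    rw [← a, ← b]

theorem shift_trans {P Q R : FinPath G} {p q r : BPath G} (h : IsShiftedBy P Q p q)
    (h' : IsShiftedBy Q R q r) : IsShiftedBy P R p r :=
  ⟨h'.1, fun n => (h.2 n).trans (h'.2 n)⟩

theorem shift_refl {P : FinPath G} {p : BPath G} (h : IsPrefixOf P p) : IsShiftedBy P P p p :=
  ⟨h, fun _ => rfl⟩

theorem shift_mem {P Q : FinPath G} {F : Set E} {p q : BPath G} (hp : p ∈ ZMinus P F)
    (h : IsShiftedBy P Q p q) : q ∈ ZMinus Q F :=
  ⟨h.1, fun e he => by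
    have := h.2 0
    simp only [add_zero] at this
    rw [← this]; exact hp.2 e he⟩

/-! ### Topology -/

/-- `n` is the length of the finite boundary path `p`. -/
def IsEnd (p : BPath G) (n : ℕ) : Prop := p.edgeAt n = none ∧ ∀ m < n, p.edgeAt m ≠ none

/-- Basic neighbourhoods. -/
def BN (p : BPath G) (N : ℕ) (F : Set E) : Set (BPath G) :=
  {q | q.src = p.src ∧ (∀ n < N, ∀ e, p.edgeAt n = some e → q.edgeAt n = some e) ∧
    ∀ n, IsEnd p n → ∀ e ∈ F, q.edgeAt n ≠ some e}

theorem zminus_open {μ : FinPath G} {F : Set E} (hF : F.Finite) (h : ∀ e ∈ F, G.s e = μ.rng) :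
    IsOpen (ZMinus μ F) :=
  TopologicalSpace.isOpen_generateFrom_of_mem ⟨μ, F, hF, h, rfl⟩

theorem zminus_empty (μ : FinPath G) : ZMinus μ ∅ = ZSet μ := by
  ext p; simp [ZMinus, ZSet]

theorem isEnd_inl {μ : FinPath G} {hμ} {n : ℕ}
    (h : IsEnd (Sum.inl ⟨μ, hμ⟩ : BPath G) n) : n = μ.edges.length := by
  obtain ⟨h1, h2⟩ := h
  simp only [BPath.edgeAt, List.getElem?_eq_none_iff] at h1
  by_contra hc
  have := h2 μ.edges.length (by omega)
  simp [BPath.edgeAt] at this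

theorem bn_nhds (p : BPath G) (N : ℕ) {F : Set E} (hF : F.Finite) : BN p N F ∈ 𝓝 p := by
  rcases p with ⟨μ, hμ⟩ | x
  · refine Filter.mem_of_superset (IsOpen.mem_nhds (zminus_open (μ := μ)
      (hF.inter_of_left {e | G.s e = μ.rng}) fun e he => he.2) ?_) ?_
    · refine ⟨⟨rfl, fun i _ => rfl⟩, fun e _ => ?_⟩
      simp [BPath.edgeAt]
    · rintro q ⟨hq, hq2⟩
      refine ⟨hq.1.symm, fun n _ e he => ?_, fun n hn e he heq => ?_⟩
      · rw [hq.2 n (List.getElem?_eq_some_iff.mp he).1]; exact he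
      · obtain rfl := isEnd_inl hn
        exact hq2 e ⟨he, pre_next hq heq⟩ heq
  · refine Filter.mem_of_superset (IsOpen.mem_nhds (zminus_open (μ := seg x 0 N)
      Set.finite_empty (by simp)) ?_) ?_
    · refine ⟨⟨rfl, fun i hi => ?_⟩, by simp⟩
      rw [seg_len] at hi
      rw [seg_get x (by omega)]; simp [BPath.edgeAt]
    · rintro q ⟨hq, -⟩
      refine ⟨hq.1.symm, fun n hn e he => ?_, fun n hn => ?_⟩
      · rw [hq.2 n (by rw [seg_len]; omega), seg_get x (by omega), ← he]; simp [BPath.edgeAt]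
      · simp [IsEnd, BPath.edgeAt] at hn

theorem bn_mono {p : BPath G} {N N' : ℕ} {F F' : Set E} (h : N ≤ N') (h' : F ⊆ F') :
    BN p N' F' ⊆ BN p N F := fun _ hq =>
  ⟨hq.1, fun n hn => hq.2.1 n (by omega), fun n hn e he => hq.2.2 n hn e (h' he)⟩

theorem exists_bn {U : Set (BPath G)} (hU : IsOpen U) :
    ∀ p ∈ U, ∃ (N : ℕ) (F : Set E), F.Finite ∧ BN p N F ⊆ U := by
  induction hU with
  | basic S hS =>
    obtain ⟨μ, F, hF, hF2, rfl⟩ := hS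
    rintro p ⟨hp, hp2⟩
    refine ⟨μ.edges.length + 1, F, hF, fun q hq => ⟨⟨hp.1.trans hq.1.symm, fun i hi => ?_⟩, ?_⟩⟩
    · have := hp.2 i hi
      rw [List.getElem?_eq_getElem hi] at this ⊢
      exact hq.2.1 i (by omega) _ this
    · intro e he
      rcases hx : p.edgeAt μ.edges.length with _ | e'
      · refine hq.2.2 _ ⟨hx, fun m hm => ?_⟩ e he
        rw [hp.2 m hm, List.getElem?_eq_getElem hm]; simp
      · rw [hq.2.1 _ (by omega) e' hx, ← hx]
        exact hp2 e he
  | univ => exact fun p _ => ⟨0, ∅, Set.finite_empty, fun _ _ => trivial⟩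
  | inter S T _ _ hS hT =>
    rintro p ⟨h1, h2⟩
    obtain ⟨N, F, hF, h⟩ := hS p h1
    obtain ⟨N', F', hF', h'⟩ := hT p h2
    exact ⟨N + N', F ∪ F', hF.union hF', fun q hq =>
      ⟨h (bn_mono (by omega) (by simp) hq), h' (bn_mono (by omega) (by simp) hq)⟩⟩
  | sUnion S _ ih =>
    rintro p ⟨T, hT, hp⟩
    obtain ⟨N, F, hF, h⟩ := ih T hT p hp
    exact ⟨N, F, hF, fun q hq => ⟨T, hT, h hq⟩⟩

theorem zminus_closed (μ : FinPath G) {F : Set E} (hF : F.Finite) : IsClosed (ZMinus μ F) := by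
  rw [← isOpen_compl_iff, isOpen_iff_mem_nhds]
  intro p hp
  refine Filter.mem_of_superset (bn_nhds p (μ.edges.length + 1)
    (hF.union (List.finite_toSet μ.edges))) ?_
  rintro q ⟨hq1, hq2, hq3⟩ ⟨hm, hm2⟩
  have key : ∀ i, i < μ.edges.length → p.edgeAt i = μ.edges[i]? := by
    intro i
    induction i using Nat.strong_induction_on with
    | _ i ih =>
      intro hi
      rcases hx : p.edgeAt i with _ | e
      · exfalso
        refine hq3 i ⟨hx, fun m hmi => ?_⟩ (μ.edges[i]) (Or.inr (by simp)) ?_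
        · rw [ih m hmi (by omega), List.getElem?_eq_getElem (by omega)]; simp
        · rw [hm.2 i hi, List.getElem?_eq_getElem hi]
      · rw [← hm.2 i hi, hq2 i (by omega) e hx]
  apply hp
  refine ⟨⟨hm.1.trans hq1, key⟩, fun e he hpe => hm2 e he (hq2 _ (by omega) e hpe)⟩

theorem zminus_clopen {μ : FinPath G} {F : Set E} (hF : F.Finite) (h : ∀ e ∈ F, G.s e = μ.rng) :
    IsClopen (ZMinus μ F) := ⟨zminus_closed μ hF, zminus_open hF h⟩

theorem zset_clopen (μ : FinPath G) : IsClopen (ZSet μ) := by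
  rw [← zminus_empty]; exact zminus_clopen Set.finite_empty (by simp)

/-- Initial segments of boundary paths. -/
theorem exists_pre (p : BPath G) (n : ℕ) (h : ∀ m < n, p.edgeAt m ≠ none) :
    ∃ μ : FinPath G, μ.edges.length = n ∧ IsPrefixOf μ p := by
  rcases p with ⟨μ, hμ⟩ | x
  · have hn : n ≤ μ.edges.length := by
      by_contra hc
      have := h μ.edges.length (by omega)
      simp [BPath.edgeAt] at this
    obtain ⟨a, b, h1, h2, -⟩ := fp_split μ n hn
    refine ⟨a, by simp [h2, hn], h1, fun i hi => ?_⟩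
    rw [h2] at hi ⊢
    simp at hi
    rw [List.getElem?_take, if_pos hi.1]; rfl
  · refine ⟨seg x 0 n, by simp [seg_len], rfl, fun i hi => ?_⟩
    rw [seg_len] at hi
    rw [seg_get x (by omega)]; simp [BPath.edgeAt]

/-- Clopen separation. -/
theorem exists_sep {p q : BPath G} (h : p ≠ q) : ∃ U : Set (BPath G), IsClopen U ∧ p ∈ U ∧ q ∉ U := by
  suffices hs : ∃ μ : FinPath G, ¬ (p ∈ ZSet μ ↔ q ∈ ZSet μ) by
    obtain ⟨μ, hμ⟩ := hs
    by_cases hp : p ∈ ZSet μ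
    · exact ⟨_, zset_clopen μ, hp, fun hq => hμ (by simp [hp, hq])⟩
    · exact ⟨_, (zset_clopen μ).compl, hp, fun hq => hμ (by
        simp only [Set.mem_compl_iff] at hq; simp [hp, hq])⟩
  by_contra hc
  push Not at hc
  have hsrc : p.src = q.src := by
    have := (hc (trivialPath G p.src)).mp ⟨rfl, by simp [trivialPath]⟩
    exact this.1
  apply h
  refine bp_ext hsrc fun n => ?_
  have aux : ∀ p q : BPath G, (∀ μ : FinPath G, p ∈ ZSet μ → q ∈ ZSet μ) → ∀ e,
      p.edgeAt n = some e → q.edgeAt n = some e := by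
    intro p q hpq e he
    obtain ⟨μ, hl, hμ⟩ := exists_pre p (n + 1) (fun m hm => bp_some_of_le (Nat.lt_succ_iff.mp hm)
      (by simp [he]))
    have := hpq μ hμ
    rw [this.2 n (by omega), ← hμ.2 n (by omega), he]
  rcases hx : p.edgeAt n with _ | e
  · rcases hy : q.edgeAt n with _ | e'
    · rfl
    · rw [aux q p (fun μ => (hc μ).mpr) e' hy] at hx; cases hx
  · exact (aux p q (fun μ => (hc μ).mp) e hx).symm

/-! ### Permuting disjoint cylinder sets -/

/-- A finite family of paths with common range and disjoint (punctured) cylinder sets. -/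
structure Fam (G : DGraph V E) (k : ℕ) where
  P : Fin k → FinPath G
  F : Set E
  rng : ∀ i j, (P i).rng = (P j).rng
  fin : F.Finite
  prop : ∀ i, F ⊂ {e : E | G.s e = (P i).rng}
  disj : ∀ i j, i ≠ j → ZMinus (P i) F ∩ ZMinus (P j) F = ∅

namespace Fam

variable {k : ℕ} (Φ : Fam G k)

/-- The `i`-th cylinder set. -/
def Z (i : Fin k) : Set (BPath G) := ZMinus (Φ.P i) Φ.F

theorem Z_clopen (i : Fin k) : IsClopen (Φ.Z i) :=
  zminus_clopen Φ.fin fun _ he => (Φ.prop i).1 he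

theorem Z_inj {i j : Fin k} {p : BPath G} (hi : p ∈ Φ.Z i) (hj : p ∈ Φ.Z j) : i = j := by
  by_contra h
  have : p ∈ ZMinus (Φ.P i) Φ.F ∩ ZMinus (Φ.P j) Φ.F := ⟨hi, hj⟩
  rw [Φ.disj i j h] at this
  exact this

theorem exists_act (σ : Equiv.Perm (Fin k)) (p : BPath G) :
    ∃ q, (∀ i, p ∈ Φ.Z i → IsShiftedBy (Φ.P i) (Φ.P (σ i)) p q) ∧ ((∀ i, p ∉ Φ.Z i) → q = p) := by
  by_cases h : ∃ i, p ∈ Φ.Z i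
  · obtain ⟨i, hi⟩ := h
    obtain ⟨q, hq⟩ := exists_shift (Φ.rng i (σ i)) hi.1
    refine ⟨q, fun j hj => ?_, fun hn => (hn i hi).elim⟩
    obtain rfl := Φ.Z_inj hi hj
    exact hq
  · push Not at h
    exact ⟨p, fun i hi => (h i hi).elim, fun _ => rfl⟩

/-- The action of a permutation. -/
noncomputable def act (σ : Equiv.Perm (Fin k)) (p : BPath G) : BPath G :=
  (Φ.exists_act σ p).choose

theorem act_shift (σ : Equiv.Perm (Fin k)) {p : BPath G} {i : Fin k} (h : p ∈ Φ.Z i) :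
    IsShiftedBy (Φ.P i) (Φ.P (σ i)) p (Φ.act σ p) :=
  (Φ.exists_act σ p).choose_spec.1 i h

theorem act_mem (σ : Equiv.Perm (Fin k)) {p : BPath G} {i : Fin k} (h : p ∈ Φ.Z i) :
    Φ.act σ p ∈ Φ.Z (σ i) :=
  shift_mem h (Φ.act_shift σ h)

theorem act_off (σ : Equiv.Perm (Fin k)) {p : BPath G} (h : ∀ i, p ∉ Φ.Z i) :
    Φ.act σ p = p :=
  (Φ.exists_act σ p).choose_spec.2 h

theorem act_one (p : BPath G) : Φ.act 1 p = p := by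
  by_cases h : ∃ i, p ∈ Φ.Z i
  · obtain ⟨i, hi⟩ := h
    exact shift_unique (Φ.act_shift 1 hi) (shift_refl hi.1)
  · push Not at h
    exact Φ.act_off 1 h

theorem act_mul (σ τ : Equiv.Perm (Fin k)) (p : BPath G) :
    Φ.act (σ * τ) p = Φ.act σ (Φ.act τ p) := by
  by_cases h : ∃ i, p ∈ Φ.Z i
  · obtain ⟨i, hi⟩ := h
    exact shift_unique (Φ.act_shift (σ * τ) hi)
      (shift_trans (Φ.act_shift τ hi) (Φ.act_shift σ (Φ.act_mem τ hi)))
  · push Not at h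
    rw [Φ.act_off _ h, Φ.act_off τ h, Φ.act_off σ h]

theorem union_clopen : IsClopen (⋃ i, Φ.Z i) := isClopen_iUnion_of_finite Φ.Z_clopen

theorem act_cont (σ : Equiv.Perm (Fin k)) : Continuous (Φ.act σ) := by
  rw [continuous_iff_continuousAt]
  intro p
  by_cases h : ∃ i, p ∈ Φ.Z i
  · obtain ⟨i, hi⟩ := h
    intro U hU
    obtain ⟨W, hWU, hW, hpW⟩ := mem_nhds_iff.mp hU
    obtain ⟨N, F, hF, hB⟩ := exists_bn hW _ hpW
    rw [Filter.mem_map]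
    filter_upwards [(Φ.Z_clopen i).isOpen.mem_nhds hi,
      bn_nhds p (N + (Φ.P i).edges.length) hF] with y hy hyB
    apply hWU; apply hB
    have hp := Φ.act_shift σ hi
    have hq := Φ.act_shift σ hy
    generalize Φ.act σ p = a at hp
    generalize Φ.act σ y = b at hq
    refine ⟨hq.1.1.symm.trans hp.1.1, fun n hn e he => ?_, fun n hn e he => ?_⟩
    · by_cases hl : n < (Φ.P (σ i)).edges.length
      · rw [hq.1.2 n hl, ← hp.1.2 n hl, he]
      · obtain ⟨m, rfl⟩ := Nat.exists_eq_add_of_le (not_lt.mp hl)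
        rw [← hq.2 m]
        exact hyB.2.1 _ (by omega) e ((hp.2 m).trans he)
    · have hl : ¬ n < (Φ.P (σ i)).edges.length := by
        intro hl
        have := hp.1.2 n hl
        rw [hn.1, List.getElem?_eq_getElem hl] at this
        cases this
      obtain ⟨m, rfl⟩ := Nat.exists_eq_add_of_le (not_lt.mp hl)
      rw [← hq.2 m]
      refine hyB.2.2 _ ⟨(hp.2 m).trans hn.1, fun j hj => ?_⟩ e he
      by_cases hjl : j < (Φ.P i).edges.length
      · rw [hi.1.2 j hjl, List.getElem?_eq_getElem hjl]; simp
      · obtain ⟨j, rfl⟩ := Nat.exists_eq_add_of_le (not_lt.mp hjl)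
        rw [hp.2 j]
        exact hn.2 _ (by omega)
  · have hp : p ∈ (⋃ i, Φ.Z i)ᶜ := by simpa using h
    refine (continuousAt_id (x := p)).congr ?_
    filter_upwards [Φ.union_clopen.compl.isOpen.mem_nhds hp] with y hy
    exact (Φ.act_off σ (by simpa using hy)).symm

/-- The homeomorphism associated to a permutation. -/
noncomputable def homeo (σ : Equiv.Perm (Fin k)) : BPath G ≃ₜ BPath G where
  toFun := Φ.act σ
  invFun := Φ.act σ⁻¹
  left_inv p := by rw [← act_mul, inv_mul_cancel, act_one]
  right_inv p := by rw [← act_mul, mul_inv_cancel, act_one]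
  continuous_toFun := Φ.act_cont σ
  continuous_invFun := Φ.act_cont σ⁻¹

/-- The group homomorphism from permutations. -/
noncomputable def hom : Equiv.Perm (Fin k) →* (BPath G ≃ₜ BPath G) :=
  MonoidHom.mk' Φ.homeo fun σ τ => Homeomorph.ext fun p => Φ.act_mul σ τ p

theorem hom_apply (σ : Equiv.Perm (Fin k)) (p : BPath G) : Φ.hom σ p = Φ.act σ p := rfl

theorem hom_full (σ : Equiv.Perm (Fin k)) : InFullGroup G (Φ.hom σ) := by
  refine ⟨k, fun i => Φ.P (σ i), Φ.P, fun _ => Φ.F, fun i => Φ.rng _ _, fun _ => Φ.fin,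
    fun i => Φ.prop _, Φ.disj, fun i j h => Φ.disj _ _ (fun h' => h (σ.injective h')), ?_, ?_, ?_⟩
  · exact (Function.Surjective.iUnion_comp σ.surjective Φ.Z).symm
  · exact fun i p hp => Φ.act_shift σ hp
  · intro p hp
    exact Φ.act_off σ (by simpa [Z] using hp)

theorem supp_subset (σ : Equiv.Perm (Fin k)) : Supp (Φ.hom σ) ⊆ ⋃ i, Φ.Z i := by
  refine closure_minimal (fun p hp => ?_) Φ.union_clopen.isClosed
  by_contra h
  exact hp (Φ.act_off σ (by simpa using h))

theorem hom_ne {σ : Equiv.Perm (Fin k)} {i : Fin k} (h : σ i ≠ i) {p : BPath G} (hp : p ∈ Φ.Z i) :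
    Φ.hom σ p ≠ p := by
  intro he
  have := Φ.act_mem σ hp
  rw [← hom_apply, he] at this
  exact h (Φ.Z_inj this hp)

end Fam

/-- The double transposition. -/
def dbl : Equiv.Perm (Fin 4) := Equiv.swap 0 1 * Equiv.swap 2 3

theorem dbl_comm : dbl = ⁅Equiv.swap (0 : Fin 4) 2 * Equiv.swap 1 3, Equiv.swap (0 : Fin 4) 1⁆ := by
  decide

theorem dbl_sq : dbl * dbl = 1 := by decide

/-- A three-cycle. -/
def tri : Equiv.Perm (Fin 4) := ⁅Equiv.swap (0 : Fin 4) 1, Equiv.swap (0 : Fin 4) 2⁆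

theorem tri_sq : (tri * tri) 0 ≠ 0 := by decide

/-! ### Combinatorics -/

/-- The two paths differ at some position. -/
def Diff (μ ν : FinPath G) : Prop :=
  ∃ (i : ℕ) (e e' : E), μ.edges[i]? = some e ∧ ν.edges[i]? = some e' ∧ e ≠ e'

theorem Diff.symm {μ ν : FinPath G} (h : Diff μ ν) : Diff ν μ := by
  obtain ⟨i, e, e', h1, h2, h3⟩ := h
  exact ⟨i, e', e, h2, h1, h3.symm⟩

theorem Diff.cat_right {μ ν a b : FinPath G} (h : Diff μ ν) (ha : μ.rng = a.src)
    (hb : ν.rng = b.src) : Diff (cat μ a ha) (cat ν b hb) := by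
  obtain ⟨i, e, e', h1, h2, h3⟩ := h
  refine ⟨i, e, e', ?_, ?_, h3⟩
  · rw [cat, List.getElem?_append_left (List.getElem?_eq_some_iff.mp h1).1, h1]
  · rw [cat, List.getElem?_append_left (List.getElem?_eq_some_iff.mp h2).1, h2]

theorem Diff.cat_left {μ a b : FinPath G} (h : Diff a b) (ha : μ.rng = a.src)
    (hb : μ.rng = b.src) : Diff (cat μ a ha) (cat μ b hb) := by
  obtain ⟨i, e, e', h1, h2, h3⟩ := h
  refine ⟨μ.edges.length + i, e, e', ?_, ?_, h3⟩
  · rw [cat, List.getElem?_append_right (by omega), Nat.add_sub_cancel_left, h1]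
  · rw [cat, List.getElem?_append_right (by omega), Nat.add_sub_cancel_left, h2]

theorem Diff.disj {μ ν : FinPath G} (h : Diff μ ν) (F F' : Set E) :
    ZMinus μ F ∩ ZMinus ν F' = ∅ := by
  obtain ⟨i, e, e', h1, h2, h3⟩ := h
  rw [Set.eq_empty_iff_forall_notMem]
  rintro p ⟨hp, hq⟩
  apply h3
  have a := hp.1.2 i (List.getElem?_eq_some_iff.mp h1).1
  have b := hq.1.2 i (List.getElem?_eq_some_iff.mp h2).1
  rw [h1] at a; rw [h2, a] at b
  exact Option.some.inj b

theorem exists_return (μ : FinPath G) (h : μ.IsCycle) :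
    ∃ τ : FinPath G, τ.IsReturnPath ∧ τ.src = μ.src := by
  classical
  have hex : ∃ n, ∃ ν : FinPath G, ν.IsCycle ∧ ν.src = μ.src ∧ ν.edges.length = n :=
    ⟨_, μ, h, rfl, rfl⟩
  obtain ⟨τ, hτ, hs, hl⟩ := Nat.find_spec hex
  refine ⟨τ, ⟨hτ, fun i hi heq => ?_⟩, hs⟩
  obtain ⟨a, b, h1, h2, h3, h4, h5⟩ := fp_split τ (i + 1) (by omega)
  have hal : a.edges.length = i + 1 := by rw [h2, List.length_take]; omega
  refine Nat.find_min hex (m := i + 1) (by omega) ⟨a, ⟨?_, ?_⟩, h1.trans hs, hal⟩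
  · intro h0; rw [h0] at hal; simp at hal
  · rw [rng_last (e := τ.edges[i]) hal, h1, ← hτ.2, ← heq]; rfl
    rw [h2, List.getElem?_take, if_pos (by omega), List.getElem?_eq_getElem]

theorem return_pre {τ ρ : FinPath G} (hτ : τ.IsReturnPath) (hρ : ρ.IsReturnPath)
    (hs : τ.src = ρ.src) (h : τ.edges <+: ρ.edges) : τ = ρ := by
  by_cases hl : τ.edges.length < ρ.edges.length
  · exfalso
    have h0 : τ.edges ≠ [] := hτ.1.1
    obtain ⟨n, hn⟩ := Nat.exists_eq_succ_of_ne_zero (n := τ.edges.length) (by simpa using h0)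
    have hn' : τ.edges.length = n + 1 := hn
    refine hρ.2 n (by omega) ?_
    have hg : τ.edges[n]? = some (ρ.edges.get ⟨n, by omega⟩) := by
      rw [List.getElem?_eq_getElem (by omega)]
      congr 1
      exact h.getElem _
    rw [← rng_last hn' hg, hτ.1.2, hρ.1.2, hs]
  · exact fp_ext hs (h.eq_of_length (le_antisymm h.length_le (not_lt.mp hl)))

theorem keyA (hK : CondK G) (hW : CondW G) (x : InfPath G) (N : ℕ) :
    ∃ m, N ≤ m ∧ ∃ ν : FinPath G, ν.src = G.s (x.edges N) ∧ ν.rng = G.s (x.edges m) ∧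
      Diff ν (seg x N m) := by
  by_cases hc : ∃ n, N ≤ n ∧ ∃ μ : FinPath G, μ.IsCycle ∧ μ.src = G.s (x.edges n)
  · obtain ⟨n, hn, μ, hμ, hs⟩ := hc
    obtain ⟨τ₀, hτ₀, hs₀⟩ := exists_return μ hμ
    rcases hK (G.s (x.edges n)) with h | ⟨τ, ρ, hne, hτ, hρ, hsτ, hsρ⟩
    · exact (h ⟨τ₀, hτ₀, hs₀.trans hs⟩).elim
    have key : ∃ σ : FinPath G, σ.IsReturnPath ∧ σ.src = G.s (x.edges n) ∧
        ∃ i, ∃ h : i < σ.edges.length, σ.edges[i] ≠ x.edges (n + i) := by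
      by_contra hcon
      push Not at hcon
      have a := hcon τ hτ hsτ
      have b := hcon ρ hρ hsρ
      have pre : ∀ l l' : List E, (∀ i (h : i < l.length), l[i] = x.edges (n + i)) →
          (∀ i (h : i < l'.length), l'[i] = x.edges (n + i)) → l.length ≤ l'.length →
          l <+: l' := by
        intro l l' hl hl' hle
        rw [List.prefix_iff_eq_take]
        apply List.ext_getElem
        · simp [hle]
        · intro i h1 h2
          rw [List.getElem_take, hl i h1, hl']
      rcases le_total τ.edges.length ρ.edges.length with h | h
      · exact hne (return_pre hτ hρ (hsτ.trans hsρ.symm) (pre _ _ a b h))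
      · exact hne (return_pre hρ hτ (hsρ.trans hsτ.symm) (pre _ _ b a h)).symm
    obtain ⟨σ, hσ, hsσ, i, hi, hd⟩ := key
    have e2 : σ.rng = (seg x n (n + σ.edges.length)).src := by rw [hσ.1.2, hsσ]; rfl
    have e1 : (seg x N n).rng = (cat σ (seg x n (n + σ.edges.length)) e2).src :=
      (seg_rng x hn).trans hsσ.symm
    refine ⟨n + σ.edges.length, by omega,
      cat (seg x N n) (cat σ (seg x n (n + σ.edges.length)) e2) e1, rfl, ?_, ?_⟩
    · rw [cat_rng, cat_rng, seg_rng x (by omega)]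
    · refine ⟨(n - N) + i, σ.edges[i], x.edges (n + i), ?_, ?_, hd⟩
      · simp only [cat]
        rw [List.getElem?_append_right (by rw [seg_len]; omega), seg_len,
          List.getElem?_append_left (by omega), Nat.add_sub_cancel_left,
          List.getElem?_eq_getElem hi]
      · rw [seg_get x (by omega)]
        congr 2; omega
  · push Not at hc
    have nocyc : ∀ i j, N ≤ i → i < j → G.s (x.edges i) ≠ G.s (x.edges j) := by
      intro i j hi hij he
      refine hc i hi (seg x i j) ⟨?_, ?_⟩ rfl
      · intro h0
        have := seg_len x i j
        rw [h0] at this; simp at this; omega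
      · rw [seg_rng x hij.le, ← he]; rfl
    let y : InfPath G := ⟨fun n => x.edges (N + n), fun i => x.chain (N + i)⟩
    have hy : Wandering y := by
      intro v
      apply Set.Subsingleton.finite
      intro i hi j hj
      have hij : G.s (x.edges (N + i)) = G.s (x.edges (N + j)) := hi.trans hj.symm
      rcases lt_trichotomy i j with h | h | h
      · exact (nocyc _ _ (by omega) (by omega) hij).elim
      · exact h
      · exact (nocyc _ _ (by omega) (by omega) hij.symm).elim
    obtain ⟨n, μ, ν, hne, hμs, hνs, hμr, hνr⟩ := hW y hy
    have hyr : G.r (y.edges n) = G.s (x.edges (N + n + 1)) := x.chain (N + n)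
    rw [hyr] at hμr hνr
    have hys : y.src = G.s (x.edges N) := rfl
    rw [hys] at hμs hνs
    have key : ∃ σ : FinPath G, σ.src = G.s (x.edges N) ∧ σ.rng = G.s (x.edges (N + n + 1)) ∧
        σ ≠ seg x N (N + n + 1) := by
      by_cases h : μ = seg x N (N + n + 1)
      · exact ⟨ν, hνs, hνr, fun h' => hne (h.trans h'.symm)⟩
      · exact ⟨μ, hμs, hμr, h⟩
    obtain ⟨σ, hσs, hσr, hσne⟩ := key
    refine ⟨N + n + 1, by omega, σ, hσs, hσr, ?_⟩
    by_contra hd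
    have agree : ∀ i, i < σ.edges.length → i < n + 1 → σ.edges[i]? = some (x.edges (N + i)) := by
      intro i hi hi'
      by_contra hcon
      refine hd ⟨i, σ.edges[i], x.edges (N + i), List.getElem?_eq_getElem hi,
        seg_get x (by omega), fun he => hcon ?_⟩
      rw [List.getElem?_eq_getElem hi, he]
    by_cases hle : σ.edges.length ≤ n + 1
    · have hσ : σ = seg x N (N + σ.edges.length) := by
        refine fp_ext hσs (List.ext_getElem? fun i => ?_)
        by_cases hi : i < σ.edges.length
        · rw [agree i hi (by omega), seg_get x (by omega)]
        · rw [List.getElem?_eq_none (by omega), List.getElem?_eq_none (by rw [seg_len]; omega)]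
      rcases hle.lt_or_eq with hlt | heq
      · have : σ.rng = G.s (x.edges (N + σ.edges.length)) := by
          conv_lhs => rw [hσ]
          rw [seg_rng x (by omega)]
        exact nocyc _ _ (by omega) (by omega) (this.symm.trans hσr)
      · rw [heq] at hσ
        exact hσne hσ
    · obtain ⟨a, b, h1, h2, h3, h4, h5⟩ := fp_split σ (n + 1) (by omega)
      have ha : a = seg x N (N + n + 1) := by
        refine fp_ext (h1.trans hσs) (List.ext_getElem? fun i => ?_)
        rw [h2, List.getElem?_take]
        split_ifs with hi
        · rw [agree i (by omega) hi, seg_get x (by omega)]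
        · rw [List.getElem?_eq_none (by rw [seg_len]; omega)]
      have hb : b.src = G.s (x.edges (N + n + 1)) := by
        rw [← h4, ha, seg_rng x (by omega)]
      refine hc (N + n + 1) (by omega) b ⟨?_, ?_⟩ hb
      · intro h0
        have : b.edges.length = 0 := by rw [h0]; rfl
        rw [h3, List.length_drop] at this
        omega
      · rw [h5, hσr, hb]

theorem pair4 {R : Fin 4 → Fin 4 → Prop} (hsym : ∀ i j, R i j → R j i) (h01 : R 0 1) (h02 : R 0 2)
    (h03 : R 0 3) (h12 : R 1 2) (h13 : R 1 3) (h23 : R 2 3) : ∀ i j, i ≠ j → R i j := by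
  intro i j hij
  fin_cases i <;> fin_cases j <;> first | exact absurd rfl hij | assumption | (apply hsym; assumption)

theorem all4 {R : Fin 4 → Prop} (h0 : R 0) (h1 : R 1) (h2 : R 2) (h3 : R 3) : ∀ i, R i := by
  intro i
  fin_cases i <;> assumption

/-- Construction of four-element families. -/
theorem mkFam (P : Fin 4 → FinPath G) (F : Set E) (v : V) (hv : ∀ i, (P i).rng = v)
    (hF : F.Finite) (hp : F ⊂ {e : E | G.s e = v})
    (hd : ∀ i j, i ≠ j → ZMinus (P i) F ∩ ZMinus (P j) F = ∅) :
    ∃ Φ : Fam G 4, Φ.P = P ∧ Φ.F = F :=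
  ⟨⟨P, F, fun i j => (hv i).trans (hv j).symm, hF, fun i => by rw [hv i]; exact hp, hd⟩, rfl, rfl⟩

theorem four (hs : ∀ v : V, ¬ IsSink G v) (hK : CondK G) (hW : CondW G) (hI : CondInf G)
    (x : BPath G) (N : ℕ) {F₀ : Set E} (hF₀ : F₀.Finite) :
    ∃ Φ : Fam G 4, x ∈ Φ.Z 0 ∧ ∀ i, (Φ.P i).src = x.src ∧
      (∀ n < N, ∀ e, x.edgeAt n = some e → (Φ.P i).edges[n]? = some e) ∧ Φ.Z i ⊆ BN x N F₀ := by
  rcases x with ⟨μ, hμ⟩ | x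
  · have hinf : InfEmitter G μ.rng := hμ.resolve_left (hs _)
    have hS := (hI _ hinf).sdiff hF₀
    obtain ⟨c, hc⟩ : ∃ c : ℕ → E, Function.Injective c ∧
        ∀ n, (G.s (c n) = μ.rng ∧ Reaches G (G.r (c n)) μ.rng) ∧ c n ∉ F₀ :=
      ⟨fun n => (hS.natEmbedding _ n).1, fun a b h => (hS.natEmbedding _).injective (Subtype.ext h),
        fun n => (hS.natEmbedding _ n).2⟩
    obtain ⟨cinj, hc⟩ := hc
    have hτ : ∀ n, ∃ τ : FinPath G, τ.src = μ.src ∧ τ.rng = μ.rng ∧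
        (∀ i < μ.edges.length, τ.edges[i]? = μ.edges[i]?) ∧
        τ.edges[μ.edges.length]? = some (c n) := by
      intro n
      obtain ⟨⟨h1, σ, h2, h3⟩, h4⟩ := hc n
      let ε : FinPath G := ⟨μ.rng, [c n], by simp [h1], List.isChain_singleton _⟩
      have e1 : ε.rng = σ.src := by rw [h2]; rfl
      have e2 : μ.rng = (cat ε σ e1).src := rfl
      refine ⟨cat μ (cat ε σ e1) e2, rfl, by rw [cat_rng, cat_rng, h3], fun i hi => ?_, ?_⟩
      · simp only [cat]; rw [List.getElem?_append_left hi]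
      · simp [cat, ε]
    choose τ t1 t2 t3 t4 using hτ
    let F : Set E := (F₀ ∩ {e | G.s e = μ.rng}) ∪ {c 0, c 1, c 2}
    have hF : F.Finite := (hF₀.inter_of_left _).union (by simp)
    have hdiff : ∀ m n, m ≠ n → ZMinus (τ m) F ∩ ZMinus (τ n) F = ∅ := fun m n hmn =>
      Diff.disj ⟨μ.edges.length, c m, c n, t4 m, t4 n, fun h => hmn (cinj h)⟩ F F
    have htl : ∀ n, μ.edges.length < (τ n).edges.length := fun n =>
      (List.getElem?_eq_some_iff.mp (t4 n)).1
    have hdiff0 : ∀ n, c n ∈ F → ZMinus μ F ∩ ZMinus (τ n) F = ∅ := by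
      intro n hn
      rw [Set.eq_empty_iff_forall_notMem]
      rintro p ⟨hp, hq⟩
      exact hp.2 (c n) hn ((hq.1.2 _ (htl n)).trans (t4 n))
    obtain ⟨Φ, hP, hFF⟩ := mkFam ![μ, τ 0, τ 1, τ 2] F μ.rng
      (all4 rfl (t2 0) (t2 1) (t2 2)) hF
      (by
        refine ⟨?_, fun hsub => hinf (hF.subset hsub)⟩
        rintro e (he | he)
        · exact he.2
        · rcases he with rfl | rfl | rfl <;> exact (hc _).1.1)
      (pair4 (fun i j h => by rw [Set.inter_comm]; exact h)
        (hdiff0 0 (by simp [F])) (hdiff0 1 (by simp [F])) (hdiff0 2 (by simp [F]))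
        (hdiff 0 1 (by simp)) (hdiff 0 2 (by simp)) (hdiff 1 2 (by simp)))
    have hZ : ∀ i, Φ.Z i = ZMinus ((![μ, τ 0, τ 1, τ 2] : Fin 4 → FinPath G) i) F := by
      intro i; simp only [Fam.Z, hP, hFF]
    refine ⟨Φ, ?_, ?_⟩
    · rw [hZ]
      refine ⟨⟨rfl, fun i _ => rfl⟩, fun e _ => ?_⟩
      simp [BPath.edgeAt]
    · have caseτ : ∀ n, (τ n).src = BPath.src (Sum.inl ⟨μ, hμ⟩ : BPath G) ∧
          (∀ m < N, ∀ e, BPath.edgeAt (Sum.inl ⟨μ, hμ⟩ : BPath G) m = some e →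
            (τ n).edges[m]? = some e) ∧ ZMinus (τ n) F ⊆ BN (Sum.inl ⟨μ, hμ⟩) N F₀ := by
        intro n
        have hag : ∀ m e, BPath.edgeAt (Sum.inl ⟨μ, hμ⟩ : BPath G) m = some e →
            (τ n).edges[m]? = some e := by
          intro m e he
          rw [t3 n m (List.getElem?_eq_some_iff.mp he).1]; exact he
        refine ⟨t1 n, fun m _ => hag m, fun q hq => ⟨hq.1.1.symm.trans (t1 n), ?_, ?_⟩⟩
        · intro m _ e he
          have := hag m e he
          rw [hq.1.2 m (List.getElem?_eq_some_iff.mp this).1, this]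
        · intro m hm e he hqe
          obtain rfl := isEnd_inl hm
          rw [hq.1.2 _ (htl n), t4 n] at hqe
          exact (hc n).2 (Option.some.inj hqe ▸ he)
      simp only [hZ, hP]
      refine all4 ⟨rfl, fun m _ e he => he, fun q hq => ⟨hq.1.1.symm, ?_, ?_⟩⟩
        (caseτ 0) (caseτ 1) (caseτ 2)
      · intro m _ e he
        rw [hq.1.2 m (List.getElem?_eq_some_iff.mp he).1]; exact he
      · intro m hm e he hqe
        obtain rfl := isEnd_inl hm
        exact hq.2 e (Or.inl ⟨he, pre_next hq.1 hqe⟩) hqe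
  · obtain ⟨m, hm, ν, hν1, hν2, hν3⟩ := keyA hK hW x N
    obtain ⟨m', hm', ρ, hρ1, hρ2, hρ3⟩ := keyA hK hW x m
    have q1 : (seg x 0 N).rng = (seg x N m).src := seg_rng x (by omega)
    have q2 : (seg x 0 N).rng = ν.src := (seg_rng x (by omega)).trans hν1.symm
    let A₀ := cat (seg x 0 N) (seg x N m) q1
    let A₁ := cat (seg x 0 N) ν q2
    have hA : Diff A₀ A₁ := Diff.cat_left hν3.symm q1 q2
    have r1 : A₀.rng = (seg x m m').src := by
      simp only [A₀]; rw [cat_rng, seg_rng x hm]; rfl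
    have r2 : A₀.rng = ρ.src := r1.trans hρ1.symm
    have r3 : A₁.rng = (seg x m m').src := by
      simp only [A₁]; rw [cat_rng, hν2]; rfl
    have r4 : A₁.rng = ρ.src := r3.trans hρ1.symm
    let P : Fin 4 → FinPath G := ![cat A₀ (seg x m m') r1, cat A₀ ρ r2, cat A₁ (seg x m m') r3,
      cat A₁ ρ r4]
    obtain ⟨Φ, hP, hFF⟩ := mkFam P ∅ (G.s (x.edges m'))
      (all4 ((cat_rng _ _ r1).trans (seg_rng x hm')) ((cat_rng _ _ r2).trans hρ2)
        ((cat_rng _ _ r3).trans (seg_rng x hm')) ((cat_rng _ _ r4).trans hρ2)) Set.finite_empty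
      (by
        refine ⟨by simp, fun hsub => ?_⟩
        exact hsub (show x.edges m' ∈ {e | G.s e = G.s (x.edges m')} from rfl))
      (pair4 (fun i j h => by rw [Set.inter_comm]; exact h)
        ((Diff.cat_left hρ3.symm r1 r2).disj _ _) ((hA.cat_right r1 r3).disj _ _)
        ((hA.cat_right r1 r4).disj _ _) ((hA.cat_right r2 r3).disj _ _)
        ((hA.cat_right r2 r4).disj _ _) ((Diff.cat_left hρ3.symm r3 r4).disj _ _))
    have hZ : ∀ i, Φ.Z i = ZMinus (P i) ∅ := by
      intro i; simp only [Fam.Z, hP, hFF]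
    have hPs : ∀ i, (P i).src = x.src := all4 rfl rfl rfl rfl
    have hPg : ∀ i, ∀ n < N, (P i).edges[n]? = some (x.edges n) := by
      have : ∀ l l' : List E, ∀ n < N, ((seg x 0 N).edges ++ l ++ l')[n]? = some (x.edges n) := by
        intro l l' n hn
        rw [List.append_assoc, List.getElem?_append_left (by rw [seg_len]; omega),
          seg_get x (by omega), Nat.zero_add]
      exact all4 (this _ _) (this _ _) (this _ _) (this _ _)
    refine ⟨Φ, ?_, ?_⟩
    · rw [hZ]
      refine ⟨⟨rfl, fun i hi => ?_⟩, by simp⟩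
      change i < ((seg x 0 N).edges ++ (seg x N m).edges ++ (seg x m m').edges).length at hi
      change some (x.edges i) =
        ((seg x 0 N).edges ++ (seg x N m).edges ++ (seg x m m').edges)[i]?
      simp only [List.length_append, seg_len] at hi
      by_cases h1 : i < N
      · rw [List.append_assoc, List.getElem?_append_left (by rw [seg_len]; omega),
          seg_get x (by omega), Nat.zero_add]
      · by_cases h2 : i < m
        · rw [List.append_assoc, List.getElem?_append_right (by rw [seg_len]; omega),
            List.getElem?_append_left (by simp only [seg_len]; omega),
            seg_len, seg_get x (by omega)]
          congr 2; omega
        · rw [List.getElem?_append_right (by rw [List.length_append, seg_len, seg_len]; omega),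
            List.length_append, seg_len, seg_len, seg_get x (by omega)]
          congr 2; omega
    · intro i
      rw [hZ, hP]
      refine ⟨hPs i, ?_, fun q hq => ⟨hq.1.1.symm.trans (hPs i), ?_, ?_⟩⟩
      · intro n hn e he
        rw [hPg i n hn]; exact he
      · intro n hn e he
        rw [hq.1.2 n (List.getElem?_eq_some_iff.mp (hPg i n hn)).1, hPg i n hn]; exact he
      · intro n hn
        simp [IsEnd, BPath.edgeAt] at hn

/-! ### The conditions imply (F1), (F2), (F3) -/

theorem dbl_mem {Γ : Subgroup (BPath G ≃ₜ BPath G)}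
    (hΓc : ∀ α β : BPath G ≃ₜ BPath G, InFullGroup G α → InFullGroup G β → ⁅α, β⁆ ∈ Γ)
    (Φ : Fam G 4) : Φ.hom dbl ∈ Γ := by
  rw [dbl_comm, map_commutatorElement]
  exact hΓc _ _ (Φ.hom_full _) (Φ.hom_full _)

theorem tri_mem {Γ : Subgroup (BPath G ≃ₜ BPath G)}
    (hΓc : ∀ α β : BPath G ≃ₜ BPath G, InFullGroup G α → InFullGroup G β → ⁅α, β⁆ ∈ Γ)
    (Φ : Fam G 4) : Φ.hom tri ∈ Γ := by
  rw [tri, map_commutatorElement]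
  exact hΓc _ _ (Φ.hom_full _) (Φ.hom_full _)

theorem shift_symm {P Q : FinPath G} {p q : BPath G} (hp : IsPrefixOf P p)
    (h : IsShiftedBy P Q p q) : IsShiftedBy Q P q p := ⟨hp, fun n => (h.2 n).symm⟩

theorem pre_of_cat {P b : FinPath G} (h : P.rng = b.src) {p : BPath G}
    (hp : IsPrefixOf (cat P b h) p) : IsPrefixOf P p := by
  refine ⟨hp.1, fun i hi => ?_⟩
  have := hp.2 i (by simp only [cat, List.length_append]; omega)
  simp only [cat] at this
  rwa [List.getElem?_append_left hi] at this

theorem shift_cat {P Q b : FinPath G} (hP : P.rng = b.src) (hQ : Q.rng = b.src) {p q : BPath G}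
    (hp : IsPrefixOf (cat P b hP) p) (h : IsShiftedBy (cat P b hP) (cat Q b hQ) p q) :
    IsShiftedBy P Q p q := by
  refine ⟨pre_of_cat hQ h.1, fun n => ?_⟩
  by_cases hn : n < b.edges.length
  · rw [hp.2 _ (by simp only [cat, List.length_append]; omega),
      h.1.2 _ (by simp only [cat, List.length_append]; omega)]
    simp only [cat]
    rw [List.getElem?_append_right (by omega), List.getElem?_append_right (by omega)]
    congr 1; omega
  · obtain ⟨m, rfl⟩ := Nat.exists_eq_add_of_le (not_lt.mp hn)
    have := h.2 m
    simpa only [cat, List.length_append, add_assoc] using this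

theorem app_sq {X : Type*} [TopologicalSpace X] {α : X ≃ₜ X} (h : α * α = 1) (x : X) :
    α (α x) = x := by
  have := congrArg (fun f : X ≃ₜ X => f x) h
  exact this

theorem backward (hs : ∀ v : V, ¬ IsSink G v)
    (Γ : Subgroup (BPath G ≃ₜ BPath G))
    (hΓ : ∀ γ ∈ Γ, InFullGroup G γ)
    (hΓc : ∀ α β : BPath G ≃ₜ BPath G, InFullGroup G α → InFullGroup G β → ⁅α, β⁆ ∈ Γ)
    (hK : CondK G) (hW : CondW G) (hI : CondInf G) : CondF1 Γ ∧ CondF2 Γ ∧ CondF3 Γ := by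
  refine ⟨?_, ?_, ?_⟩
  · intro x A hA hx
    obtain ⟨N, F, hF, hB⟩ := exists_bn hA.isOpen x hx
    obtain ⟨Φ, hx0, hΦ⟩ := four hs hK hW hI x N hF
    have hne : Φ.hom dbl x ≠ x := Φ.hom_ne (i := 0) (by decide) hx0
    refine ⟨Φ.hom dbl, dbl_mem hΓc Φ, ?_, ?_, subset_closure hne, ?_⟩
    · intro h; rw [h] at hne; exact hne rfl
    · rw [← map_mul, dbl_sq, map_one]
    · exact (Φ.supp_subset dbl).trans (Set.iUnion_subset fun i => (hΦ i).2.2.trans hB)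
  · intro α hα _ hsq A hA hAne hAs
    obtain ⟨x, hxA, hx⟩ : ∃ x ∈ A, α x ≠ x := by
      obtain ⟨a, ha⟩ := hAne
      obtain ⟨x, hx, hx'⟩ := mem_closure_iff.mp (hAs ha) A hA.isOpen ha
      exact ⟨x, hx, hx'⟩
    obtain ⟨k, μs, lams, Fs, h1, h2, h3, h4, h5, h6, h7, h8⟩ := hΓ α hα
    have hxS : x ∈ ⋃ i, ZMinus (lams i) (Fs i) := by
      by_contra hc
      exact hx (h8 x hc)
    obtain ⟨i, hi⟩ := Set.mem_iUnion.mp hxS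
    obtain ⟨U, hU, hxU, hαU⟩ := exists_sep (Ne.symm hx)
    have hO : IsOpen (A ∩ ZMinus (lams i) (Fs i) ∩ U ∩ α ⁻¹' Uᶜ) :=
      ((hA.isOpen.inter (zminus_open (h2 i) fun e he => by
        rw [← h1 i]; exact (h3 i).1 he)).inter hU.isOpen).inter
        (hU.compl.isOpen.preimage α.continuous)
    obtain ⟨N, F, hF, hB⟩ := exists_bn hO x ⟨⟨⟨hxA, hi⟩, hxU⟩, hαU⟩
    obtain ⟨Φ, hx0, hΦ⟩ := four hs hK hW hI x (N + (lams i).edges.length) hF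
    have hsub : ∀ j, Φ.Z j ⊆ A ∩ ZMinus (lams i) (Fs i) ∩ U ∩ α ⁻¹' Uᶜ := fun j =>
      ((hΦ j).2.2.trans (bn_mono (by omega) le_rfl)).trans hB
    have hsplit : ∀ j, ∃ (b : FinPath G) (hb : (lams i).rng = b.src),
        cat (lams i) b hb = Φ.P j := by
      intro j
      have hag : ∀ n < (lams i).edges.length, (Φ.P j).edges[n]? = (lams i).edges[n]? := by
        intro n hn
        have := hi.1.2 n hn
        rw [List.getElem?_eq_getElem hn] at this ⊢
        exact (hΦ j).2.1 n (by omega) _ this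
      have hle : (lams i).edges.length ≤ (Φ.P j).edges.length := by
        by_contra hc
        have := hag (Φ.P j).edges.length (by omega)
        rw [List.getElem?_eq_none le_rfl, List.getElem?_eq_getElem (by omega)] at this
        cases this
      obtain ⟨a, b, k1, k2, k3, k4, k5⟩ := fp_split (Φ.P j) _ hle
      have ha : a = lams i := by
        refine fp_ext (k1.trans ((hΦ j).1.trans hi.1.1.symm)) (List.ext_getElem? fun n => ?_)
        rw [k2, List.getElem?_take]
        split_ifs with hn
        · exact hag n hn
        · rw [List.getElem?_eq_none (by omega)]
      subst ha
      refine ⟨b, k4, fp_ext k1 ?_⟩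
      have hta := List.take_append_drop (lams i).edges.length (Φ.P j).edges
      rw [← k2, ← k3] at hta
      exact hta
    choose b hb hcat using hsplit
    have hb' : ∀ j, (μs i).rng = (b j).src := fun j => (h1 i).trans (hb j)
    let Q : Fin 4 → FinPath G := fun j => cat (μs i) (b j) (hb' j)
    have hQr : ∀ j, (Q j).rng = (Φ.P j).rng := fun j => by
      rw [← hcat j]; exact (cat_rng _ _ (hb' j)).trans (cat_rng _ _ (hb j)).symm
    have hshift' : ∀ j p q, p ∈ Φ.Z j → IsShiftedBy (Φ.P j) (Q j) p q → q = α p := by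
      intro j p q hp hq
      refine shift_unique ?_ (h7 i p (hsub j hp).1.1.2)
      have hp1 := hp.1
      rw [← hcat j] at hq hp1
      exact shift_cat _ _ hp1 hq
    have hback : ∀ j q, q ∈ ZMinus (Q j) Φ.F → ∃ p ∈ Φ.Z j, α p = q := by
      intro j q hq
      obtain ⟨p, hp⟩ := exists_shift (hQr j) hq.1
      have hpZ : p ∈ Φ.Z j := shift_mem hq hp
      exact ⟨p, hpZ, (hshift' j p q hpZ (shift_symm hq.1 hp)).symm⟩
    have hPQ : ∀ j l, ZMinus (Φ.P j) Φ.F ∩ ZMinus (Q l) Φ.F = ∅ := by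
      intro j l
      rw [Set.eq_empty_iff_forall_notMem]
      rintro q ⟨hq1, hq2⟩
      obtain ⟨p, hp, rfl⟩ := hback l q hq2
      exact (hsub l hp).2 (hsub j hq1).1.2
    have hQQ : ∀ j l, j ≠ l → ZMinus (Q j) Φ.F ∩ ZMinus (Q l) Φ.F = ∅ := by
      intro j l hjl
      rw [Set.eq_empty_iff_forall_notMem]
      rintro q ⟨hq1, hq2⟩
      obtain ⟨p, hp, rfl⟩ := hback j q hq1
      obtain ⟨p', hp', he⟩ := hback l _ hq2
      rw [α.injective he] at hp'
      exact hjl (Φ.Z_inj hp hp')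
    obtain ⟨Ψ, hP, hFF⟩ := mkFam ![Φ.P 0, Q 0, Φ.P 1, Q 1] Φ.F (Φ.P 0).rng
      (all4 rfl (hQr 0) (Φ.rng 1 0) ((hQr 1).trans (Φ.rng 1 0))) Φ.fin (Φ.prop 0)
      (pair4 (fun i j h => by rw [Set.inter_comm]; exact h)
        (hPQ 0 0) (Φ.disj 0 1 (by decide)) (hPQ 0 1) (by rw [Set.inter_comm]; exact hPQ 1 0)
        (hQQ 0 1 (by decide)) (hPQ 1 1))
    have hZ : ∀ j, Ψ.Z j =
        ZMinus ((![Φ.P 0, Q 0, Φ.P 1, Q 1] : Fin 4 → FinPath G) j) Φ.F := by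
      intro j; simp only [Fam.Z, hP, hFF]
    have hZ0 : Ψ.Z 0 = Φ.Z 0 := hZ 0
    have hZ1 : Ψ.Z 1 = ZMinus (Q 0) Φ.F := hZ 1
    have hZ2 : Ψ.Z 2 = Φ.Z 1 := hZ 2
    have hZ3 : Ψ.Z 3 = ZMinus (Q 1) Φ.F := hZ 3
    have hββ : Ψ.hom dbl * Ψ.hom dbl = 1 := by rw [← map_mul, dbl_sq, map_one]
    have act0 : ∀ p ∈ Ψ.Z 0, Ψ.hom dbl p = α p := by
      intro p hp
      have := Ψ.act_shift dbl hp
      rw [hP] at this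
      exact hshift' 0 p _ (hZ0 ▸ hp) this
    have act2 : ∀ p ∈ Ψ.Z 2, Ψ.hom dbl p = α p := by
      intro p hp
      have := Ψ.act_shift dbl hp
      rw [hP] at this
      exact hshift' 1 p _ (hZ2 ▸ hp) this
    have hne : Ψ.hom dbl x ≠ x := Ψ.hom_ne (i := 0) (by decide) (hZ0 ▸ hx0)
    refine ⟨Ψ.hom dbl, dbl_mem hΓc Ψ, ?_, ?_, ?_⟩
    · intro h; rw [h] at hne; exact hne rfl
    · refine (Ψ.supp_subset dbl).trans (Set.iUnion_subset (all4 ?_ ?_ ?_ ?_))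
      · rw [hZ0]; exact fun p hp => Or.inl (hsub 0 hp).1.1.1
      · rw [hZ1]
        intro q hq
        obtain ⟨p, hp, rfl⟩ := hback 0 q hq
        exact Or.inr ⟨p, (hsub 0 hp).1.1.1, rfl⟩
      · rw [hZ2]; exact fun p hp => Or.inl (hsub 1 hp).1.1.1
      · rw [hZ3]
        intro q hq
        obtain ⟨p, hp, rfl⟩ := hback 1 q hq
        exact Or.inr ⟨p, (hsub 1 hp).1.1.1, rfl⟩
    · intro p hp
      obtain ⟨j, hj⟩ := Set.mem_iUnion.mp (Ψ.supp_subset dbl hp)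
      revert hj
      refine all4 (R := fun j => p ∈ Ψ.Z j → Ψ.hom dbl p = α p) (act0 p) ?_ (act2 p) ?_ j
      · intro hj
        rw [hZ1] at hj
        obtain ⟨q, hq, rfl⟩ := hback 0 p hj
        rw [app_sq hsq, ← act0 q (hZ0 ▸ hq), app_sq hββ]
      · intro hj
        rw [hZ3] at hj
        obtain ⟨q, hq, rfl⟩ := hback 1 p hj
        rw [app_sq hsq, ← act2 q (hZ2 ▸ hq), app_sq hββ]
  · intro A hA hAne
    obtain ⟨x, hx⟩ := hAne
    obtain ⟨N, F, hF, hB⟩ := exists_bn hA.isOpen x hx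
    obtain ⟨Φ, hx0, hΦ⟩ := four hs hK hW hI x N hF
    refine ⟨Φ.hom tri, tri_mem hΓc Φ, ?_, ?_⟩
    · exact (Φ.supp_subset tri).trans (Set.iUnion_subset fun i => (hΦ i).2.2.trans hB)
    · intro h
      rw [← map_mul] at h
      have hne : Φ.hom (tri * tri) x ≠ x := Φ.hom_ne (i := 0) tri_sq hx0
      rw [h] at hne
      exact hne rfl

/-! ### (F1) implies the conditions -/

theorem supp_local {α : BPath G ≃ₜ BPath G} (hα : InFullGroup G α) {x : BPath G}
    (hx : x ∈ Supp α) : ∃ (lam μ : FinPath G) (F : Set E), μ.rng = lam.rng ∧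
      x ∈ ZMinus lam F ∧ IsOpen (ZMinus lam F) ∧
      (∀ p ∈ ZMinus lam F, IsShiftedBy lam μ p (α p)) ∧ lam ≠ μ := by
  obtain ⟨k, μs, lams, Fs, h1, h2, h3, h4, h5, h6, h7, h8⟩ := hα
  have hcl : ∀ i, IsClopen (ZMinus (lams i) (Fs i)) := fun i =>
    zminus_clopen (h2 i) fun e he => by rw [← h1 i]; exact (h3 i).1 he
  have hS : IsClopen (⋃ i, ZMinus (lams i) (Fs i)) := isClopen_iUnion_of_finite hcl
  have hxS : x ∈ ⋃ i, ZMinus (lams i) (Fs i) := by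
    by_contra hc
    obtain ⟨y, hy, hy'⟩ := mem_closure_iff.mp hx _ hS.compl.isOpen hc
    exact hy' (h8 y hy)
  obtain ⟨i, hi⟩ := Set.mem_iUnion.mp hxS
  refine ⟨lams i, μs i, Fs i, h1 i, hi, (hcl i).isOpen, h7 i, fun heq => ?_⟩
  obtain ⟨y, hy, hy'⟩ := mem_closure_iff.mp hx _ (hcl i).isOpen hi
  have := h7 i y hy
  rw [← heq] at this
  exact hy' (shift_unique this (shift_refl hy.1))

theorem supp_image {X : Type*} [TopologicalSpace X] {α : X ≃ₜ X} {A : Set X} (h : Supp α ⊆ A)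
    {x : X} (hx : x ∈ A) : α x ∈ A := by
  by_cases hf : α x = x
  · rwa [hf]
  · exact h (subset_closure fun h' => hf (α.injective h'))

theorem forwardInf {Γ : Subgroup (BPath G ≃ₜ BPath G)} (hΓ : ∀ γ ∈ Γ, InFullGroup G γ)
    (h1 : CondF1 Γ) : CondInf G := by
  intro v hv hfin
  let F := {e : E | G.s e = v ∧ Reaches G (G.r e) v}
  let x : BPath G := Sum.inl ⟨trivialPath G v, Or.inr hv⟩
  have hxA : x ∈ ZMinus (trivialPath G v) F :=
    ⟨⟨rfl, fun i _ => rfl⟩, fun e _ => by simp [x, BPath.edgeAt, trivialPath]⟩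
  obtain ⟨α, hα, -, -, hxs, hsub⟩ := h1 x (ZMinus (trivialPath G v) F)
    (zminus_clopen hfin fun e he => he.1) hxA
  obtain ⟨lam, μ, F', hr, hx, -, hsh, hne⟩ := supp_local (hΓ α hα) hxs
  have hαx := supp_image hsub hxA
  have hl : lam.edges = [] := by
    by_contra hc
    have hlt : 0 < lam.edges.length := List.length_pos_iff.mpr hc
    have := hx.1.2 0 hlt
    rw [List.getElem?_eq_getElem hlt] at this
    simp [x, BPath.edgeAt, trivialPath] at this
  have hls : lam.src = v := hx.1.1
  have hμs : μ.src = v := (hsh x hx).1.1.trans hαx.1.1.symm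
  have hμr : μ.rng = v := by rw [hr, rng_nil hl, hls]
  apply hne
  refine fp_ext (hls.trans hμs.symm) ?_
  rw [hl]
  by_contra hc
  have hlt : 0 < μ.edges.length := List.length_pos_iff.mpr (Ne.symm hc)
  obtain ⟨a, b, k1, k2, k3, k4, k5⟩ := fp_split μ 1 hlt
  have h0 : μ.edges[0]? = some μ.edges[0] := List.getElem?_eq_getElem hlt
  have hαe := (hsh x hx).1.2 0 hlt
  rw [h0] at hαe
  refine hαx.2 μ.edges[0] ⟨(fp_zero h0).trans hμs, b, ?_, k5.trans hμr⟩ hαe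
  rw [← k4]
  refine rng_last (n := 0) (by rw [k2, List.length_take]; omega) ?_
  rw [k2, List.getElem?_take, if_pos (by omega), h0]

theorem forwardW {Γ : Subgroup (BPath G ≃ₜ BPath G)} (hΓ : ∀ γ ∈ Γ, InFullGroup G γ)
    (h1 : CondF1 Γ) : CondW G := by
  intro x _
  let A := ZSet (trivialPath G x.src)
  have hxA : (Sum.inr x : BPath G) ∈ A := ⟨rfl, by simp [trivialPath]⟩
  obtain ⟨α, hα, -, -, hxs, hsub⟩ := h1 (Sum.inr x) A (zset_clopen _) hxA
  obtain ⟨lam, μ, F', hr, hx, -, hsh, hne⟩ := supp_local (hΓ α hα) hxs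
  have hαx := supp_image hsub hxA
  have hls : lam.src = x.src := hx.1.1
  have hμs : μ.src = x.src := (hsh _ hx).1.1.trans hαx.1.symm
  rcases hl : lam.edges.length with _ | n
  · have hl0 := List.length_eq_zero_iff.mp hl
    have e1 : lam.rng = (seg x 0 1).src := by rw [rng_nil hl0, hls]; rfl
    have e2 : μ.rng = (seg x 0 1).src := hr.trans e1
    have hsr : (seg x 0 1).rng = G.r (x.edges 0) := by rw [seg_rng x (by omega), x.chain]
    refine ⟨0, cat lam _ e1, cat μ _ e2, ?_, hls, hμs, (cat_rng _ _ _).trans hsr,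
      (cat_rng _ _ _).trans hsr⟩
    intro heq
    apply hne
    refine fp_ext (hls.trans hμs.symm) ?_
    have := congrArg FinPath.edges heq
    simpa [cat] using this
  · have hlr : lam.rng = G.r (x.edges n) := by
      refine rng_last hl ?_
      rw [← hx.1.2 n (by omega)]; rfl
    exact ⟨n, lam, μ, hne, hls, hμs, hlr, hr.trans hlr⟩

/-- A boundary path visiting `v` infinitely often. -/
def Visits (G : DGraph V E) (v : V) (y : BPath G) : Prop :=
  ∀ N, ∃ n, N ≤ n ∧ ∃ e, y.edgeAt n = some e ∧ G.s e = v

theorem first_return {v : V} {y : InfPath G} (hs : y.src = v)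
    (hv : Visits G v (Sum.inr y)) : ∃ m, 0 < m ∧ G.s (y.edges m) = v ∧
      (seg y 0 m).IsReturnPath := by
  classical
  have hex : ∃ m, 0 < m ∧ G.s (y.edges m) = v := by
    obtain ⟨n, hn, e, he, hse⟩ := hv 1
    refine ⟨n, hn, ?_⟩
    rw [← hse, ← Option.some.inj he]
  obtain ⟨h1, h2⟩ := Nat.find_spec hex
  refine ⟨Nat.find hex, h1, h2, ⟨⟨?_, ?_⟩, ?_⟩⟩
  · intro h0
    have := seg_len y 0 (Nat.find hex)
    rw [h0] at this; simp only [List.length_nil] at this; omega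
  · exact (seg_rng y (by omega)).trans (h2.trans hs.symm)
  · intro i hi heq
    rw [seg_len] at hi
    have hg := seg_get y (N := 0) (m := Nat.find hex) (i := i) (by omega)
    obtain ⟨_, hg⟩ := List.getElem?_eq_some_iff.mp hg
    rw [List.get_eq_getElem, hg, seg_rng y (by omega), h2, y.chain] at heq
    refine Nat.find_min hex (m := i + 1) (by omega) ⟨by omega, ?_⟩
    rw [← heq]; congr 2; omega

theorem visits_unique {v : V} (hu : ∀ τ ρ : FinPath G, τ.IsReturnPath → ρ.IsReturnPath →
      τ.src = v → ρ.src = v → τ = ρ) {y y' : BPath G} (hs : y.src = v) (hs' : y'.src = v)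
    (hv : Visits G v y) (hv' : Visits G v y') : y = y' := by
  have aux : ∀ n, ∀ y y' : InfPath G, y.src = v → y'.src = v → Visits G v (Sum.inr y) →
      Visits G v (Sum.inr y') → y.edges n = y'.edges n := by
    intro n
    induction n using Nat.strong_induction_on with
    | _ n ih =>
      intro y y' hs hs' hv hv'
      obtain ⟨m, hm, hm2, hmr⟩ := first_return hs hv
      obtain ⟨m', hm', hm2', hmr'⟩ := first_return hs' hv'
      have heq := hu _ _ hmr hmr' hs hs'
      have hmm : m = m' := by
        have := congrArg (fun μ : FinPath G => μ.edges.length) heq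
        simpa only [seg_len, Nat.sub_zero] using this
      subst hmm
      by_cases hn : n < m
      · have a := seg_get y (N := 0) (m := m) (i := n) (by omega)
        have b := seg_get y' (N := 0) (m := m) (i := n) (by omega)
        rw [heq, b] at a
        simpa using (Option.some.inj a).symm
      · have sh : ∀ z : InfPath G, Visits G v (Sum.inr z) →
            Visits G v (Sum.inr ⟨fun n => z.edges (m + n), fun i => z.chain (m + i)⟩) := by
          intro z hz N
          obtain ⟨j, hj, e, he, hse⟩ := hz (m + N)
          refine ⟨j - m, by omega, e, ?_, hse⟩
          rw [← he]
          simp only [BPath.edgeAt]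
          congr 2; omega
        have := ih (n - m) (by omega) ⟨fun n => y.edges (m + n), fun i => y.chain (m + i)⟩
          ⟨fun n => y'.edges (m + n), fun i => y'.chain (m + i)⟩ hm2 hm2' (sh y hv) (sh y' hv')
        simp only at this
        rwa [show m + (n - m) = n by omega] at this
  have noinl : ∀ p, ¬ Visits G v (Sum.inl p : BPath G) := by
    intro p hp
    obtain ⟨n, hn, e, he, -⟩ := hp p.1.edges.length
    have := (List.getElem?_eq_some_iff.mp he).1
    omega
  rcases y with p | y
  · exact (noinl p hv).elim
  rcases y' with p | y'
  · exact (noinl p hv').elim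
  exact bp_ext (hs.trans hs'.symm) fun n => congrArg some (aux n y y' hs hs' hv hv')

theorem exists_visits (τ : FinPath G) (hτ : τ.IsCycle) :
    ∃ x : BPath G, x.src = τ.src ∧ Visits G τ.src x := by
  have hl : 0 < τ.edges.length := List.length_pos_iff.mpr hτ.1
  let f : ℕ → E := fun n => τ.edges[n % τ.edges.length]'(Nat.mod_lt _ hl)
  have hf0 : ∀ n, n % τ.edges.length = 0 → G.s (f n) = τ.src := by
    intro n hn
    apply fp_zero
    simp only [f, hn]
    exact List.getElem?_eq_getElem hl
  let x : InfPath G := ⟨f, by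
    intro n
    have hg : τ.edges[n % τ.edges.length]? = some (f n) := List.getElem?_eq_getElem _
    by_cases h : n % τ.edges.length + 1 = τ.edges.length
    · rw [← rng_last h.symm hg, hτ.2, hf0]
      rw [← Nat.mod_add_mod, h, Nat.mod_self]
    · have hlt := Nat.mod_lt n hl
      have hm : (n + 1) % τ.edges.length = n % τ.edges.length + 1 := by
        rw [← Nat.mod_add_mod, Nat.mod_eq_of_lt (by omega)]
      refine fp_succ hg ?_
      rw [← hm]
      exact List.getElem?_eq_getElem _⟩
  refine ⟨Sum.inr x, hf0 0 (by simp), fun N => ⟨N * τ.edges.length, ?_, f _, rfl, hf0 _ (by simp)⟩⟩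
  exact Nat.le_mul_of_pos_right N hl

theorem forwardK {Γ : Subgroup (BPath G ≃ₜ BPath G)} (hΓ : ∀ γ ∈ Γ, InFullGroup G γ)
    (h1 : CondF1 Γ) : CondK G := by
  intro v
  by_contra hcon
  push Not at hcon
  obtain ⟨⟨τ, hτ, hτv⟩, hu'⟩ := hcon
  have hu : ∀ τ ρ : FinPath G, τ.IsReturnPath → ρ.IsReturnPath →
      τ.src = v → ρ.src = v → τ = ρ := by
    intro τ ρ a b c d
    by_contra hne
    exact hu' τ ρ hne a b c d
  obtain ⟨x, hxs, hxv⟩ := exists_visits τ hτ.1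
  rw [hτv] at hxs hxv
  let A := ZSet (trivialPath G v)
  have hxA : x ∈ A := ⟨hxs.symm, by simp [trivialPath]⟩
  obtain ⟨α, hα, -, hsq, hxs', hsub⟩ := h1 x A (zset_clopen _) hxA
  obtain ⟨lam, μ, F', hr, hx, hop, hsh, hne⟩ := supp_local (hΓ α hα) hxs'
  have hαx := supp_image hsub hxA
  have hfix : α x = x := by
    refine visits_unique hu hαx.1.symm hxs (fun N => ?_) hxv
    obtain ⟨n, hn, e, he, hse⟩ := hxv (lam.edges.length + N)
    refine ⟨μ.edges.length + (n - lam.edges.length), by omega, e, ?_, hse⟩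
    rw [← (hsh x hx).2, ← he]
    congr 1; omega
  have hlen : lam.edges.length ≠ μ.edges.length := by
    intro h
    refine hne (pre_eq hx.1 ?_ h)
    have := (hsh x hx).1
    rwa [hfix] at this
  have hper : ∃ i₀ k, 0 < k ∧ ∀ y, y ∈ ZMinus lam F' → α y ∈ ZMinus lam F' →
      ∀ n, y.edgeAt (i₀ + n) = y.edgeAt (i₀ + (2 * k + n)) := by
    rcases lt_or_gt_of_ne hlen with h | h
    · refine ⟨lam.edges.length, μ.edges.length - lam.edges.length, by omega, ?_⟩
      intro y hy hy' n
      have a := (hsh y hy).2 n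
      have b := (hsh _ hy').2 (μ.edges.length - lam.edges.length + n)
      rw [app_sq hsq] at b
      rw [a, show μ.edges.length + n =
        lam.edges.length + (μ.edges.length - lam.edges.length + n) by omega, b]
      congr 1; omega
    · refine ⟨μ.edges.length, lam.edges.length - μ.edges.length, by omega, ?_⟩
      intro y hy hy' n
      have a := (hsh y hy).2 (lam.edges.length - μ.edges.length + n)
      have b := (hsh _ hy').2 n
      rw [app_sq hsq] at b
      rw [← b, show lam.edges.length + n =
        μ.edges.length + (lam.edges.length - μ.edges.length + n) by omega, ← a]
      congr 1; omega
  obtain ⟨i₀, k, hk, hper⟩ := hper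
  obtain ⟨j, hj, e, he, hse⟩ := hxv i₀
  have hnb : ZMinus lam F' ∩ α ⁻¹' (ZMinus lam F') ∩ BN x (j + 1) ∅ ∈ 𝓝 x := by
    refine Filter.inter_mem (Filter.inter_mem (hop.mem_nhds hx) ?_) (bn_nhds x _ Set.finite_empty)
    exact (hop.preimage α.continuous).mem_nhds (by rw [Set.mem_preimage, hfix]; exact hx)
  obtain ⟨y, ⟨⟨hy1, hy2⟩, hy3⟩, hym⟩ := mem_closure_iff_nhds.mp hxs' _ hnb
  have hyv : Visits G v y := by
    have hall : ∀ t, y.edgeAt (j + 2 * k * t) = some e := by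
      intro t
      induction t with
      | zero => exact hy3.2.1 j (by omega) e he
      | succ t ih =>
        rw [← ih]
        have := hper y hy1 hy2 (j - i₀ + 2 * k * t)
        rw [show i₀ + (j - i₀ + 2 * k * t) = j + 2 * k * t by omega] at this
        rw [this]
        congr 1
        rw [Nat.mul_succ]; omega
    intro N
    refine ⟨j + 2 * k * N, ?_, e, hall N, hse⟩
    have : N ≤ 2 * k * N := Nat.le_mul_of_pos_left N (by omega)
    omega
  have hyx : y = x := visits_unique hu (hy3.1.trans hxs) hxs hyv hxv
  rw [hyx] at hym
  exact hym hfix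

end S4


/-- Let `E` be a graph with no sinks and `Γ` a subgroup of the topological
full group `G_E` containing the commutator subgroup of `G_E`. Then `(Γ, ∂E)` satisfies
conditions (F1), (F2) and (F3) if and only if `E` satisfies Conditions (K), (W) and (∞). -/
theorem statement4 (G : DGraph V E) (hs : ∀ v : V, ¬ IsSink G v)
    (Γ : Subgroup (BPath G ≃ₜ BPath G))
    (hΓ : ∀ γ ∈ Γ, InFullGroup G γ)
    (hΓc : ∀ α β : BPath G ≃ₜ BPath G, InFullGroup G α → InFullGroup G β → ⁅α, β⁆ ∈ Γ) :
    (CondF1 Γ ∧ CondF2 Γ ∧ CondF3 Γ) ↔ (CondK G ∧ CondW G ∧ CondInf G) := by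
  constructor
  · rintro ⟨h1, -, -⟩
    exact ⟨S4.forwardK hΓ h1, S4.forwardW hΓ h1, S4.forwardInf hΓ h1⟩
  · rintro ⟨hK, hW, hI⟩
    exact S4.backward hs Γ hΓ hΓc hK hW hI
end
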